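/- For every integer d ≥ 5, setting A(k) = binom(k+d−3, d−2)·(d−2)·(k−1)·(k−2)/(2d) and B(k) = binom(k+d−2, d−1)·(d−1)·(k−1)/d, one has dim_ℂ (Syz_d / Kos_d) = A(m)·A(n) + A(m)·B(n) + B(m)·A(n). (This is the degree-d part of the first Koszul homology of the 2×2 minors.) -/

import Mathlib

open MvPolynomial

/-- Index set for the 2×2 minors of a generic `m × n` matrix:
quadruples `((i,i'),(j,j'))` with `i < i'` and `j < j'`. -/
def MinorIdx (m n : ℕ) : Type :=
  {w : (Fin m × Fin m) × (Fin n × Fin n) // w.1.1 < w.1.2 ∧ w.2.1 < w.2.2}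

instance (m n : ℕ) : Fintype (MinorIdx m n) := by unfold MinorIdx; infer_instance

instance (m n : ℕ) : DecidableEq (MinorIdx m n) := by unfold MinorIdx; infer_instance

/-- The 2×2 minor `Δ_{(i,i'),(j,j')} = x_{i,j} x_{i',j'} - x_{i,j'} x_{i',j}`. -/
noncomputable def minorΔ {m n : ℕ} (w : MinorIdx m n) : MvPolynomial (Fin m × Fin n) ℂ :=
  X (w.1.1.1, w.1.2.1) * X (w.1.1.2, w.1.2.2) - X (w.1.1.1, w.1.2.2) * X (w.1.1.2, w.1.2.1)

/-- `Syz_d`: the ℂ-vector space of degree-`d` syzygies of the 2×2 minors, i.e.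
families `c = (c_w)` of homogeneous polynomials of degree `d - 2` with
`∑_w c_w Δ_w = 0`. -/
noncomputable def Syz (m n d : ℕ) :
    Submodule ℂ (MinorIdx m n → MvPolynomial (Fin m × Fin n) ℂ) where
  carrier := {c | (∀ w, c w ∈ homogeneousSubmodule (Fin m × Fin n) ℂ (d - 2)) ∧
    ∑ w, c w * minorΔ w = 0}
  zero_mem' := by
    refine ⟨fun w => Submodule.zero_mem _, ?_⟩
    simp
  add_mem' := by
    rintro a b ⟨ha1, ha2⟩ ⟨hb1, hb2⟩
    refine ⟨fun w => Submodule.add_mem _ (ha1 w) (hb1 w), ?_⟩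
    simp only [Pi.add_apply, add_mul]
    rw [Finset.sum_add_distrib, ha2, hb2, add_zero]
  smul_mem' := by
    rintro r a ⟨ha1, ha2⟩
    refine ⟨fun w => Submodule.smul_mem _ r (ha1 w), ?_⟩
    simp only [Pi.smul_apply, smul_mul_assoc]
    rw [← Finset.smul_sum, ha2, smul_zero]

/-- The `S`-submodule of the free module `F = ⊕_w S·e_w` generated by the
Koszul syzygies `Δ_{w'}·e_w − Δ_w·e_{w'}`. -/
noncomputable def KosMod (m n : ℕ) :
    Submodule (MvPolynomial (Fin m × Fin n) ℂ)
      (MinorIdx m n → MvPolynomial (Fin m × Fin n) ℂ) :=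
  Submodule.span _ {k | ∃ w w' : MinorIdx m n,
    k = Pi.single w (minorΔ w') - Pi.single w' (minorΔ w)}

/-- `Kos_d`: the space of degree-`d` syzygies lying in the `S`-submodule
generated by the Koszul syzygies. -/
noncomputable def Kos (m n d : ℕ) :
    Submodule ℂ (MinorIdx m n → MvPolynomial (Fin m × Fin n) ℂ) :=
  Syz m n d ⊓ Submodule.restrictScalars ℂ (KosMod m n)



set_option linter.unusedSimpArgs false
set_option linter.unusedVariables false
set_option maxHeartbeats 1000000
set_option synthInstance.maxHeartbeats 200000

/-- Abstract data of the degree-two generators of the quotient of the free module by Koszul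
relations. -/
structure Dat (α β S Q : Type) [CommRing S] [AddCommGroup Q] [Module S Q] where
  x : α → β → S
  e : α → α → β → β → Q
  ev : Q →ₗ[S] S
  anti1 : ∀ i j p q, e i j p q = - e j i p q
  anti2 : ∀ i j p q, e i j p q = - e i j q p
  ev_e : ∀ i j p q, ev (e i j p q) = x i p * x j q - x i q * x j p
  comm : ∀ i j p q i' j' p' q', (x i p * x j q - x i q * x j p) • e i' j' p' q' =
    (x i' p' * x j' q' - x i' q' * x j' p') • e i j p q
  kill : ∀ i j p q h, ev h = 0 → (x i p * x j q - x i q * x j p) • h = 0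

namespace Dat

variable {α β S Q : Type} [CommRing S] [AddCommGroup Q] [Module S Q]

/-- The transposed data. -/
def tr (D : Dat α β S Q) : Dat β α S Q where
  x := fun p i => D.x i p
  e := fun p q i j => D.e i j p q
  ev := D.ev
  anti1 := fun p q i j => D.anti2 i j p q
  anti2 := fun p q i j => D.anti1 i j p q
  ev_e := fun p q i j => by rw [D.ev_e]; ring
  comm := fun p q i j p' q' i' j' => by
    have h := D.comm i j p q i' j' p' q'
    rw [mul_comm (D.x i q), mul_comm (D.x i' q')] at h
    exact h
  kill := fun p q i j h hh => by
    have h := D.kill i j p q h hh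
    rw [mul_comm (D.x i q)] at h
    exact h

variable (D : Dat α β S Q)

/-- Laplace expansion along a column. -/
def E (i j k : α) (r p q : β) : Q :=
  D.x i r • D.e j k p q - D.x j r • D.e i k p q + D.x k r • D.e i j p q

/-- Linear syzygies. -/
def lam (i j k : α) (r p q : β) : Q := D.E i j k r p q + D.E i j k p r q

/-- Basic quadratic syzygies. -/
def Eh (u i j k : α) (p q r v : β) : Q :=
  D.x u v • D.lam i j k r p q + D.x u r • D.lam i j k v p q - D.x u p • D.lam i j k r v q

def Al (l i j k : α) (v r p q : β) : Q :=
  D.x l v • D.lam i j k r p q - D.x i v • D.lam l j k r p q - D.x j v • D.lam i l k r p q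
    - D.x k v • D.lam i j l r p q

def kap (u i j k : α) (r p q v : β) : Q :=
  D.x u q • D.lam i j k r p v + D.x u v • D.lam i j k r p q + D.x u p • D.lam i j k q v r
    + D.x u r • D.lam i j k q v p

theorem ev_E (i j k r p q) : D.ev (D.E i j k r p q) =
    D.x i r * (D.x j p * D.x k q - D.x j q * D.x k p)
    - D.x j r * (D.x i p * D.x k q - D.x i q * D.x k p)
    + D.x k r * (D.x i p * D.x j q - D.x i q * D.x j p) := by
  simp [E, D.ev_e]

theorem ev_lam (i j k r p q) : D.ev (D.lam i j k r p q) = 0 := by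
  rw [lam, map_add, ev_E, ev_E]; ring

theorem ev_Eh (u i j k p q r v) : D.ev (D.Eh u i j k p q r v) = 0 := by
  simp [Eh, ev_lam]

theorem lam_symm (i j k r p q) : D.lam i j k r p q = D.lam i j k p r q := by
  simp [lam, add_comm]

theorem lam_cyc (i j k r p q) : D.lam i j k r p q + D.lam i j k p q r + D.lam i j k q r p = 0 := by
  simp only [lam, E]
  simp only [D.anti2 _ _ q p, D.anti2 _ _ r p, D.anti2 _ _ q r]
  module

theorem lam_12 (i j k r p q) : D.lam i j k r p q = - D.lam j i k r p q := by
  simp only [lam, E]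
  simp only [D.anti1 j i]
  module

theorem lam_23 (i j k r p q) : D.lam i j k r p q = - D.lam i k j r p q := by
  simp only [lam, E]
  simp only [D.anti1 k j]
  module

theorem Eh_symm (u i j k p q r v) : D.Eh u i j k p q r v = D.Eh u i j k p q v r := by
  simp only [Eh, D.lam_symm i j k r v q]; module

theorem Eh_12 (u i j k p q r v) : D.Eh u i j k p q r v = - D.Eh u j i k p q r v := by
  simp only [Eh, D.lam_12 i j k]; module

theorem Eh_23 (u i j k p q r v) : D.Eh u i j k p q r v = - D.Eh u i k j p q r v := by
  simp only [Eh, D.lam_23 i j k]; module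

theorem swap_kill (i j p q) (h : Q) (hh : D.ev h = 0) :
    (D.x i p * D.x j q) • h = (D.x i q * D.x j p) • h := by
  have := D.kill i j p q h hh
  rw [sub_smul] at this
  exact sub_eq_zero.1 this

section
variable (u i j k : α) (p q r v : β)

theorem Al_1 : D.Al u i j k v r p q = D.Al u i j k q r p v := by
  have a1 : ∀ p q, D.e i u p q = - D.e u i p q := fun p q => D.anti1 _ _ _ _
  have a2 : ∀ p q, D.e j u p q = - D.e u j p q := fun p q => D.anti1 _ _ _ _
  have a3 : ∀ p q, D.e k u p q = - D.e u k p q := fun p q => D.anti1 _ _ _ _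
  have b1 : ∀ a b, D.e a b q p = - D.e a b p q := fun p q => D.anti2 _ _ _ _
  have b2 : ∀ a b, D.e a b r p = - D.e a b p r := fun p q => D.anti2 _ _ _ _
  have b3 : ∀ a b, D.e a b v p = - D.e a b p v := fun p q => D.anti2 _ _ _ _
  have b4 : ∀ a b, D.e a b r q = - D.e a b q r := fun p q => D.anti2 _ _ _ _
  have b5 : ∀ a b, D.e a b v q = - D.e a b q v := fun p q => D.anti2 _ _ _ _
  have b6 : ∀ a b, D.e a b v r = - D.e a b r v := fun p q => D.anti2 _ _ _ _
  simp only [Al, lam, E, a1, a2, a3, b1, b2, b3, b4, b5, b6]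
  linear_combination (norm := module) D.comm u i p q j k r v + D.comm u i p v j k q r - D.comm u i q r j k p v - D.comm u i r v j k p q - D.comm u j p q i k r v - D.comm u j p v i k q r + D.comm u j q r i k p v + D.comm u j r v i k p q + D.comm u k p q i j r v + D.comm u k p v i j q r - D.comm u k q r i j p v - D.comm u k r v i j p q

theorem Al_2 : D.Al u i j k v r p q = D.Al u i j k p q v r := by
  have a1 : ∀ p q, D.e i u p q = - D.e u i p q := fun p q => D.anti1 _ _ _ _
  have a2 : ∀ p q, D.e j u p q = - D.e u j p q := fun p q => D.anti1 _ _ _ _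
  have a3 : ∀ p q, D.e k u p q = - D.e u k p q := fun p q => D.anti1 _ _ _ _
  have b1 : ∀ a b, D.e a b q p = - D.e a b p q := fun p q => D.anti2 _ _ _ _
  have b2 : ∀ a b, D.e a b r p = - D.e a b p r := fun p q => D.anti2 _ _ _ _
  have b3 : ∀ a b, D.e a b v p = - D.e a b p v := fun p q => D.anti2 _ _ _ _
  have b4 : ∀ a b, D.e a b r q = - D.e a b q r := fun p q => D.anti2 _ _ _ _
  have b5 : ∀ a b, D.e a b v q = - D.e a b q v := fun p q => D.anti2 _ _ _ _
  have b6 : ∀ a b, D.e a b v r = - D.e a b r v := fun p q => D.anti2 _ _ _ _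
  simp only [Al, lam, E, a1, a2, a3, b1, b2, b3, b4, b5, b6]
  linear_combination (norm := module) D.comm u i p q j k r v - D.comm u i r v j k p q - D.comm u j p q i k r v + D.comm u j r v i k p q + D.comm u k p q i j r v - D.comm u k r v i j p q

theorem kap_eq_Al : D.kap u i j k r p q v = D.Al u i j k v r p q := by
  have a1 : ∀ p q, D.e i u p q = - D.e u i p q := fun p q => D.anti1 _ _ _ _
  have a2 : ∀ p q, D.e j u p q = - D.e u j p q := fun p q => D.anti1 _ _ _ _
  have a3 : ∀ p q, D.e k u p q = - D.e u k p q := fun p q => D.anti1 _ _ _ _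
  have b1 : ∀ a b, D.e a b q p = - D.e a b p q := fun p q => D.anti2 _ _ _ _
  have b2 : ∀ a b, D.e a b r p = - D.e a b p r := fun p q => D.anti2 _ _ _ _
  have b3 : ∀ a b, D.e a b v p = - D.e a b p v := fun p q => D.anti2 _ _ _ _
  have b4 : ∀ a b, D.e a b r q = - D.e a b q r := fun p q => D.anti2 _ _ _ _
  have b5 : ∀ a b, D.e a b v q = - D.e a b q v := fun p q => D.anti2 _ _ _ _
  have b6 : ∀ a b, D.e a b v r = - D.e a b r v := fun p q => D.anti2 _ _ _ _
  simp only [Al, kap, lam, E, a1, a2, a3, b1, b2, b3, b4, b5, b6]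
  linear_combination (norm := module) (-1 : ℤ) • D.comm u i p q j k r v + D.comm u i q r j k p v + D.comm u j p q i k r v - D.comm u j q r i k p v - D.comm u k p q i j r v + D.comm u k q r i j p v

theorem VW_cyc : D.Eh u i j k p q r v + D.Eh u i j k q r p v + D.Eh u i j k r p q v =
    D.tr.Eh v p q r i j k u + D.tr.Eh v p q r j k i u + D.tr.Eh v p q r k i j u := by
  have a1 : ∀ p q, D.e i u p q = - D.e u i p q := fun p q => D.anti1 _ _ _ _
  have a2 : ∀ p q, D.e j u p q = - D.e u j p q := fun p q => D.anti1 _ _ _ _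
  have a3 : ∀ p q, D.e k u p q = - D.e u k p q := fun p q => D.anti1 _ _ _ _
  have a4 : ∀ p q, D.e j i p q = - D.e i j p q := fun p q => D.anti1 _ _ _ _
  have a5 : ∀ p q, D.e k i p q = - D.e i k p q := fun p q => D.anti1 _ _ _ _
  have a6 : ∀ p q, D.e k j p q = - D.e j k p q := fun p q => D.anti1 _ _ _ _
  have b1 : ∀ a b, D.e a b q p = - D.e a b p q := fun p q => D.anti2 _ _ _ _
  have b2 : ∀ a b, D.e a b r p = - D.e a b p r := fun p q => D.anti2 _ _ _ _
  have b3 : ∀ a b, D.e a b v p = - D.e a b p v := fun p q => D.anti2 _ _ _ _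
  have b4 : ∀ a b, D.e a b r q = - D.e a b q r := fun p q => D.anti2 _ _ _ _
  have b5 : ∀ a b, D.e a b v q = - D.e a b q v := fun p q => D.anti2 _ _ _ _
  have b6 : ∀ a b, D.e a b v r = - D.e a b r v := fun p q => D.anti2 _ _ _ _
  simp only [Eh, lam, E, tr, a1, a2, a3, a4, a5, a6, b1, b2, b3, b4, b5, b6]
  linear_combination (norm := module) (-1 : ℤ) • D.comm u i p q j k r v + D.comm u i p r j k q v - D.comm u i q r j k p v + D.comm u j p q i k r v - D.comm u j p r i k q v + D.comm u j q r i k p v - D.comm u k p q i j r v + D.comm u k p r i j q v - D.comm u k q r i j p v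

end
end Dat



set_option linter.unusedSimpArgs false
set_option linter.unusedSectionVars false

namespace Dat

variable {α β S Q : Type} [CommRing S] [AddCommGroup Q] [Module S Q] [Module ℂ Q]

theorem nsmul_tf {Q : Type} [AddCommGroup Q] [Module ℂ Q] (n : ℕ) (hn : n ≠ 0) (g : Q) (h : (n : ℤ) • g = 0) : g = 0 := by
  have h2 : (n : ℂ) • g = 0 := by
    rw [Nat.cast_smul_eq_nsmul]; simpa using h
  have hn' : (n : ℂ) ≠ 0 := by exact_mod_cast hn
  have h3 : ((n : ℂ)⁻¹ * n) • g = 0 := by rw [mul_smul, h2, smul_zero]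
  rwa [inv_mul_cancel₀ hn', one_smul] at h3

variable (D : Dat α β S Q)

section
variable (u i j k : α)

theorem xAl_sw (h : α) (z v r p q : β) :
    D.x h z • D.Al u i j k v r p q = D.x h v • D.Al u i j k z r p q := by
  have k1 := D.swap_kill h u z v _ (D.ev_lam i j k r p q)
  have k2 := D.swap_kill h i z v _ (D.ev_lam u j k r p q)
  have k3 := D.swap_kill h j z v _ (D.ev_lam i u k r p q)
  have k4 := D.swap_kill h k z v _ (D.ev_lam i j u r p q)
  simp only [Al]
  linear_combination (norm := module) k1 - k2 - k3 - k4

theorem Al_sym (v r p q : β) : D.Al u i j k v r p q = D.Al u i j k v p r q := by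
  simp only [Al, D.lam_symm _ _ _ r p]

theorem Al_cyc (v r p q : β) :
    D.Al u i j k v r p q + D.Al u i j k v p q r + D.Al u i j k v q r p = 0 := by
  have k1 := D.lam_cyc i j k r p q
  have k2 := D.lam_cyc u j k r p q
  have k3 := D.lam_cyc i u k r p q
  have k4 := D.lam_cyc i j u r p q
  simp only [Al]
  linear_combination (norm := module) D.x u v • k1 - D.x i v • k2 - D.x j v • k3 - D.x k v • k4

theorem x_Al (h : α) (z v r p q : β) : D.x h z • D.Al u i j k v r p q = 0 := by
  have s1 : ∀ z v r p q, D.x h z • D.Al u i j k v r p q = D.x h v • D.Al u i j k z r p q :=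
    D.xAl_sw u i j k h
  have s2 : ∀ z v r p q, D.x h z • D.Al u i j k v r p q = D.x h z • D.Al u i j k q r p v :=
    fun z v r p q => by rw [D.Al_1]
  have s3 : ∀ z v r p q, D.x h z • D.Al u i j k v r p q = D.x h z • D.Al u i j k p q v r :=
    fun z v r p q => by rw [D.Al_2]
  have s4 : ∀ z v r p q, D.x h z • D.Al u i j k v r p q = D.x h z • D.Al u i j k v p r q :=
    fun z v r p q => by rw [D.Al_sym]
  have c := congrArg (fun y => D.x h z • y) (D.Al_cyc u i j k v r p q)
  simp only [smul_add, smul_zero] at c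
  have key : ∀ z v r p q, D.x h z • D.Al u i j k v r p q = D.x h z • D.Al u i j k v p q r := by
    intro z v r p q
    rw [s1 z v r p q, s2 v z r p q, s1 v q r p z, s3 q v r p z]
    rw [s2 q p z v r, s1 q r z v p, s3 r q z v p]
    rw [s1 r v p q z, s2 v r p q z, s1 v z p q r]
  have e1 := key z v r p q
  have e2 := key z v p q r
  apply nsmul_tf 3 (by norm_num)
  linear_combination (norm := module) c + (2 : ℤ) • e1 + e2

theorem x_kap (h : α) (z v r p q : β) : D.x h z • D.kap u i j k r p q v = 0 := by
  rw [kap_eq_Al, x_Al]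

theorem Eh_z (z : α) (w p q r v : β) :
    D.x z w • D.Eh u i j k p q r v = D.x u w • D.Eh z i j k p q r v := by
  have k1 := D.swap_kill z u w v _ (D.ev_lam i j k r p q)
  have k2 := D.swap_kill z u w r _ (D.ev_lam i j k v p q)
  have k3 := D.swap_kill z u w p _ (D.ev_lam i j k r v q)
  simp only [Eh]
  linear_combination (norm := module) k1 + k2 - k3

theorem Eh_w (z : α) (w p q r v : β) :
    D.x z w • D.Eh u i j k p q r v = D.x z v • D.Eh u i j k p q r w := by
  have ks : ∀ a b (h : Q), D.ev h = 0 → (D.x z b * D.x u a) • h = (D.x z a * D.x u b) • h :=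
    fun a b h hh => D.swap_kill z u b a h hh
  have hc : ∀ a b r p q, (D.x z a * D.x u b) • D.lam i j k r p q +
      (D.x z a * D.x u b) • D.lam i j k p q r + (D.x z a * D.x u b) • D.lam i j k q r p = 0 := by
    intro a b r p q
    rw [← smul_add, ← smul_add, D.lam_cyc, smul_zero]
  have hk : ∀ w r p q v, (D.x z w * D.x u q) • D.lam i j k r p v
      + (D.x z w * D.x u v) • D.lam i j k r p q + (D.x z w * D.x u p) • D.lam i j k q v r
      + (D.x z w * D.x u r) • D.lam i j k q v p = 0 := by
    intro w r p q v
    have := D.x_kap u i j k z w v r p q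
    simp only [kap] at this
    linear_combination (norm := module) this
  have nl : ∀ a b r p q, (D.x z b * D.x u a) • D.lam i j k r p q =
      (D.x z a * D.x u b) • D.lam i j k r p q := fun a b r p q => ks a b _ (D.ev_lam _ _ _ _ _ _)
  have d1 := hk w p q r v
  simp only [Eh]
  have l1 : ∀ a, D.lam i j k q p a = D.lam i j k p q a := fun a => D.lam_symm _ _ _ _ _ _
  have l2 : ∀ a, D.lam i j k r p a = D.lam i j k p r a := fun a => D.lam_symm _ _ _ _ _ _
  have l3 : ∀ a, D.lam i j k v p a = D.lam i j k p v a := fun a => D.lam_symm _ _ _ _ _ _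
  have l4 : ∀ a, D.lam i j k w p a = D.lam i j k p w a := fun a => D.lam_symm _ _ _ _ _ _
  have l5 : ∀ a, D.lam i j k r q a = D.lam i j k q r a := fun a => D.lam_symm _ _ _ _ _ _
  have l6 : ∀ a, D.lam i j k v q a = D.lam i j k q v a := fun a => D.lam_symm _ _ _ _ _ _
  have l7 : ∀ a, D.lam i j k w q a = D.lam i j k q w a := fun a => D.lam_symm _ _ _ _ _ _
  have l8 : ∀ a, D.lam i j k v r a = D.lam i j k r v a := fun a => D.lam_symm _ _ _ _ _ _
  have l9 : ∀ a, D.lam i j k w r a = D.lam i j k r w a := fun a => D.lam_symm _ _ _ _ _ _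
  have l10 : ∀ a, D.lam i j k w v a = D.lam i j k v w a := fun a => D.lam_symm _ _ _ _ _ _
  have n1 := fun a b c => nl p q a b c
  have n2 := fun a b c => nl p r a b c
  have n3 := fun a b c => nl p v a b c
  have n4 := fun a b c => nl p w a b c
  have n5 := fun a b c => nl q r a b c
  have n6 := fun a b c => nl q v a b c
  have n7 := fun a b c => nl q w a b c
  have n8 := fun a b c => nl r v a b c
  have n9 := fun a b c => nl r w a b c
  have n10 := fun a b c => nl v w a b c
  clear nl ks
  apply sub_eq_zero.1
  apply nsmul_tf 3 (by norm_num)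
  have t0 := hc p r q v w
  have t1 := hc p v q r w
  have t2 := hc p w q r v
  have t3 := hc q w p r v
  have t4 := hc r v p q w
  have t5 := hc r w p q v
  have t6 := hk p q r v w
  have t7 := hk p q v r w
  have t8 := hk q p r v w
  have t9 := hk q p v r w
  have t10 := hk r p q v w
  have t11 := hk r p v q w
  have t12 := hk v p q r w
  have t13 := hk v p r q w
  have t14 := hk w p q r v
  have t15 := hk w p r q v
  clear hc hk d1
  simp only [smul_sub, smul_add, smul_smul]
  simp only [l1, l2, l3, l4, l5, l6, l7, l8, l9, l10] at t0 t1 t2 t3 t4 t5 t6 t7 t8 t9 t10 t11 t12 t13 t14 t15 ⊢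
  simp only [n1, n2, n3, n4, n5, n6, n7, n8, n9, n10] at t0 t1 t2 t3 t4 t5 t6 t7 t8 t9 t10 t11 t12 t13 t14 t15 ⊢
  linear_combination (norm := module) (-2 : ℤ) • t0 + (-1 : ℤ) • t1 + (-1 : ℤ) • t2 + (2 : ℤ) • t3 + (-3 : ℤ) • t4 + (1 : ℤ) • t5 + (1 : ℤ) • t6 + (2 : ℤ) • t7 + (-1 : ℤ) • t8 + (-2 : ℤ) • t9 + (1 : ℤ) • t10 + (2 : ℤ) • t11 + (2 : ℤ) • t12 + (1 : ℤ) • t13 + (-2 : ℤ) • t14 + (-1 : ℤ) • t15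

theorem Eh_anti (z : α) (w p q r v : β) :
    D.x z w • D.Eh u i j k p q r v = - (D.x z w • D.Eh u i j k q p r v) := by
  have h := D.x_kap u i j k z w v p q r
  have l1 : ∀ a, D.lam i j k q p a = D.lam i j k p q a := fun a => D.lam_symm _ _ _ _ _ _
  have l2 : ∀ a, D.lam i j k r p a = D.lam i j k p r a := fun a => D.lam_symm _ _ _ _ _ _
  have l3 : ∀ a, D.lam i j k v p a = D.lam i j k p v a := fun a => D.lam_symm _ _ _ _ _ _
  have l5 : ∀ a, D.lam i j k r q a = D.lam i j k q r a := fun a => D.lam_symm _ _ _ _ _ _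
  have l6 : ∀ a, D.lam i j k v q a = D.lam i j k q v a := fun a => D.lam_symm _ _ _ _ _ _
  have l8 : ∀ a, D.lam i j k v r a = D.lam i j k r v a := fun a => D.lam_symm _ _ _ _ _ _
  have c1 := D.lam_cyc i j k p q r
  have c2 := D.lam_cyc i j k p q v
  simp only [kap, Eh, l1, l2, l3, l5, l6, l8] at *
  linear_combination (norm := module) - h + (D.x z w * D.x u v) • c1 + (D.x z w * D.x u r) • c2

theorem two_x_lam (p q r v : β) :
    (2 : ℤ) • D.x u v • D.lam i j k r p q = D.Eh u i j k p q r v + D.Eh u i j k r q p v := by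
  simp only [Eh, D.lam_symm i j k p r, D.lam_symm i j k v r, D.lam_symm i j k v p]
  module

theorem x_Eh_alt (z : α) (w p q r v : β) :
    D.x z w • D.Eh u i j k p q r v - D.x z w • D.Eh i u j k p q r v
      - D.x z w • D.Eh j i u k p q r v - D.x z w • D.Eh k i j u p q r v = 0 := by
  have h1 := D.x_Al u i j k z w v r p q
  have h2 := D.x_Al u i j k z w r v p q
  have h3 := D.x_Al u i j k z w p r v q
  simp only [Al, Eh] at *
  linear_combination (norm := module) h1 + h2 - h3

theorem three_E (p q r : β) : (3 : ℤ) • (D.E i j k r p q - D.tr.E p q r i j k) =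
    D.lam i j k r p q - D.lam i j k r q p - (D.tr.lam p q r i j k - D.tr.lam p q r i k j) := by
  have a1 : ∀ p q, D.e j i p q = - D.e i j p q := fun p q => D.anti1 _ _ _ _
  have a2 : ∀ p q, D.e k i p q = - D.e i k p q := fun p q => D.anti1 _ _ _ _
  have a3 : ∀ p q, D.e k j p q = - D.e j k p q := fun p q => D.anti1 _ _ _ _
  have b1 : ∀ a b, D.e a b q p = - D.e a b p q := fun p q => D.anti2 _ _ _ _
  have b2 : ∀ a b, D.e a b r p = - D.e a b p r := fun p q => D.anti2 _ _ _ _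
  have b4 : ∀ a b, D.e a b r q = - D.e a b q r := fun p q => D.anti2 _ _ _ _
  simp only [lam, E, tr, a1, a2, a3, b1, b2, b4]
  module

end
end Dat



section Newman

variable {m n : ℕ}

/-- Exchange of columns. -/
def sw {α β : Type} (a b : α × β) : α × β := (a.1, b.2)

def nu (M : Multiset (Fin m × Fin n)) : ℕ :=
  (M.map (fun a => (((a.1 : ℕ) : ℤ) - ((a.2 : ℕ) : ℤ)).natAbs ^ 2)).sum

theorem nu_cons (a : Fin m × Fin n) (M) :
    ((nu (a ::ₘ M) : ℕ) : ℤ) = (((a.1 : ℕ) : ℤ) - ((a.2 : ℕ) : ℤ)) ^ 2 + nu M := by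
  simp [nu]

/-- descending pair -/
def Dsc (a b : Fin m × Fin n) : Prop :=
  0 < (((a.1 : ℕ) : ℤ) - ((b.1 : ℕ) : ℤ)) * (((b.2 : ℕ) : ℤ) - ((a.2 : ℕ) : ℤ))

theorem nu_Dsc {a b : Fin m × Fin n} (M) (h : Dsc a b) :
    nu (sw a b ::ₘ sw b a ::ₘ M) < nu (a ::ₘ b ::ₘ M) := by
  zify
  simp only [nu_cons, sw]
  unfold Dsc at h
  nlinarith

theorem Dsc_symm {a b : Fin m × Fin n} (h : Dsc a b) : Dsc b a := by
  unfold Dsc at *; nlinarith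

theorem gain_aux (a b c d : ℤ) (h1 : 0 < a * c) (h2 : 0 < b * d) :
    0 < a * c + b * c + b * d ∨ 0 < a * c + a * d + b * d := by
  rcases pos_and_pos_or_neg_and_neg_of_mul_pos h1 with ⟨ha, hc⟩ | ⟨ha, hc⟩ <;>
  rcases pos_and_pos_or_neg_and_neg_of_mul_pos h2 with ⟨hb, hd⟩ | ⟨hb, hd⟩
  · left; positivity
  · rcases le_or_gt (c + d) 0 with h | h
    · left; nlinarith
    · right; nlinarith
  · rcases le_or_gt (c + d) 0 with h | h
    · right; nlinarith
    · left; nlinarith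
  · left; nlinarith

variable {G : Type} [AddCommGroup G]

open Classical in
noncomputable def phiN (ε : Fin m × Fin n → Fin m × Fin n → Multiset (Fin m × Fin n) → G)
    (M : Multiset (Fin m × Fin n)) : G :=
  if h : ∃ t : (Fin m × Fin n) × (Fin m × Fin n) × Multiset (Fin m × Fin n),
      t.1 ::ₘ t.2.1 ::ₘ t.2.2 = M ∧ Dsc t.1 t.2.1 then
    ε h.choose.1 h.choose.2.1 h.choose.2.2 +
      phiN ε (sw h.choose.1 h.choose.2.1 ::ₘ sw h.choose.2.1 h.choose.1 ::ₘ h.choose.2.2)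
  else 0
termination_by nu M
decreasing_by
  have := h.choose_spec
  conv_rhs => rw [← this.1]
  exact nu_Dsc _ this.2

variable (ε : Fin m × Fin n → Fin m × Fin n → Multiset (Fin m × Fin n) → G)

theorem phiN_spec {M} {a b N} (hM : a ::ₘ b ::ₘ N = M) (hd : Dsc a b) :
    ∃ a' b' N', a' ::ₘ b' ::ₘ N' = M ∧ Dsc a' b' ∧
      phiN ε M = ε a' b' N' + phiN ε (sw a' b' ::ₘ sw b' a' ::ₘ N') := by
  have h : ∃ t : (Fin m × Fin n) × (Fin m × Fin n) × Multiset (Fin m × Fin n),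
      t.1 ::ₘ t.2.1 ::ₘ t.2.2 = M ∧ Dsc t.1 t.2.1 := ⟨(a, b, N), hM, hd⟩
  refine ⟨h.choose.1, h.choose.2.1, h.choose.2.2, h.choose_spec.1, h.choose_spec.2, ?_⟩
  conv_lhs => rw [phiN]
  rw [dif_pos h]

theorem newman [Module ℂ G] 
    (h1 : ∀ a b N, ε a b N = ε b a N)
    (h2 : ∀ a b N, ε (sw a b) (sw b a) N = - ε a b N)
    (h3 : ∀ a b c d N, ε a b (c ::ₘ d ::ₘ N) - ε a b (sw c d ::ₘ sw d c ::ₘ N) =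
      ε c d (a ::ₘ b ::ₘ N) - ε c d (sw a b ::ₘ sw b a ::ₘ N))
    (h4 : ∀ a b c N, ε a b (c ::ₘ N) + ε (sw b a) c (sw a b ::ₘ N) =
      ε b c (a ::ₘ N) + ε a (sw c b) (sw b c ::ₘ N)) :
    ∃ φ : Multiset (Fin m × Fin n) → G, ∀ a b N,
      ε a b N = φ (a ::ₘ b ::ₘ N) - φ (sw a b ::ₘ sw b a ::ₘ N) := by
  refine ⟨phiN ε, ?_⟩
  have hsw : ∀ a b : Fin m × Fin n, sw (sw a b) (sw b a) = a := fun a b => rfl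
  -- from descending edges to all edges
  have ext : ∀ a b N, (Dsc a b → ε a b N = phiN ε (a ::ₘ b ::ₘ N)
        - phiN ε (sw a b ::ₘ sw b a ::ₘ N)) →
      (Dsc (sw a b) (sw b a) → ε (sw a b) (sw b a) N = phiN ε (sw a b ::ₘ sw b a ::ₘ N)
        - phiN ε (a ::ₘ b ::ₘ N)) →
      ε a b N = phiN ε (a ::ₘ b ::ₘ N) - phiN ε (sw a b ::ₘ sw b a ::ₘ N) := by
    intro a b N e1 e2
    by_cases c1 : Dsc a b
    · exact e1 c1
    by_cases c2 : Dsc (sw a b) (sw b a)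
    · have := e2 c2
      rw [h2] at this
      rw [← neg_sub, ← this, neg_neg]
    have h0 : a.1 = b.1 ∨ a.2 = b.2 := by
      unfold Dsc sw at *
      simp only at c2
      have : (((a.1 : ℕ) : ℤ) - ((b.1 : ℕ) : ℤ)) * (((b.2 : ℕ) : ℤ) - ((a.2 : ℕ) : ℤ)) = 0 := by
        nlinarith
      rcases mul_eq_zero.1 this with h | h
      · left; apply Fin.ext; omega
      · right; apply Fin.ext; omega
    have z : ε a b N = - ε a b N := by
      rcases h0 with h | h
      · have e1 : sw a b = b := by simp [sw, h]
        have e2 : sw b a = a := by simp [sw, ← h]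
        have := h2 a b N
        rw [e1, e2, h1 b a] at this
        exact this
      · have e1 : sw a b = a := by simp [sw, ← h]
        have e2 : sw b a = b := by simp [sw, h]
        have := h2 a b N
        rw [e1, e2] at this
        exact this
    have z0 : ε a b N = 0 := Dat.nsmul_tf 2 (by norm_num) _ (by
      rw [Nat.cast_ofNat, two_smul]; nth_rw 2 [z]; exact add_neg_cancel _)
    have z1 : sw a b ::ₘ sw b a ::ₘ N = a ::ₘ b ::ₘ N := by
      rcases h0 with h | h
      · have e1 : sw a b = b := by simp [sw, h]
        have e2 : sw b a = a := by simp [sw, ← h]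
        rw [e1, e2, Multiset.cons_swap]
      · have e1 : sw a b = a := by simp [sw, ← h]
        have e2 : sw b a = b := by simp [sw, h]
        rw [e1, e2]
    rw [z0, z1, sub_self]
  have main : ∀ K, ∀ a b N, nu (a ::ₘ b ::ₘ N) < K → Dsc a b → ε a b N =
      phiN ε (a ::ₘ b ::ₘ N) - phiN ε (sw a b ::ₘ sw b a ::ₘ N) := by
    intro K
    induction K with
    | zero => intro a b N h; omega
    | succ K ih =>
      have P : ∀ a b N, nu (a ::ₘ b ::ₘ N) < K → nu (sw a b ::ₘ sw b a ::ₘ N) < K →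
          ε a b N = phiN ε (a ::ₘ b ::ₘ N) - phiN ε (sw a b ::ₘ sw b a ::ₘ N) := by
        intro a b N k1 k2
        exact ext a b N (ih a b N k1) (ih _ _ N k2)
      have fs : ∀ a b N, ε a b N + phiN ε (sw a b ::ₘ sw b a ::ₘ N) =
          ε b a N + phiN ε (sw b a ::ₘ sw a b ::ₘ N) := by
        intro a b N; rw [h1, Multiset.cons_swap]
      -- half of the sharing lemma
      have share1 : ∀ a b c N, nu (a ::ₘ b ::ₘ c ::ₘ N) < K + 1 → Dsc a b → Dsc b c →
          nu (sw a b ::ₘ sw b c ::ₘ sw c a ::ₘ N) < nu (a ::ₘ b ::ₘ c ::ₘ N) →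
          ε a b (c ::ₘ N) + phiN ε (sw a b ::ₘ sw b a ::ₘ c ::ₘ N) =
          ε b c (a ::ₘ N) + phiN ε (sw b c ::ₘ sw c b ::ₘ a ::ₘ N) := by
        intro a b c N hK d1 d2 hm
        have q1 := nu_Dsc (c ::ₘ N) d1
        have q2 := nu_Dsc (a ::ₘ N) d2
        have r0 : b ::ₘ c ::ₘ a ::ₘ N = a ::ₘ b ::ₘ c ::ₘ N := by
          rw [Multiset.cons_swap c a, Multiset.cons_swap b a]
        have r1 : sw b a ::ₘ c ::ₘ sw a b ::ₘ N = sw a b ::ₘ sw b a ::ₘ c ::ₘ N := by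
          rw [Multiset.cons_swap c, Multiset.cons_swap (sw b a)]
        have r2 : a ::ₘ sw c b ::ₘ sw b c ::ₘ N = sw b c ::ₘ sw c b ::ₘ a ::ₘ N := by
          rw [Multiset.cons_swap (sw c b), Multiset.cons_swap a, Multiset.cons_swap a]
        have r3 : sw (sw b a) c ::ₘ sw c (sw b a) ::ₘ sw a b ::ₘ N =
            sw a b ::ₘ sw b c ::ₘ sw c a ::ₘ N := by
          have : sw (sw b a) c = sw b c := rfl
          rw [this]
          have : sw c (sw b a) = sw c a := rfl
          rw [this]
          rw [Multiset.cons_swap (sw c a), Multiset.cons_swap (sw b c)]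
        have r4 : sw a (sw c b) ::ₘ sw (sw c b) a ::ₘ sw b c ::ₘ N =
            sw a b ::ₘ sw b c ::ₘ sw c a ::ₘ N := by
          have : sw a (sw c b) = sw a b := rfl
          rw [this]
          have : sw (sw c b) a = sw c a := rfl
          rw [this, Multiset.cons_swap (sw c a)]
        rw [r0] at q2
        have e1 := P (sw b a) c (sw a b ::ₘ N) (by rw [r1]; omega) (by rw [r3]; omega)
        have e2 := P a (sw c b) (sw b c ::ₘ N) (by rw [r2]; omega) (by rw [r4]; omega)
        rw [r1, r3] at e1
        rw [r2, r4] at e2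
        have := h4 a b c N
        rw [e1, e2] at this
        linear_combination (norm := module) this
      have share : ∀ a b c N, nu (a ::ₘ b ::ₘ c ::ₘ N) < K + 1 → Dsc a b → Dsc b c →
          ε a b (c ::ₘ N) + phiN ε (sw a b ::ₘ sw b a ::ₘ c ::ₘ N) =
          ε b c (a ::ₘ N) + phiN ε (sw b c ::ₘ sw c b ::ₘ a ::ₘ N) := by
        intro a b c N hK d1 d2
        have g := gain_aux _ _ _ _ d1 d2
        rcases g with g | g
        · apply share1 a b c N hK d1 d2
          zify
          simp only [nu_cons, sw]
          nlinarith
        · have r0 : c ::ₘ b ::ₘ a ::ₘ N = a ::ₘ b ::ₘ c ::ₘ N := by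
            rw [Multiset.cons_swap b a, Multiset.cons_swap c a, Multiset.cons_swap b c]
          have := share1 c b a N (by rw [r0]; exact hK) (Dsc_symm d2) (Dsc_symm d1) (by
            zify
            simp only [nu_cons, sw]
            nlinarith)
          rw [fs a b, fs b c, this]
      intro a b N hK hd
      obtain ⟨c, d, N', hM, hd', hphi⟩ := phiN_spec ε rfl hd
      rw [hphi]
      rw [eq_sub_iff_add_eq]
      rcases Multiset.cons_eq_cons.1 hM with ⟨rfl, k⟩ | ⟨-, cs, k1, k2⟩
      · rcases Multiset.cons_eq_cons.1 k with ⟨rfl, rfl⟩ | ⟨-, N0, rfl, rfl⟩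
        · rfl
        · rw [Multiset.cons_swap] at hK
          exact (fs _ _ _).trans (share b c d N0 hK (Dsc_symm hd) hd')
      · rcases Multiset.cons_eq_cons.1 k1 with ⟨rfl, rfl⟩ | ⟨-, cs', rfl, rfl⟩
        · rcases Multiset.cons_eq_cons.1 k2.symm with ⟨rfl, rfl⟩ | ⟨-, N0, rfl, rfl⟩
          · exact fs _ _ _
          · rw [Multiset.cons_swap] at hK
            exact (fs _ _ _).trans ((share b d c N0 hK (Dsc_symm hd) (Dsc_symm hd')).trans
              (fs _ _ _))
        · rcases Multiset.cons_eq_cons.1 k2 with ⟨rfl, rfl⟩ | ⟨-, X, rfl, k3⟩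
          · exact share a b d cs' hK hd hd'
          · rcases Multiset.cons_eq_cons.1 k3 with ⟨rfl, rfl⟩ | ⟨-, X', rfl, rfl⟩
            · exact (share a d c cs' hK hd (Dsc_symm hd')).trans (fs _ _ _)
            · have q1 := nu_Dsc (c ::ₘ d ::ₘ X') hd
              have q2 := nu_Dsc (a ::ₘ b ::ₘ X') hd'
              have mv : ∀ a b c d : Fin m × Fin n, c ::ₘ d ::ₘ a ::ₘ b ::ₘ X' =
                  a ::ₘ b ::ₘ c ::ₘ d ::ₘ X' := by
                intro a b c d
                rw [Multiset.cons_swap d a, Multiset.cons_swap c a, Multiset.cons_swap d b,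
                  Multiset.cons_swap c b]
              have q3 := nu_Dsc (sw c d ::ₘ sw d c ::ₘ X') hd
              rw [← mv a b] at q3
              rw [mv a b c d] at q2
              have e1 := P a b (sw c d ::ₘ sw d c ::ₘ X')
                (by rw [← mv]; omega) (by omega)
              have e2 := P c d (sw a b ::ₘ sw b a ::ₘ X')
                (by rw [← mv]; omega) (by rw [mv]; omega)
              have e3 := h3 a b c d X'
              rw [e1, e2] at e3
              rw [mv a b (sw c d) (sw d c)]
              rw [mv (sw a b) (sw b a) (sw c d) (sw d c)] at e3
              rw [mv (sw a b) (sw b a) c d] at e3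
              linear_combination (norm := module) e3
  intro a b N
  exact ext a b N (main _ a b N (Nat.lt_succ_self _)) (main _ _ _ N (Nat.lt_succ_self _))

end Newman



open MvPolynomial

namespace Dat

variable {α β S Q : Type} [CommRing S] [AddCommGroup Q] [Module S Q] (D : Dat α β S Q)

/-- monomials in the `x` -/
def mon (N : Multiset (α × β)) : S := (N.map (fun a => D.x a.1 a.2)).prod

theorem mon_cons (a : α × β) (N) : D.mon (a ::ₘ N) = D.x a.1 a.2 * D.mon N := by
  simp [mon]

theorem mon_zero : D.mon 0 = 1 := by
  simp [mon]

theorem mon_kill (N : Multiset (α × β)) : ∀ (N' : Multiset (α × β)) (h : Q), D.ev h = 0 →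
    N.map Prod.fst = N'.map Prod.fst → N.map Prod.snd = N'.map Prod.snd →
    D.mon N • h = D.mon N' • h := by
  classical
  induction N using Multiset.induction_on with
  | empty =>
    intro N' h hh h1 h2
    have : N' = 0 := by
      have := congrArg Multiset.card h1
      simpa using this.symm
    rw [this]
  | cons a N0 ih =>
    intro N' h hh h1 h2
    obtain ⟨i, j⟩ := a
    have hi : i ∈ N'.map Prod.fst := by rw [← h1]; simp
    obtain ⟨⟨i1, j'⟩, hm, hi1⟩ := Multiset.mem_map.1 hi
    simp only at hi1
    subst hi1
    obtain ⟨N1, rfl⟩ := Multiset.exists_cons_of_mem hm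
    simp only [Multiset.map_cons, Multiset.cons_inj_right] at h1
    by_cases hj : j = j'
    · subst hj
      simp only [Multiset.map_cons, Multiset.cons_inj_right] at h2
      rw [mon_cons, mon_cons, mul_smul, mul_smul, ih N1 h hh h1 h2]
    · have hj2 : j ∈ N1.map Prod.snd := by
        have : j ∈ ((i1, j') ::ₘ N1).map Prod.snd := by rw [← h2]; simp
        simp only [Multiset.map_cons, Multiset.mem_cons] at this
        exact this.resolve_left hj
      obtain ⟨⟨i', j1⟩, hm2, hj1⟩ := Multiset.mem_map.1 hj2
      simp only at hj1
      subst hj1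
      obtain ⟨N2, rfl⟩ := Multiset.exists_cons_of_mem hm2
      have e := ih ((i', j') ::ₘ N2) h hh (by simpa using h1) (by
        simp only [Multiset.map_cons] at h2 ⊢
        rw [Multiset.cons_swap] at h2
        exact (Multiset.cons_inj_right _).1 h2)
      have k := D.swap_kill i1 i' j1 j' (D.mon N2 • h) (by rw [map_smul, hh, smul_zero])
      rw [mon_cons, mul_smul, e]
      simp only [mon_cons, smul_smul] at k ⊢
      rw [← mul_assoc, k, mul_assoc]

variable [Module ℂ Q]

/-- index tuples -/
abbrev Tup (α β : Type) := Multiset (α × β) × α × β × β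

def val (i j k : α) (p q : β) (X : Tup α β) : Q :=
  D.mon X.1 • D.Eh X.2.1 i j k p q X.2.2.1 X.2.2.2

theorem val_congr (i j k : α) (p q : β) (N N' : Multiset (α × β)) (u u' : α) (r v r' v' : β)
    (h1 : u ::ₘ N.map Prod.fst = u' ::ₘ N'.map Prod.fst)
    (h2 : r ::ₘ v ::ₘ N.map Prod.snd = r' ::ₘ v' ::ₘ N'.map Prod.snd) :
    D.val i j k p q (N, u, r, v) = D.val i j k p q (N', u', r', v') := by
  classical
  unfold val
  simp only
  have hEv := D.ev_Eh
  have sym : ∀ u r v, D.Eh u i j k p q r v = D.Eh u i j k p q v r :=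
    fun u r v => D.Eh_symm u i j k p q r v
  -- third reduction: only `r` differs
  have S3 : ∀ (u : α) (N N' : Multiset (α × β)) (r r' v : β),
      N.map Prod.fst = N'.map Prod.fst → r ::ₘ N.map Prod.snd = r' ::ₘ N'.map Prod.snd →
      D.mon N • D.Eh u i j k p q r v = D.mon N' • D.Eh u i j k p q r' v := by
    intro u N N' r r' v k1 k2
    by_cases hr : r = r'
    · subst hr
      exact D.mon_kill N N' _ (hEv _ _ _ _ _ _ _ _) k1 ((Multiset.cons_inj_right _).1 k2)
    · have hm : r' ∈ N.map Prod.snd := by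
        have : r' ∈ r ::ₘ N.map Prod.snd := by rw [k2]; simp
        exact (Multiset.mem_cons.1 this).resolve_left (Ne.symm hr)
      obtain ⟨⟨z, w⟩, hm2, hw⟩ := Multiset.mem_map.1 hm
      simp only at hw
      subst hw
      obtain ⟨N1, rfl⟩ := Multiset.exists_cons_of_mem hm2
      have e := D.Eh_w u i j k z w p q v r
      rw [mon_cons, mul_comm, mul_smul, sym, e, sym u v, ← mul_smul, mul_comm]
      have := D.mon_kill ((z, r) ::ₘ N1) N' _ (hEv u i j k p q w v) (by simpa using k1) (by
        simp only [Multiset.map_cons] at k2 ⊢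
        rw [Multiset.cons_swap] at k2
        exact (Multiset.cons_inj_right _).1 k2)
      rw [← this, mon_cons]
  have S2 : ∀ (u : α) (N N' : Multiset (α × β)) (r r' v v' : β),
      N.map Prod.fst = N'.map Prod.fst →
      r ::ₘ v ::ₘ N.map Prod.snd = r' ::ₘ v' ::ₘ N'.map Prod.snd →
      D.mon N • D.Eh u i j k p q r v = D.mon N' • D.Eh u i j k p q r' v' := by
    intro u N N' r r' v v' k1 k2
    by_cases hr : v = v'
    · subst hr
      apply S3 u N N' r r' v k1
      rw [Multiset.cons_swap, Multiset.cons_swap r'] at k2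
      exact (Multiset.cons_inj_right _).1 k2
    by_cases hr2 : r = v'
    · subst hr2
      rw [sym]
      apply S3 u N N' v r' r k1
      rw [Multiset.cons_swap r'] at k2
      exact (Multiset.cons_inj_right _).1 k2
    · have hm : v' ∈ N.map Prod.snd := by
        have : v' ∈ r ::ₘ v ::ₘ N.map Prod.snd := by rw [k2]; simp
        have := (Multiset.mem_cons.1 this).resolve_left (Ne.symm hr2)
        exact (Multiset.mem_cons.1 this).resolve_left (Ne.symm hr)
      obtain ⟨⟨z, w⟩, hm2, hw⟩ := Multiset.mem_map.1 hm
      simp only at hw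
      subst hw
      obtain ⟨N1, rfl⟩ := Multiset.exists_cons_of_mem hm2
      have e := D.Eh_w u i j k z w p q r v
      rw [mon_cons, mul_comm, mul_smul, e, ← mul_smul, mul_comm]
      have := S3 u ((z, v) ::ₘ N1) N' r r' w (by simpa using k1) (by
        simp only [Multiset.map_cons] at k2 ⊢
        rw [Multiset.cons_swap v w, Multiset.cons_swap r w, Multiset.cons_swap r' w] at k2
        exact (Multiset.cons_inj_right _).1 k2)
      rw [← this, mon_cons]
  by_cases hu : u = u'
  · subst hu
    exact S2 u N N' r r' v v' ((Multiset.cons_inj_right _).1 h1) h2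
  · have hm : u' ∈ N.map Prod.fst := by
      have : u' ∈ u ::ₘ N.map Prod.fst := by rw [h1]; simp
      exact (Multiset.mem_cons.1 this).resolve_left (Ne.symm hu)
    obtain ⟨⟨z, w⟩, hm2, hw⟩ := Multiset.mem_map.1 hm
    simp only at hw
    subst hw
    obtain ⟨N1, rfl⟩ := Multiset.exists_cons_of_mem hm2
    have e := D.Eh_z u i j k z w p q r v
    rw [mon_cons, mul_comm, mul_smul, e, ← mul_smul, mul_comm]
    have := S2 z ((u, w) ::ₘ N1) N' r r' v v' (by
        simp only [Multiset.map_cons] at h1 ⊢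
        rw [Multiset.cons_swap] at h1
        exact (Multiset.cons_inj_right _).1 h1) (by simpa using h2)
    rw [← this, mon_cons]

section Psi
variable {γ : Type} (f : α ⊕ β ≃ γ)

/-- the monomial of a tuple -/
def tmon (X : Tup α β) : Multiset γ :=
  ((X.2.1 ::ₘ X.1.map Prod.fst).map (fun i => f (.inl i))) +
    ((X.2.2.1 ::ₘ X.2.2.2 ::ₘ X.1.map Prod.snd).map (fun j => f (.inr j)))

theorem add_inj_sum (M M' : Multiset α) (L L' : Multiset β)
    (h : M.map (fun i => f (.inl i)) + L.map (fun j => f (.inr j)) =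
      M'.map (fun i => f (.inl i)) + L'.map (fun j => f (.inr j))) : M = M' ∧ L = L' := by
  have h2 := congrArg (Multiset.map f.symm) h
  simp only [Multiset.map_add, Multiset.map_map, Function.comp_def, Equiv.symm_apply_apply] at h2
  constructor
  · have h3 := congrArg (Multiset.filterMap Sum.getLeft?) h2
    have z : ∀ L : Multiset β, Multiset.filterMap (fun _ => (none : Option α)) L = 0 := by
      intro L; induction L using Multiset.induction_on <;> simp [*]
    simpa [Multiset.filterMap_map, Function.comp_def, Multiset.filterMap_add, z] using h3
  · have h3 := congrArg (Multiset.filterMap Sum.getRight?) h2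
    have z : ∀ L : Multiset α, Multiset.filterMap (fun _ => (none : Option β)) L = 0 := by
      intro L; induction L using Multiset.induction_on <;> simp [*]
    simpa [Multiset.filterMap_map, Function.comp_def, Multiset.filterMap_add, z] using h3

theorem val_tmon (i j k : α) (p q : β) (X Y : Tup α β) (h : tmon f X = tmon f Y) :
    D.val i j k p q X = D.val i j k p q Y := by
  have := add_inj_sum f _ _ _ _ h
  exact D.val_congr i j k p q _ _ _ _ _ _ _ _ this.1 this.2

open Classical in
/-- The comparison map. -/
noncomputable def Psi (i j k : α) (p q : β) : MvPolynomial γ ℂ →ₗ[ℂ] Q :=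
  (basisMonomials γ ℂ).constr ℂ (fun e =>
    if h : ∃ X : Tup α β, Multiset.toFinsupp (tmon f X) = e then D.val i j k p q h.choose else 0)

/-- product of variables -/
noncomputable def pm {γ : Type} (M : Multiset γ) : MvPolynomial γ ℂ :=
  (M.map (MvPolynomial.X (R := ℂ))).prod

open Classical in
theorem pm_eq {γ : Type} (M : Multiset γ) : pm M = monomial (Multiset.toFinsupp M) (1 : ℂ) := by
  induction M using Multiset.induction_on with
  | empty => simp [pm]
  | cons a M ih =>
    rw [pm, Multiset.map_cons, Multiset.prod_cons, ← pm, ih, ← Multiset.singleton_add, map_add,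
      Multiset.toFinsupp_singleton, X, monomial_mul, one_mul]

theorem Psi_mon (i j k : α) (p q : β) (X : Tup α β) :
    D.Psi f i j k p q (pm (tmon f X)) = D.val i j k p q X := by
  classical
  rw [pm_eq]
  have h : ∃ Y : Tup α β, Multiset.toFinsupp (tmon f Y) = Multiset.toFinsupp (tmon f X) := ⟨X, rfl⟩
  have e : monomial (Multiset.toFinsupp (tmon f X)) (1 : ℂ) =
      basisMonomials γ ℂ (Multiset.toFinsupp (tmon f X)) := by simp
  rw [e, Psi, Module.Basis.constr_basis]
  have h' := h
  convert dif_pos h using 1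
  · exact D.val_tmon f i j k p q _ _ (Multiset.toFinsupp.injective h.choose_spec.symm)

/-- bidegree weights -/
def wt (g : γ) : ℕ × ℕ := (f.symm g).elim (fun _ => (1, 0)) (fun _ => (0, 1))

/-- Bihomogeneous polynomials. -/
noncomputable def Bi (a b : ℕ) : Submodule ℂ (MvPolynomial γ ℂ) :=
  weightedHomogeneousSubmodule ℂ (wt f) (a, b)

theorem Bi_monomial_mem (M : Multiset α) (L : Multiset β) :
    pm (M.map (fun i => f (.inl i)) + L.map (fun j => f (.inr j))) ∈
      Bi f (Multiset.card M) (Multiset.card L) := by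
  unfold pm Bi
  rw [Multiset.map_add, Multiset.prod_add]
  have h1 : ∀ M : Multiset α, ((M.map (fun i => f (.inl i))).map (MvPolynomial.X (R := ℂ))).prod
      |>.IsWeightedHomogeneous (wt f) (Multiset.card M, 0) := by
    intro M
    induction M using Multiset.induction_on with
    | empty => simpa [← Prod.zero_eq_mk] using isWeightedHomogeneous_one ℂ (wt f)
    | cons a M ih =>
      have := (isWeightedHomogeneous_X ℂ (wt f) (f (.inl a))).mul ih
      simp only [wt, Equiv.symm_apply_apply, Sum.elim_inl, Prod.mk_add_mk] at this
      simpa [add_comm, wt] using this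
  have h2 : ∀ M : Multiset β, ((M.map (fun i => f (.inr i))).map (MvPolynomial.X (R := ℂ))).prod
      |>.IsWeightedHomogeneous (wt f) (0, Multiset.card M) := by
    intro M
    induction M using Multiset.induction_on with
    | empty => simpa [← Prod.zero_eq_mk] using isWeightedHomogeneous_one ℂ (wt f)
    | cons a M ih =>
      have := (isWeightedHomogeneous_X ℂ (wt f) (f (.inr a))).mul ih
      simp only [wt, Equiv.symm_apply_apply, Sum.elim_inr, Prod.mk_add_mk] at this
      simpa [add_comm, wt] using this
  simpa using (h1 M).mul (h2 L)

theorem split_multiset (M : Multiset γ) : ∃ (A : Multiset α) (B : Multiset β),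
    M = A.map (fun i => f (.inl i)) + B.map (fun j => f (.inr j)) := by
  induction M using Multiset.induction_on with
  | empty => exact ⟨0, 0, by simp⟩
  | cons g M ih =>
    obtain ⟨A, B, rfl⟩ := ih
    obtain ⟨x, rfl⟩ := f.surjective g
    rcases x with i | j
    · exact ⟨i ::ₘ A, B, by simp⟩
    · exact ⟨A, j ::ₘ B, by simp [Multiset.add_cons]⟩

theorem Bi_span (a b : ℕ) : Bi f a b = Submodule.span ℂ
    {P | ∃ (A : Multiset α) (B : Multiset β), Multiset.card A = a ∧ Multiset.card B = b ∧
      P = pm (A.map (fun i => f (.inl i)) + B.map (fun j => f (.inr j)))} := by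
  classical
  apply le_antisymm
  · intro P hP
    rw [P.as_sum]
    refine Submodule.sum_mem _ fun e he => ?_
    have hw := hP (mem_support_iff.1 he)
    obtain ⟨A, B, hAB⟩ := split_multiset f (Finsupp.toMultiset e)
    have hpm : monomial e (1 : ℂ) = pm (A.map (fun i => f (.inl i)) + B.map (fun j => f (.inr j))) := by
      rw [pm_eq, ← hAB]; simp
    have hw2 := Bi_monomial_mem f A B
    rw [← hpm] at hw2
    have hw3 := hw2 (d := e) (by simp)
    rw [hw] at hw3
    have : monomial e (coeff e P) = coeff e P • monomial e (1 : ℂ) := by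
      rw [smul_monomial, smul_eq_mul, mul_one]
    rw [this, hpm]
    apply Submodule.smul_mem
    apply Submodule.subset_span
    exact ⟨A, B, (congrArg Prod.fst hw3).symm, (congrArg Prod.snd hw3).symm, rfl⟩
  · rw [Submodule.span_le]
    rintro P ⟨A, B, rfl, rfl, rfl⟩
    exact Bi_monomial_mem f A B

theorem Bi_ext {a b : ℕ} {V : Type} [AddCommGroup V] [Module ℂ V]
    (F G : MvPolynomial γ ℂ →ₗ[ℂ] V)
    (h : ∀ (A : Multiset α) (B : Multiset β), Multiset.card A = a → Multiset.card B = b →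
      F (pm (A.map (fun i => f (.inl i)) + B.map (fun j => f (.inr j)))) =
      G (pm (A.map (fun i => f (.inl i)) + B.map (fun j => f (.inr j)))))
    (P : MvPolynomial γ ℂ) (hP : P ∈ Bi f a b) : F P = G P := by
  rw [Bi_span] at hP
  have : Set.EqOn F G {P | ∃ (A : Multiset α) (B : Multiset β), Multiset.card A = a ∧
      Multiset.card B = b ∧
      P = pm (A.map (fun i => f (.inl i)) + B.map (fun j => f (.inr j)))} := by
    rintro P ⟨A, B, h1, h2, rfl⟩
    exact h A B h1 h2
  exact LinearMap.eqOn_span this hP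

theorem exists_cons_card {δ : Type} {k : ℕ} (A : Multiset δ) (h : Multiset.card A = k + 1) :
    ∃ a A', A = a ::ₘ A' := by
  have : A ≠ 0 := by rintro rfl; simp at h
  obtain ⟨a, ha⟩ := Multiset.exists_mem_of_ne_zero this
  obtain ⟨A', hA⟩ := Multiset.exists_cons_of_mem ha
  exact ⟨a, A', hA⟩

theorem exists_zip {k : ℕ} : ∀ (A : Multiset α) (B : Multiset β), Multiset.card A = k →
    Multiset.card B = k → ∃ N : Multiset (α × β), N.map Prod.fst = A ∧ N.map Prod.snd = B ∧
      Multiset.card N = k := by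
  induction k with
  | zero =>
    intro A B hA hB
    rw [Multiset.card_eq_zero] at hA hB
    exact ⟨0, by simp [hA], by simp [hB], by simp⟩
  | succ k ih =>
    intro A B hA hB
    obtain ⟨a, A', rfl⟩ := exists_cons_card A hA
    obtain ⟨b, B', rfl⟩ := exists_cons_card B hB
    obtain ⟨N, h1, h2, h3⟩ := ih A' B' (by simpa using hA) (by simpa using hB)
    exact ⟨(a, b) ::ₘ N, by simp [h1], by simp [h2], by simp [h3]⟩

theorem exists_tup {κ : ℕ} (A : Multiset α) (B : Multiset β) (hA : Multiset.card A = κ + 1)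
    (hB : Multiset.card B = κ + 2) : ∃ X : Tup α β, Multiset.card X.1 = κ ∧
      A.map (fun i => f (.inl i)) + B.map (fun j => f (.inr j)) = tmon f X := by
  obtain ⟨u, A', rfl⟩ := exists_cons_card A hA
  obtain ⟨r, B', rfl⟩ := exists_cons_card B hB
  have hB' : Multiset.card B' = κ + 1 := by simpa using hB
  obtain ⟨v, B'', rfl⟩ := exists_cons_card B' hB'
  obtain ⟨N, rfl, rfl, h3⟩ := exists_zip (k := κ) A' B'' (by simpa using hA) (by simpa using hB)
  exact ⟨(N, u, r, v), h3, rfl⟩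

theorem tup_ext {κ : ℕ} {V : Type} [AddCommGroup V] [Module ℂ V]
    (F G : MvPolynomial γ ℂ →ₗ[ℂ] V)
    (h : ∀ X : Tup α β, Multiset.card X.1 = κ → F (pm (tmon f X)) = G (pm (tmon f X)))
    (P : MvPolynomial γ ℂ) (hP : P ∈ Bi f (κ + 1) (κ + 2)) : F P = G P := by
  refine Bi_ext f F G ?_ P hP
  intro A B hA hB
  obtain ⟨X, h1, h2⟩ := exists_tup f A B hA hB
  rw [h2]
  exact h X h1

theorem Psi_mem {κ : ℕ} (i j k : α) (p q : β) (H : Submodule ℂ Q)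
    (hH : ∀ X : Tup α β, Multiset.card X.1 = κ → D.val i j k p q X ∈ H)
    (P : MvPolynomial γ ℂ) (hP : P ∈ Bi f (κ + 1) (κ + 2)) :
    D.Psi f i j k p q P ∈ H := by
  have := tup_ext f (H.mkQ ∘ₗ D.Psi f i j k p q) 0 (fun X hX => by
    simp only [LinearMap.comp_apply, Psi_mon, LinearMap.zero_apply, Submodule.mkQ_apply]
    rw [Submodule.Quotient.mk_eq_zero]
    exact hH X hX) P hP
  simpa using this

variable (i j k : α) (p q : β)

theorem Psi_12 {κ : ℕ} (P : MvPolynomial γ ℂ) (hP : P ∈ Bi f (κ + 1) (κ + 2)) :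
    D.Psi f i j k p q P = - D.Psi f j i k p q P := by
  refine tup_ext f (D.Psi f i j k p q) (- D.Psi f j i k p q) (fun X hX => ?_) P hP
  simp only [LinearMap.neg_apply, Psi_mon, val]
  rw [Eh_12, smul_neg]

theorem Psi_23 {κ : ℕ} (P : MvPolynomial γ ℂ) (hP : P ∈ Bi f (κ + 1) (κ + 2)) :
    D.Psi f i j k p q P = - D.Psi f i k j p q P := by
  refine tup_ext f (D.Psi f i j k p q) (- D.Psi f i k j p q) (fun X hX => ?_) P hP
  simp only [LinearMap.neg_apply, Psi_mon, val]
  rw [Eh_23, smul_neg]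

theorem Psi_anti {κ : ℕ} (hκ : 1 ≤ κ) (P : MvPolynomial γ ℂ) (hP : P ∈ Bi f (κ + 1) (κ + 2)) :
    D.Psi f i j k p q P = - D.Psi f i j k q p P := by
  refine tup_ext f (D.Psi f i j k p q) (- D.Psi f i j k q p) (fun X hX => ?_) P hP
  simp only [LinearMap.neg_apply, Psi_mon, val]
  obtain ⟨N, u, r, v⟩ := X
  obtain ⟨κ, rfl⟩ := Nat.exists_eq_add_of_le' hκ
  obtain ⟨⟨z, w⟩, N', rfl⟩ := exists_cons_card N hX
  simp only
  rw [mon_cons, mul_comm, mul_smul, mul_smul, Eh_anti, smul_neg]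

theorem Psi_B {κ : ℕ} (hκ : 1 ≤ κ) (u : α) (P : MvPolynomial γ ℂ) (hP : P ∈ Bi f κ (κ + 2)) :
    D.Psi f i j k p q (X (f (.inl u)) * P) = D.Psi f u j k p q (X (f (.inl i)) * P) +
      D.Psi f i u k p q (X (f (.inl j)) * P) + D.Psi f i j u p q (X (f (.inl k)) * P) := by
  let mx : γ → MvPolynomial γ ℂ →ₗ[ℂ] MvPolynomial γ ℂ := fun g => LinearMap.mulLeft ℂ (X g)
  refine Bi_ext f (D.Psi f i j k p q ∘ₗ mx (f (.inl u))) (D.Psi f u j k p q ∘ₗ mx (f (.inl i)) +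
    D.Psi f i u k p q ∘ₗ mx (f (.inl j)) + D.Psi f i j u p q ∘ₗ mx (f (.inl k))) ?_ P hP
  intro A B hA hB
  simp only [LinearMap.comp_apply, LinearMap.add_apply, mx, LinearMap.mulLeft_apply]
  obtain ⟨κ, rfl⟩ := Nat.exists_eq_add_of_le' hκ
  obtain ⟨r, B', rfl⟩ := exists_cons_card B hB
  have hB' : Multiset.card B' = κ + 1 + 1 := by simpa using hB
  obtain ⟨v, B'', rfl⟩ := exists_cons_card B' hB'
  obtain ⟨N, rfl, rfl, h3⟩ := exists_zip (k := κ + 1) A B'' hA (by simpa using hB)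
  have key : ∀ u, X (f (.inl u)) * pm ((N.map Prod.fst).map (fun i => f (.inl i)) +
      (r ::ₘ v ::ₘ N.map Prod.snd).map (fun j => f (.inr j))) = pm (tmon f (N, u, r, v)) := by
    intro u
    simp [pm, tmon]
    ring
  simp only [key, Psi_mon, val]
  obtain ⟨⟨z, w⟩, N', rfl⟩ := exists_cons_card N h3
  have := D.x_Eh_alt u i j k z w p q r v
  have h := congrArg (fun y => D.mon N' • y) this
  simp only [mon_cons] at h ⊢
  linear_combination (norm := module) h

theorem Psi_C {κ : ℕ} (r : β) (P : MvPolynomial γ ℂ) (hP : P ∈ Bi f (κ + 1) (κ + 1)) :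
    D.Psi f i j k p q (X (f (.inr r)) * P) + D.Psi f i j k q r (X (f (.inr p)) * P) +
      D.Psi f i j k r p (X (f (.inr q)) * P) =
    D.tr.Psi ((Equiv.sumComm β α).trans f) p q r i j (X (f (.inl k)) * P) +
      D.tr.Psi ((Equiv.sumComm β α).trans f) p q r j k (X (f (.inl i)) * P) +
      D.tr.Psi ((Equiv.sumComm β α).trans f) p q r k i (X (f (.inl j)) * P) := by
  let mx : γ → MvPolynomial γ ℂ →ₗ[ℂ] MvPolynomial γ ℂ := fun g => LinearMap.mulLeft ℂ (X g)
  refine Bi_ext f (D.Psi f i j k p q ∘ₗ mx (f (.inr r)) + D.Psi f i j k q r ∘ₗ mx (f (.inr p)) +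
      D.Psi f i j k r p ∘ₗ mx (f (.inr q)))
    (D.tr.Psi ((Equiv.sumComm β α).trans f) p q r i j ∘ₗ mx (f (.inl k)) +
      D.tr.Psi ((Equiv.sumComm β α).trans f) p q r j k ∘ₗ mx (f (.inl i)) +
      D.tr.Psi ((Equiv.sumComm β α).trans f) p q r k i ∘ₗ mx (f (.inl j))) ?_ P hP
  intro A B hA hB
  simp only [LinearMap.comp_apply, LinearMap.add_apply, mx, LinearMap.mulLeft_apply]
  obtain ⟨u, A', rfl⟩ := exists_cons_card A hA
  obtain ⟨v, B', rfl⟩ := exists_cons_card B hB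
  obtain ⟨N, rfl, rfl, h3⟩ := exists_zip (k := κ) A' B' (by simpa using hA) (by simpa using hB)
  have key1 : ∀ r, X (f (.inr r)) * pm ((u ::ₘ N.map Prod.fst).map (fun i => f (.inl i)) +
      (v ::ₘ N.map Prod.snd).map (fun j => f (.inr j))) = pm (tmon f (N, u, r, v)) := by
    intro r
    simp [pm, tmon]
  have key2 : ∀ k, X (f (.inl k)) * pm ((u ::ₘ N.map Prod.fst).map (fun i => f (.inl i)) +
      (v ::ₘ N.map Prod.snd).map (fun j => f (.inr j))) =
      pm (tmon ((Equiv.sumComm β α).trans f) (N.map Prod.swap, v, k, u)) := by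
    intro r
    simp [pm, tmon, Function.comp_def]
    ring
  simp only [key1, key2, Psi_mon, val]
  have h := congrArg (fun y => D.mon N • y) (D.VW_cyc u i j k p q r v)
  have hm : D.tr.mon (N.map Prod.swap) = D.mon N := by
    simp [mon, tr, Function.comp_def]
  rw [hm]
  linear_combination (norm := module) h

end Psi
end Dat



open MvPolynomial

namespace Kz

variable {γ ι : Type} [Fintype ι] (s : ι → γ)

/-- contraction -/
noncomputable def bd (y : ι → MvPolynomial γ ℂ) : MvPolynomial γ ℂ := ∑ i, X (s i) * y i

/-- Euler relation -/
def Eu (a : ℕ) (P : MvPolynomial γ ℂ) : Prop :=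
  ∑ i, X (s i) * pderiv (s i) P = (a : MvPolynomial γ ℂ) * P

theorem pd_bd (hs : Function.Injective s) (q : ι) (y : ι → MvPolynomial γ ℂ) :
    pderiv (s q) (bd s y) = y q + bd s (fun p => pderiv (s q) (y p)) := by
  classical
  unfold bd
  rw [map_sum]
  simp only [Derivation.leibniz, pderiv_X, smul_eq_mul, Finset.sum_add_distrib]
  rw [add_comm]
  congr 1
  rw [Finset.sum_eq_single q]
  · simp
  · intro b _ hb
    rw [Pi.single_eq_of_ne (fun h => hb (hs h)), mul_zero]
  · simp

theorem pd_comm (g h : γ) (P : MvPolynomial γ ℂ) :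
    pderiv g (pderiv h P) = pderiv h (pderiv g P) := by
  classical
  have : ⁅(pderiv g : Derivation ℂ (MvPolynomial γ ℂ) (MvPolynomial γ ℂ)),
      (pderiv h : Derivation ℂ (MvPolynomial γ ℂ) (MvPolynomial γ ℂ))⁆ = 0 := by
    apply MvPolynomial.derivation_ext
    intro i
    rw [Derivation.commutator_apply]
    simp [pderiv_X, Pi.single_apply]
    split_ifs <;> simp
  have h2 := congrArg (fun D => D P) this
  rw [Derivation.commutator_apply] at h2
  simpa [sub_eq_zero] using h2

theorem bd_add (y z : ι → MvPolynomial γ ℂ) : bd s (fun p => y p + z p) = bd s y + bd s z := by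
  simp [bd, mul_add, Finset.sum_add_distrib]
theorem bd_neg (y : ι → MvPolynomial γ ℂ) : bd s (fun p => - y p) = - bd s y := by
  simp [bd]
theorem bd_sub (y z : ι → MvPolynomial γ ℂ) : bd s (fun p => y p - z p) = bd s y - bd s z := by
  simp [bd, mul_sub]
theorem bd_smul (c : ℂ) (y : ι → MvPolynomial γ ℂ) : bd s (fun p => c • y p) = c • bd s y := by
  simp [bd, Finset.smul_sum]
theorem bd_zero : bd s (fun _ => 0) = 0 := by
  simp [bd]
theorem bd_bd {ι' : Type} [Fintype ι'] (t : ι' → γ) (y : ι → ι' → MvPolynomial γ ℂ) :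
    bd s (fun i => bd t (y i)) = bd t (fun p => bd s (fun i => y i p)) := by
  simp only [bd, Finset.mul_sum]
  rw [Finset.sum_comm]
  refine Finset.sum_congr rfl fun _ _ => Finset.sum_congr rfl fun _ _ => by ring
/-- differentiation in an unrelated variable -/
theorem pd_bd' (g : γ) (hg : ∀ i, s i ≠ g) (y : ι → MvPolynomial γ ℂ) :
    pderiv g (bd s y) = bd s (fun p => pderiv g (y p)) := by
  classical
  unfold bd
  rw [map_sum]
  refine Finset.sum_congr rfl fun i _ => ?_
  simp [Derivation.leibniz, pderiv_X, Pi.single_eq_of_ne (hg i)]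

theorem bd_pd {a : ℕ} {P : MvPolynomial γ ℂ} (h : Eu s a P) :
    bd s (fun p => pderiv (s p) P) = (a : MvPolynomial γ ℂ) * P := h

/-- homotopies -/
noncomputable def D1 (y : ι → MvPolynomial γ ℂ) (p q : ι) : MvPolynomial γ ℂ :=
  pderiv (s p) (y q) - pderiv (s q) (y p)

noncomputable def D2 (y : ι → ι → MvPolynomial γ ℂ) (p q r : ι) : MvPolynomial γ ℂ :=
  pderiv (s p) (y q r) + pderiv (s q) (y r p) + pderiv (s r) (y p q)

theorem kos1 (hs : Function.Injective s) (y : ι → MvPolynomial γ ℂ) (a : ℕ) (h : ∀ q, Eu s a (y q))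
    (q : ι) : bd s (fun p => D1 s y p q) = ((a + 1 : ℕ) : MvPolynomial γ ℂ) * y q
      - pderiv (s q) (bd s y) := by
  unfold D1
  rw [bd_sub, bd_pd s (h q), pd_bd s hs]
  push_cast; ring

theorem kos2 (hs : Function.Injective s) (y : ι → ι → MvPolynomial γ ℂ) (a : ℕ)
    (h : ∀ q r, Eu s a (y q r)) (hy : ∀ q r, y q r = - y r q)
    (q r : ι) : bd s (fun p => D2 s y p q r) = ((a + 2 : ℕ) : MvPolynomial γ ℂ) * y q r
      - pderiv (s q) (bd s (fun p => y p r)) + pderiv (s r) (bd s (fun p => y p q)) := by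
  unfold D2
  rw [bd_add, bd_add, bd_pd s (h q r), pd_bd s hs, pd_bd s hs]
  have : bd s (fun p => pderiv (s q) (y r p)) = - bd s (fun p => pderiv (s q) (y p r)) := by
    rw [← bd_neg]
    congr 1; ext1 p; rw [hy r p, map_neg]
  rw [this, hy r q]
  push_cast; ring

end Kz

namespace Dat
variable {α β γ : Type} (f : α ⊕ β ≃ γ)

theorem Bi_swap (a b : ℕ) : Bi ((Equiv.sumComm β α).trans f) b a = Bi f a b := by
  rw [Bi_span, Bi_span]
  congr 1
  ext P
  constructor
  · rintro ⟨A, B, h1, h2, rfl⟩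
    exact ⟨B, A, h2, h1, by rw [add_comm]; rfl⟩
  · rintro ⟨A, B, h1, h2, rfl⟩
    exact ⟨B, A, h2, h1, by rw [add_comm]; rfl⟩

theorem Bi_X_inl {a b : ℕ} {P : MvPolynomial γ ℂ} (i : α) (hP : P ∈ Bi f a b) :
    X (f (.inl i)) * P ∈ Bi f (a + 1) b := by
  have := (isWeightedHomogeneous_X ℂ (wt f) (f (.inl i))).mul hP
  simp only [wt, Equiv.symm_apply_apply, Sum.elim_inl, Prod.mk_add_mk, zero_add] at this
  rw [add_comm 1 a] at this
  exact this

theorem Bi_X_inr {a b : ℕ} {P : MvPolynomial γ ℂ} (i : β) (hP : P ∈ Bi f a b) :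
    X (f (.inr i)) * P ∈ Bi f a (b + 1) := by
  have := (isWeightedHomogeneous_X ℂ (wt f) (f (.inr i))).mul hP
  simp only [wt, Equiv.symm_apply_apply, Sum.elim_inr, Prod.mk_add_mk, zero_add] at this
  rw [add_comm 1 b] at this
  exact this

theorem Bi_pd_inl {a b : ℕ} {P : MvPolynomial γ ℂ} (i : α) (hP : P ∈ Bi f (a + 1) b) :
    pderiv (f (.inl i)) P ∈ Bi f a b :=
  IsWeightedHomogeneous.pderiv (n := (a + 1, b)) hP (by simp [wt])

theorem Bi_pd_inr {a b : ℕ} {P : MvPolynomial γ ℂ} (i : β) (hP : P ∈ Bi f a (b + 1)) :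
    pderiv (f (.inr i)) P ∈ Bi f a b :=
  IsWeightedHomogeneous.pderiv (n := (a, b + 1)) hP (by simp [wt])

theorem Bi_bd_inl [Fintype α] {a b : ℕ} {y : α → MvPolynomial γ ℂ} (hP : ∀ i, y i ∈ Bi f a b) :
    Kz.bd (fun i => f (.inl i)) y ∈ Bi f (a + 1) b :=
  Submodule.sum_mem _ fun i _ => Bi_X_inl f i (hP i)

theorem Bi_bd_inr [Fintype β] {a b : ℕ} {y : β → MvPolynomial γ ℂ} (hP : ∀ i, y i ∈ Bi f a b) :
    Kz.bd (fun i => f (.inr i)) y ∈ Bi f a (b + 1) :=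
  Submodule.sum_mem _ fun i _ => Bi_X_inr f i (hP i)

theorem Eu_inl [Fintype α] {a b : ℕ} {P : MvPolynomial γ ℂ} (hP : P ∈ Bi f a b) :
    Kz.Eu (fun i => f (.inl i)) a P := by
  classical
  revert P
  intro P0 hP0
  have : ∀ P ∈ Bi f a b, (∑ i, LinearMap.mulLeft ℂ (X (f (.inl i))) ∘ₗ
      ((pderiv (f (.inl i)) : Derivation ℂ (MvPolynomial γ ℂ) (MvPolynomial γ ℂ)) :
        MvPolynomial γ ℂ →ₗ[ℂ] MvPolynomial γ ℂ)) P =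
      (LinearMap.mulLeft ℂ (a : MvPolynomial γ ℂ)) P := by
    refine Bi_ext f _ _ ?_
    rintro A B rfl -
    clear hP0
    simp only [LinearMap.sum_apply, LinearMap.comp_apply, LinearMap.mulLeft_apply, Derivation.coeFn_coe]
    induction A using Multiset.induction_on with
    | empty =>
      have h0 : ∀ i, pderiv (f (.inl i)) (pm (B.map fun j => f (.inr j))) = 0 := by
        intro i
        induction B using Multiset.induction_on with
        | empty => simp [pm]
        | cons b B ih => 
          simp only [pm, Multiset.map_cons, Multiset.prod_cons, Derivation.leibniz] at ih ⊢
          rw [ih, pderiv_X]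
          simp
      simp [h0]
    | cons u A ih =>
      have e : pm (((u ::ₘ A).map fun i => f (.inl i)) + B.map fun j => f (.inr j)) =
          X (f (.inl u)) * pm ((A.map fun i => f (.inl i)) + B.map fun j => f (.inr j)) := by
        simp [pm]
      rw [e]
      simp only [Derivation.leibniz, pderiv_X, smul_eq_mul, mul_add, Finset.sum_add_distrib,
        Multiset.card_cons]
      have e2 : ∀ x, X (R := ℂ) (f (.inl x)) * (X (f (.inl u)) * pderiv (f (.inl x))
          (pm ((A.map fun i => f (.inl i)) + B.map fun j => f (.inr j)))) = 
          X (f (.inl u)) * (X (f (.inl x)) * pderiv (f (.inl x))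
          (pm ((A.map fun i => f (.inl i)) + B.map fun j => f (.inr j)))) := fun x => by ring
      simp only [e2, ← Finset.mul_sum, ih]
      rw [Finset.sum_eq_single u]
      · simp; ring
      · intro b _ hb
        rw [Pi.single_eq_of_ne (by simpa using hb.symm)]; simp
      · simp
  have := this P0 hP0
  simpa [Kz.Eu] using this

theorem Eu_inr [Fintype β] {a b : ℕ} {P : MvPolynomial γ ℂ} (hP : P ∈ Bi f a b) :
    Kz.Eu (fun i => f (.inr i)) b P := by
  rw [← Bi_swap f] at hP
  exact Eu_inl ((Equiv.sumComm β α).trans f) hP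

end Dat



open MvPolynomial

namespace Dat

variable {α β γ : Type} [Fintype α] [Fintype β] (f : α ⊕ β ≃ γ)

/-- The spaces of alternating coefficient arrays. -/
noncomputable def TV (κ : ℕ) : Submodule ℂ (α → α → α → β → β → MvPolynomial γ ℂ) where
  carrier := {τ | (∀ i j k p q, τ i j k p q = - τ j i k p q) ∧
    (∀ i j k p q, τ i j k p q = - τ i k j p q) ∧ (∀ i j k p q, τ i j k p q = - τ i j k q p) ∧
    ∀ i j k p q, τ i j k p q ∈ Bi f (κ + 1) (κ + 2)}
  zero_mem' := by
    refine ⟨?_, ?_, ?_, ?_⟩ <;> intros <;> simp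
  add_mem' := by
    rintro a b ⟨h1, h2, h3, h4⟩ ⟨k1, k2, k3, k4⟩
    refine ⟨fun i j k p q => ?_, fun i j k p q => ?_, fun i j k p q => ?_, fun i j k p q => ?_⟩
    · simp only [Pi.add_apply]; rw [h1, k1]; ring
    · simp only [Pi.add_apply]; rw [h2, k2]; ring
    · simp only [Pi.add_apply]; rw [h3, k3]; ring
    · exact Submodule.add_mem _ (h4 _ _ _ _ _) (k4 _ _ _ _ _)
  smul_mem' := by
    rintro c a ⟨h1, h2, h3, h4⟩
    refine ⟨fun i j k p q => ?_, fun i j k p q => ?_, fun i j k p q => ?_, fun i j k p q => ?_⟩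
    · simp only [Pi.smul_apply]; rw [h1, smul_neg]
    · simp only [Pi.smul_apply]; rw [h2, smul_neg]
    · simp only [Pi.smul_apply]; rw [h3, smul_neg]
    · exact Submodule.smul_mem _ _ (h4 _ _ _ _ _)

variable {S Q : Type} [CommRing S] [AddCommGroup Q] [Module S Q] (D : Dat α β S Q) [Module ℂ Q]

/-- total comparison map -/
noncomputable def psi : (α → α → α → β → β → MvPolynomial γ ℂ) →ₗ[ℂ] Q where
  toFun := fun τ => ∑ i, ∑ j, ∑ k, ∑ p, ∑ q, D.Psi f i j k p q (τ i j k p q)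
  map_add' := by
    intro a b
    simp [Finset.sum_add_distrib]
  map_smul' := by
    intro a b
    simp [Finset.smul_sum]

theorem psi_apply (τ : α → α → α → β → β → MvPolynomial γ ℂ) :
    D.psi f τ = ∑ i, ∑ j, ∑ k, ∑ p, ∑ q, D.Psi f i j k p q (τ i j k p q) := rfl

theorem bd_rot12 {ι : Type} [Fintype ι] (s : ι → γ) (τ : ι → ι → ι → MvPolynomial γ ℂ)
    (h : ∀ i j k, τ i j k = - τ j i k) (j k) :
    Kz.bd s (fun i => τ j i k) = - Kz.bd s (fun i => τ i j k) := by
  rw [← Kz.bd_neg]; congr 1; ext1 i; exact h _ _ _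

theorem K3_aux {κ : ℕ} (hκ : 1 ≤ κ) (τ : α → α → α → MvPolynomial γ ℂ) (p q : β)
    (h12 : ∀ i j k, τ i j k = - τ j i k) (h23 : ∀ i j k, τ i j k = - τ i k j)
    (hB : ∀ i j k, τ i j k ∈ Bi f (κ + 1) (κ + 2))
    (h0 : ∀ j k, Kz.bd (fun i => f (.inl i)) (fun i => τ i j k) = 0) :
    ∑ i, ∑ j, ∑ k, D.Psi f i j k p q (τ i j k) = 0 := by
  have hinj : Function.Injective (fun i : α => f (.inl i : α ⊕ β)) :=
    f.injective.comp Sum.inl_injective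
  have h0' : ∀ i k, Kz.bd (fun i => f (.inl i)) (fun j => τ i j k) = 0 := by
    intro i k; rw [bd_rot12 _ _ h12, h0, neg_zero]
  have h0'' : ∀ i j, Kz.bd (fun i => f (.inl i)) (fun k => τ i j k) = 0 := by
    intro i j
    have : (fun k => τ i j k) = fun k => - τ i k j := by ext1 k; exact h23 _ _ _
    rw [this, Kz.bd_neg, h0', neg_zero]
  have key : ∀ (y : α → MvPolynomial γ ℂ), Kz.bd (fun i => f (.inl i)) y = 0 → ∀ l,
      ∑ i, X (f (.inl i)) * pderiv (f (.inl l)) (y i) = - y l := by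
    intro y hy l
    have := Kz.pd_bd (fun i => f (.inl i)) hinj l y
    rw [hy, map_zero] at this
    exact (neg_eq_of_add_eq_zero_right this.symm).symm
  set T := ∑ i, ∑ j, ∑ k, D.Psi f i j k p q (τ i j k) with hT
  have e1 : ((κ + 1 : ℕ) : ℂ) • T = ∑ i, ∑ j, ∑ k, ∑ l,
      D.Psi f i j k p q (X (f (.inl l)) * pderiv (f (.inl l)) (τ i j k)) := by
    rw [hT]
    simp only [Finset.smul_sum, ← map_smul, ← map_sum]
    refine Finset.sum_congr rfl fun i _ => Finset.sum_congr rfl fun j _ =>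
      Finset.sum_congr rfl fun k _ => ?_
    congr 1
    have := Eu_inl f (hB i j k)
    rw [Kz.Eu] at this
    rw [this, Nat.cast_smul_eq_nsmul, nsmul_eq_mul]
  have e2 : ∀ i j k l, D.Psi f i j k p q (X (f (.inl l)) * pderiv (f (.inl l)) (τ i j k)) =
      D.Psi f l j k p q (X (f (.inl i)) * pderiv (f (.inl l)) (τ i j k)) +
      D.Psi f i l k p q (X (f (.inl j)) * pderiv (f (.inl l)) (τ i j k)) +
      D.Psi f i j l p q (X (f (.inl k)) * pderiv (f (.inl l)) (τ i j k)) := fun i j k l =>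
    D.Psi_B f i j k p q hκ l _ (Bi_pd_inl f l (hB i j k))
  simp only [e2, Finset.sum_add_distrib] at e1
  have e3 : ∑ i, ∑ j, ∑ k, ∑ l, D.Psi f l j k p q (X (f (.inl i)) * pderiv (f (.inl l)) (τ i j k))
      = - T := by
    have : ∀ i, ∑ j, ∑ k, ∑ l, D.Psi f l j k p q (X (f (.inl i)) * pderiv (f (.inl l)) (τ i j k))
      = ∑ l, ∑ j, ∑ k, D.Psi f l j k p q (X (f (.inl i)) * pderiv (f (.inl l)) (τ i j k)) := by
      intro i
      rw [Finset.sum_comm]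
      conv_rhs => rw [Finset.sum_comm]
      rw [Finset.sum_comm]
      exact Finset.sum_congr rfl fun j _ => Finset.sum_comm
    simp only [this]
    rw [Finset.sum_comm, hT, ← Finset.sum_neg_distrib]
    refine Finset.sum_congr rfl fun l _ => ?_
    rw [Finset.sum_comm, ← Finset.sum_neg_distrib]
    refine Finset.sum_congr rfl fun j _ => ?_
    rw [Finset.sum_comm, ← Finset.sum_neg_distrib]
    refine Finset.sum_congr rfl fun k _ => ?_
    rw [← map_sum, key (fun i => τ i j k) (h0 j k) l, map_neg]
  have e4 : ∑ i, ∑ j, ∑ k, ∑ l, D.Psi f i l k p q (X (f (.inl j)) * pderiv (f (.inl l)) (τ i j k))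
      = - T := by
    rw [hT, ← Finset.sum_neg_distrib]
    refine Finset.sum_congr rfl fun i _ => ?_
    have : ∀ j, ∑ k, ∑ l, D.Psi f i l k p q (X (f (.inl j)) * pderiv (f (.inl l)) (τ i j k))
      = ∑ l, ∑ k, D.Psi f i l k p q (X (f (.inl j)) * pderiv (f (.inl l)) (τ i j k)) :=
      fun j => Finset.sum_comm
    simp only [this]
    rw [Finset.sum_comm, ← Finset.sum_neg_distrib]
    refine Finset.sum_congr rfl fun j _ => ?_
    rw [Finset.sum_comm, ← Finset.sum_neg_distrib]
    refine Finset.sum_congr rfl fun k _ => ?_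
    rw [← map_sum, key (fun j => τ i j k) (h0' i k) j, map_neg]
  have e5 : ∑ i, ∑ j, ∑ k, ∑ l, D.Psi f i j l p q (X (f (.inl k)) * pderiv (f (.inl l)) (τ i j k))
      = - T := by
    rw [hT, ← Finset.sum_neg_distrib]
    refine Finset.sum_congr rfl fun i _ => ?_
    rw [← Finset.sum_neg_distrib]
    refine Finset.sum_congr rfl fun j _ => ?_
    rw [Finset.sum_comm, ← Finset.sum_neg_distrib]
    refine Finset.sum_congr rfl fun k _ => ?_
    rw [← map_sum, key (fun k => τ i j k) (h0'' i j) k, map_neg]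
  rw [e3, e4, e5] at e1
  have e6 : ((κ + 4 : ℕ) : ℂ) • T = 0 := by
    have : ((κ + 4 : ℕ) : ℂ) = ((κ + 1 : ℕ) : ℂ) + 3 := by push_cast; ring
    rw [this, add_smul, e1]; module
  exact (smul_eq_zero.1 e6).resolve_left (Nat.cast_ne_zero.2 (by omega))

theorem K3 {κ : ℕ} (hκ : 1 ≤ κ) (τ : α → α → α → β → β → MvPolynomial γ ℂ) (hτ : τ ∈ TV f κ)
    (h0 : ∀ j k p q, Kz.bd (fun i => f (.inl i)) (fun i => τ i j k p q) = 0) :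
    D.psi f τ = 0 := by
  obtain ⟨h1, h2, h3, h4⟩ := hτ
  have : D.psi f τ = ∑ p, ∑ q, ∑ i, ∑ j, ∑ k, D.Psi f i j k p q (τ i j k p q) := by
    rw [psi_apply]
    have a1 : ∀ (F : α → β → β → Q), ∑ k, ∑ p, ∑ q, F k p q = ∑ p, ∑ q, ∑ k, F k p q := by
      intro F
      rw [Finset.sum_comm]
      exact Finset.sum_congr rfl fun j _ => Finset.sum_comm
    simp only [a1]
  rw [this]
  refine Finset.sum_eq_zero fun p _ => Finset.sum_eq_zero fun q _ => ?_
  exact D.K3_aux f hκ (fun i j k => τ i j k p q) p q (fun i j k => h1 _ _ _ _ _)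
    (fun i j k => h2 _ _ _ _ _) (fun i j k => h4 _ _ _ _ _) (fun j k => h0 j k p q)

theorem sum_cyc {ι Q : Type} [Fintype ι] [AddCommGroup Q] (F : ι → ι → ι → Q) :
    ∑ p, ∑ q, ∑ r, F p q r = ∑ p, ∑ q, ∑ r, F q r p := by
  rw [Finset.sum_comm]
  conv_rhs => rw [Finset.sum_comm]
  have : ∀ y, ∑ x, ∑ r, F x y r = ∑ r, ∑ x, F x y r := fun y => Finset.sum_comm
  simp only [this]
  rw [Finset.sum_comm]
  conv_lhs => 
    enter [2, r]
    rw [Finset.sum_comm]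
  rw [Finset.sum_comm]

/-- alternating in both triples -/
theorem psi_VW {κ : ℕ} (ξ : α → α → α → β → β → β → MvPolynomial γ ℂ)
    (h1 : ∀ i j k p q r, ξ i j k p q r = ξ j k i p q r)
    (h2 : ∀ i j k p q r, ξ i j k p q r = ξ i j k q r p)
    (hB : ∀ i j k p q r, ξ i j k p q r ∈ Bi f (κ + 1) (κ + 1)) :
    D.psi f (fun i j k p q => Kz.bd (fun r => f (.inr r)) (fun r => ξ i j k r p q)) =
    D.tr.psi ((Equiv.sumComm β α).trans f)
      (fun p q r i j => Kz.bd (fun k => f (.inl k)) (fun k => ξ k i j p q r)) := by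
  have c3 : ∀ a b : Q, (3 : ℂ) • a = (3 : ℂ) • b → a = b := fun a b h => by
    have := congrArg (fun x => (3 : ℂ)⁻¹ • x) h
    simpa [smul_smul] using this
  apply c3
  have L : (3 : ℂ) • D.psi f (fun i j k p q => Kz.bd (fun r => f (.inr r)) (fun r => ξ i j k r p q)) =
      ∑ i, ∑ j, ∑ k, ∑ p, ∑ q, ∑ r, (D.Psi f i j k p q (X (f (.inr r)) * ξ i j k p q r) +
        D.Psi f i j k q r (X (f (.inr p)) * ξ i j k p q r) +
        D.Psi f i j k r p (X (f (.inr q)) * ξ i j k p q r)) := by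
    rw [psi_apply]
    simp only [Finset.smul_sum]
    refine Finset.sum_congr rfl fun i _ => Finset.sum_congr rfl fun j _ =>
      Finset.sum_congr rfl fun k _ => ?_
    simp only [← Finset.smul_sum, Finset.sum_add_distrib]
    have a2 := sum_cyc (fun p q r => D.Psi f i j k p q (X (f (.inr r)) * ξ i j k p q r))
    have a3 := sum_cyc (fun p q r => D.Psi f i j k q r (X (f (.inr p)) * ξ i j k p q r))
    simp only [← h2] at a2 a3
    rw [← a3, ← a2]
    have a4 : ∑ p, ∑ q, D.Psi f i j k p q (Kz.bd (fun r => f (.inr r)) (fun r => ξ i j k r p q)) =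
      ∑ p, ∑ q, ∑ r, D.Psi f i j k p q (X (f (.inr r)) * ξ i j k p q r) := by
      refine Finset.sum_congr rfl fun p _ => Finset.sum_congr rfl fun q _ => ?_
      rw [Kz.bd, map_sum]
      refine Finset.sum_congr rfl fun r _ => ?_
      rw [h2 i j k r p q]
    rw [a4]; module
  have Rr : (3 : ℂ) • D.tr.psi ((Equiv.sumComm β α).trans f)
      (fun p q r i j => Kz.bd (fun k => f (.inl k)) (fun k => ξ k i j p q r)) =
      ∑ p, ∑ q, ∑ r, ∑ i, ∑ j, ∑ k,
      (D.tr.Psi ((Equiv.sumComm β α).trans f) p q r i j (X (f (.inl k)) * ξ i j k p q r) +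
      D.tr.Psi ((Equiv.sumComm β α).trans f) p q r j k (X (f (.inl i)) * ξ i j k p q r) +
      D.tr.Psi ((Equiv.sumComm β α).trans f) p q r k i (X (f (.inl j)) * ξ i j k p q r)) := by
    rw [psi_apply]
    simp only [Finset.smul_sum]
    refine Finset.sum_congr rfl fun p _ => Finset.sum_congr rfl fun q _ =>
      Finset.sum_congr rfl fun r _ => ?_
    simp only [← Finset.smul_sum, Finset.sum_add_distrib]
    have a2 := sum_cyc (fun i j k => D.tr.Psi ((Equiv.sumComm β α).trans f) p q r i j (X (f (.inl k)) * ξ i j k p q r))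
    have a3 := sum_cyc (fun i j k => D.tr.Psi ((Equiv.sumComm β α).trans f) p q r j k (X (f (.inl i)) * ξ i j k p q r))
    simp only [← h1] at a2 a3
    rw [← a3, ← a2]
    have a4 : ∑ i, ∑ j, D.tr.Psi ((Equiv.sumComm β α).trans f) p q r i j
        (Kz.bd (fun k => f (.inl k)) (fun k => ξ k i j p q r)) =
      ∑ i, ∑ j, ∑ k, D.tr.Psi ((Equiv.sumComm β α).trans f) p q r i j
        (X (f (.inl k)) * ξ i j k p q r) := by
      refine Finset.sum_congr rfl fun p _ => Finset.sum_congr rfl fun q _ => ?_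
      rw [Kz.bd, map_sum]
      refine Finset.sum_congr rfl fun r _ => ?_
      rw [h1 r p q]
    rw [a4]; module
  rw [L, Rr]
  have a1 : ∀ (F : α → β → β → β → Q), ∑ k, ∑ p, ∑ q, ∑ r, F k p q r = ∑ p, ∑ q, ∑ r, ∑ k, F k p q r := by
    intro F
    rw [Finset.sum_comm]
    refine Finset.sum_congr rfl fun j _ => ?_
    rw [Finset.sum_comm]
    exact Finset.sum_congr rfl fun j _ => Finset.sum_comm
  simp only [a1]
  refine Finset.sum_congr rfl fun p _ => Finset.sum_congr rfl fun q _ =>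
    Finset.sum_congr rfl fun r _ => Finset.sum_congr rfl fun i _ => Finset.sum_congr rfl fun j _ =>
    Finset.sum_congr rfl fun k _ => ?_
  exact D.Psi_C f i j k p q r _ (hB i j k p q r)

theorem sum_delta {ι Q : Type} [Fintype ι] [DecidableEq ι] [AddCommGroup Q] [Module ℂ Q]
    (i : ι) (F : ι → Q) : ∑ x, (if x = i then (1 : ℂ) else 0) • F x = F i := by
  simp

/-- delta -/
def dl {ι : Type} [DecidableEq ι] (x i : ι) : ℂ := if x = i then 1 else 0

theorem sum_dl {ι Q : Type} [Fintype ι] [DecidableEq ι] [AddCommGroup Q] [Module ℂ Q]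
    (i : ι) (F : ι → Q) : ∑ x, dl x i • F x = F i := by
  simp [dl]

theorem sum_dl3 {Q : Type} [DecidableEq α] [AddCommGroup Q] [Module ℂ Q]
    (i j k : α) (F : α → α → α → Q) :
    ∑ x, ∑ y, ∑ z, (dl x i * dl y j * dl z k) • F x y z = F i j k := by
  simp only [mul_smul, ← Finset.smul_sum, sum_dl]

theorem sum_dl2 {Q : Type} [DecidableEq α] [AddCommGroup Q] [Module ℂ Q]
    (i j : α) (F : α → α → Q) :
    ∑ x, ∑ y, (dl x i * dl y j) • F x y = F i j := by
  simp only [mul_smul, ← Finset.smul_sum, sum_dl]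

theorem Psi_mem_map {κ : ℕ} (hκ : 1 ≤ κ) (i j k : α) (p q : β) (P : MvPolynomial γ ℂ)
    (hP : P ∈ Bi f (κ + 1) (κ + 2)) : D.Psi f i j k p q P ∈ (TV f κ).map (D.psi f) := by
  classical
  let c3 : α → α → α → ℂ := fun x y z => dl x i * dl y j * dl z k + dl x j * dl y k * dl z i +
    dl x k * dl y i * dl z j - dl x i * dl y k * dl z j - dl x j * dl y i * dl z k -
    dl x k * dl y j * dl z i
  let c2 : β → β → ℂ := fun x y => dl x p * dl y q - dl x q * dl y p
  let τ : α → α → α → β → β → MvPolynomial γ ℂ := fun x y z u v => (c3 x y z * c2 u v) • P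
  have hτ : τ ∈ TV f κ := by
    refine ⟨fun x y z u v => ?_, fun x y z u v => ?_, fun x y z u v => ?_, fun x y z u v => ?_⟩
    · simp only [τ, ← neg_smul]; congr 1; simp only [c3, c2]; ring
    · simp only [τ, ← neg_smul]; congr 1; simp only [c3, c2]; ring
    · simp only [τ, ← neg_smul]; congr 1; simp only [c3, c2]; ring
    · exact Submodule.smul_mem _ _ hP
  have e : D.psi f τ = (12 : ℂ) • D.Psi f i j k p q P := by
    have e1 : D.psi f τ = ∑ x, ∑ y, ∑ z, c3 x y z • ∑ u, ∑ v, c2 u v • D.Psi f x y z u v P := by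
      rw [psi_apply]
      simp only [τ, Finset.smul_sum, map_smul, mul_smul]
    have e2 : ∀ x y z, ∑ u, ∑ v, c2 u v • D.Psi f x y z u v P = (2 : ℂ) • D.Psi f x y z p q P := by
      intro x y z
      simp only [c2, sub_smul, Finset.sum_sub_distrib, sum_dl2]
      rw [D.Psi_anti f x y z q p hκ P hP]; module
    rw [e1]
    simp only [e2]
    simp only [c3, sub_smul, add_smul, Finset.sum_sub_distrib, Finset.sum_add_distrib, sum_dl3]
    rw [D.Psi_12 f j k i p q P hP, D.Psi_23 f k j i p q P hP, D.Psi_12 f k i j p q P hP,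
      D.Psi_23 f i k j p q P hP, D.Psi_12 f j i k p q P hP]
    module
  have : D.Psi f i j k p q P = (12 : ℂ)⁻¹ • D.psi f τ := by
    rw [e, smul_smul]; norm_num
  rw [this]
  exact Submodule.smul_mem _ _ ⟨τ, hτ, rfl⟩

end Dat



open MvPolynomial

namespace Kz
theorem kform {γ ι : Type} [Fintype ι] (s : ι → γ)
    (hs : Function.Injective s) (y : ι → ι → MvPolynomial γ ℂ) (a : ℕ)
    (h : ∀ q r, Eu s a (y q r)) (hy : ∀ q r, y q r = - y r q)
    (q r : ι) : y q r - bd s (fun p => ((a + 2 : ℕ) : ℂ)⁻¹ • D2 s y p q r) =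
      ((a + 2 : ℕ) : ℂ)⁻¹ • (pderiv (s q) (bd s (fun p => y p r)) -
        pderiv (s r) (bd s (fun p => y p q))) := by
  have e := kos2 s hs y a h hy q r
  have hc : ((a + 2 : ℕ) : ℂ) ≠ 0 := Nat.cast_ne_zero.2 (by omega)
  rw [bd_smul, e, ← nsmul_eq_mul, ← Nat.cast_smul_eq_nsmul ℂ]
  generalize ((a + 2 : ℕ) : ℂ) = c at *
  match_scalars <;> field_simp <;> ring

end Kz

namespace Dat

variable {α β γ : Type} [Fintype α] [Fintype β] (f : α ⊕ β ≃ γ)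
variable {S Q : Type} [CommRing S] [AddCommGroup Q] [Module S Q] (D : Dat α β S Q) [Module ℂ Q]

theorem core_inj {κ : ℕ} (hκ : 1 ≤ κ) (τ : α → α → α → β → β → MvPolynomial γ ℂ)
    (τ' : β → β → β → α → α → MvPolynomial γ ℂ) (hτ : τ ∈ TV f κ)
    (hτ' : τ' ∈ TV ((Equiv.sumComm β α).trans f) κ)
    (h0 : ∀ j k p q, Kz.bd (fun i => f (.inl i)) (fun i => τ i j k p q) +
      Kz.bd (fun r => f (.inr r)) (fun r => τ' r p q j k) = 0) :
    D.psi f τ + D.tr.psi ((Equiv.sumComm β α).trans f) τ' = 0 := by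
  obtain ⟨h1, h2, h3, h4⟩ := id hτ
  have hinj : Function.Injective (fun i : β => f (.inr i : α ⊕ β)) :=
    f.injective.comp Sum.inr_injective
  set s : α → γ := fun i => f (.inl i) with hs
  set t : β → γ := fun i => f (.inr i) with ht
  have hst : ∀ p i, s i ≠ t p := fun p i h => by simpa using f.injective h
  have hts : ∀ i p, t p ≠ s i := fun i p h => by simpa using f.injective h
  let c : ℂ := ((κ + 4 : ℕ) : ℂ)⁻¹
  have hc : ((κ + 4 : ℕ) : ℂ) ≠ 0 := Nat.cast_ne_zero.2 (by omega)
  let ξ : α → α → α → β → β → β → MvPolynomial γ ℂ := fun i j k p q r =>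
    c • Kz.D2 t (τ i j k) p q r
  have x12 : ∀ i j k p q r, ξ i j k p q r = - ξ j i k p q r := by
    intro i j k p q r
    simp only [ξ, Kz.D2]
    rw [h1 i j k q r, h1 i j k r p, h1 i j k p q]
    simp only [map_neg, ← smul_neg]; congr 1; ring
  have x23 : ∀ i j k p q r, ξ i j k p q r = - ξ i k j p q r := by
    intro i j k p q r
    simp only [ξ, Kz.D2]
    rw [h2 i j k q r, h2 i j k r p, h2 i j k p q]
    simp only [map_neg, ← smul_neg]; congr 1; ring
  have xcyc : ∀ i j k p q r, ξ i j k p q r = ξ i j k q r p := by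
    intro i j k p q r
    simp only [ξ, Kz.D2]
    congr 1; ring
  have y12 : ∀ i j k p q r, ξ i j k p q r = - ξ i j k q p r := by
    intro i j k p q r
    simp only [ξ, Kz.D2]
    rw [h3 i j k q r, h3 i j k r p, h3 i j k p q]
    simp only [map_neg, ← smul_neg]; congr 1; ring
  have y23 : ∀ i j k p q r, ξ i j k p q r = - ξ i j k p r q := by
    intro i j k p q r
    rw [xcyc i j k p q r, y12, ← xcyc]
  have xB : ∀ i j k p q r, ξ i j k p q r ∈ Bi f (κ + 1) (κ + 1) := by
    intro i j k p q r
    refine Submodule.smul_mem _ _ (Submodule.add_mem _ (Submodule.add_mem _ ?_ ?_) ?_) <;>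
    exact Bi_pd_inr f _ (h4 _ _ _ _ _)
  let σ : α → α → α → β → β → MvPolynomial γ ℂ := fun i j k p q => Kz.bd t (fun r => ξ i j k r p q)
  let σ' : β → β → β → α → α → MvPolynomial γ ℂ := fun p q r i j => Kz.bd s (fun k => ξ k i j p q r)
  have hσ : σ ∈ TV f κ := by
    refine ⟨fun i j k p q => ?_, fun i j k p q => ?_, fun i j k p q => ?_, fun i j k p q => ?_⟩
    · simp only [σ, ← Kz.bd_neg]; congr 1; ext1 r; exact x12 _ _ _ _ _ _
    · simp only [σ, ← Kz.bd_neg]; congr 1; ext1 r; exact x23 _ _ _ _ _ _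
    · simp only [σ, ← Kz.bd_neg]; congr 1; ext1 r; exact y23 _ _ _ _ _ _
    · exact Bi_bd_inr f fun r => xB _ _ _ _ _ _
  have hσ' : σ' ∈ TV ((Equiv.sumComm β α).trans f) κ := by
    refine ⟨fun i j k p q => ?_, fun i j k p q => ?_, fun i j k p q => ?_, fun i j k p q => ?_⟩
    · simp only [σ', ← Kz.bd_neg]; congr 1; ext1 r; exact y12 _ _ _ _ _ _
    · simp only [σ', ← Kz.bd_neg]; congr 1; ext1 r; exact y23 _ _ _ _ _ _
    · simp only [σ', ← Kz.bd_neg]; congr 1; ext1 r; exact x23 _ _ _ _ _ _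
    · rw [Bi_swap]; exact Bi_bd_inl f fun r => xB _ _ _ _ _ _
  have hVW : D.psi f σ = D.tr.psi ((Equiv.sumComm β α).trans f) σ' :=
    D.psi_VW f ξ (fun i j k p q r => by rw [x12, x23, neg_neg]) xcyc xB
  -- explicit formula
  have hform : ∀ i j k p q, τ i j k p q - σ i j k p q =
      c • (pderiv (t p) (Kz.bd t (fun r => τ i j k r q)) -
        pderiv (t q) (Kz.bd t (fun r => τ i j k r p))) := by
    intro i j k p q
    exact Kz.kform t hinj (τ i j k) (κ + 2) (fun q r => Eu_inr f (h4 i j k q r))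
      (fun q r => h3 i j k q r) p q
  have hV : ∀ j k p q, Kz.bd s (fun i => τ i j k p q - σ i j k p q) = 0 := by
    intro j k p q
    simp only [hform]
    rw [Kz.bd_smul, Kz.bd_sub, ← Kz.pd_bd' s (t p) (hst p), ← Kz.pd_bd' s (t q) (hst q)]
    have z : ∀ q, Kz.bd s (fun i => Kz.bd t (fun r => τ i j k r q)) = 0 := by
      intro q
      rw [Kz.bd_bd]
      have : ∀ r, Kz.bd s (fun i => τ i j k r q) = - Kz.bd t (fun r' => τ' r' r q j k) :=
        fun r => eq_neg_of_add_eq_zero_left (h0 j k r q)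
      simp only [this]
      rw [Kz.bd_neg]
      have h5 : Kz.bd t (fun p => Kz.bd t (fun r' => τ' r' p q j k)) =
          - Kz.bd t (fun p => Kz.bd t (fun r' => τ' r' p q j k)) := by
        conv_lhs => rw [Kz.bd_bd]
        rw [← Kz.bd_neg]
        congr 1; ext1 p
        rw [← Kz.bd_neg]
        congr 1; ext1 r
        exact hτ'.1 _ _ _ _ _
      have h6 : Kz.bd t (fun p => Kz.bd t (fun r' => τ' r' p q j k)) = 0 := by
        have := CharZero.eq_neg_self_iff.1 h5
        exact this
      rw [h6, neg_zero]
    rw [z, z]; simp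
  have k1 : D.psi f (τ - σ) = 0 :=
    D.K3 f hκ _ (Submodule.sub_mem _ hτ hσ) (fun j k p q => hV j k p q)
  have k2 : D.tr.psi ((Equiv.sumComm β α).trans f) (τ' + σ') = 0 := by
    refine D.tr.K3 _ hκ _ (Submodule.add_mem _ hτ' hσ') (fun q r i j => ?_)
    change Kz.bd t (fun p => τ' p q r i j + σ' p q r i j) = 0
    rw [Kz.bd_add]
    have a1 := h0 i j q r
    have a2 := hV i j q r
    rw [Kz.bd_sub, Kz.bd_bd] at a2
    rw [← sub_eq_zero.1 a2, add_comm]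
    exact a1
  rw [map_sub, sub_eq_zero] at k1
  rw [map_add] at k2
  rw [k1, hVW, add_comm]
  exact k2

end Dat



open MvPolynomial

namespace Dat

variable {α β γ : Type} [Fintype α] [Fintype β] [DecidableEq α] [DecidableEq β] (f : α ⊕ β ≃ γ)
variable {S Q : Type} [CommRing S] [AddCommGroup Q] [Module S Q] (D : Dat α β S Q) [Module ℂ Q]

/-- antisymmetrized delta -/
def ep {ι : Type} [DecidableEq ι] (i j a b : ι) : ℂ := dl i a * dl j b - dl i b * dl j a

theorem sum_ep2 {M : Type} [AddCommGroup M] [Module ℂ M] (ζ : α → α → M)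
    (h : ∀ i j, ζ i j = - ζ j i) (a b : α) : ∑ i, ∑ j, ep i j a b • ζ i j = (2 : ℂ) • ζ a b := by
  simp only [ep, sub_smul, Finset.sum_sub_distrib, sum_dl2]
  rw [h b a]; module

theorem sum_ep4 {M : Type} [AddCommGroup M] [Module ℂ M] (ζ : α → α → β → β → M)
    (h1 : ∀ i j p q, ζ i j p q = - ζ j i p q) (h2 : ∀ i j p q, ζ i j p q = - ζ i j q p)
    (a b : α) (c d : β) :
    ∑ i, ∑ j, ∑ p, ∑ q, (ep i j a b * ep p q c d) • ζ i j p q = (4 : ℂ) • ζ a b c d := by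
  simp only [mul_smul, ← Finset.smul_sum]
  have : ∀ i j, ∑ p, ∑ q, ep p q c d • ζ i j p q = (2 : ℂ) • ζ i j c d := fun i j =>
    sum_ep2 (ζ i j) (h2 i j) c d
  simp only [this]
  rw [sum_ep2 (fun i j => (2 : ℂ) • ζ i j c d) (fun i j => by rw [h1, smul_neg])]
  rw [smul_smul]; norm_num

theorem Pi_Psi {κ : ℕ} (π : Q →ₗ[ℂ] MvPolynomial γ ℂ)
    (hπ : ∀ i p z, π (D.x i p • z) = X (f (.inl i)) * X (f (.inr p)) * π z)
    (i j k : α) (p q : β) (P : MvPolynomial γ ℂ) (hP : P ∈ Bi f (κ + 1) (κ + 2)) :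
    π (D.Psi f i j k p q P) = 2 * (P * (X (f (.inl i)) * π (D.e j k p q) -
      X (f (.inl j)) * π (D.e i k p q) + X (f (.inl k)) * π (D.e i j p q))) := by
  have := tup_ext f (π ∘ₗ D.Psi f i j k p q) (LinearMap.mulRight ℂ (2 * (X (f (.inl i)) * π (D.e j k p q) -
      X (f (.inl j)) * π (D.e i k p q) + X (f (.inl k)) * π (D.e i j p q)))) ?_ P hP
  · simp only [LinearMap.comp_apply, LinearMap.mulRight_apply] at this
    rw [this]; ring
  · rintro ⟨N, u, r, v⟩ -
    simp only [LinearMap.comp_apply, LinearMap.mulRight_apply, Psi_mon, val]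
    have hN : ∀ z, π (D.mon N • z) = pm (N.map fun a => f (.inl a.1)) *
        pm (N.map fun a => f (.inr a.2)) * π z := by
      induction N using Multiset.induction_on with
      | empty => intro z; simp [mon, pm]
      | cons a N ih =>
        intro z
        rw [mon_cons, mul_smul, hπ, ih]
        simp only [pm, Multiset.map_cons, Multiset.prod_cons]; ring
    rw [hN]
    have hpm : pm (tmon f (N, u, r, v)) = X (f (.inl u)) * X (f (.inr r)) * X (f (.inr v)) *
        (pm (N.map fun a => f (.inl a.1)) * pm (N.map fun a => f (.inr a.2))) := by
      simp [pm, tmon, Function.comp_def]; ring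
    rw [hpm]
    simp only [Eh, lam, E, map_add, map_sub, hπ, smul_add, smul_sub]
    ring

theorem Pi_psi {κ : ℕ} (π : Q →ₗ[ℂ] MvPolynomial γ ℂ)
    (hπ : ∀ i p z, π (D.x i p • z) = X (f (.inl i)) * X (f (.inr p)) * π z)
    (a b : α) (c d : β)
    (he : ∀ i j p q, π (D.e i j p q) = C (ep i j a b * ep p q c d))
    (τ : α → α → α → β → β → MvPolynomial γ ℂ) (hτ : τ ∈ TV f κ) :
    π (D.psi f τ) = (24 : ℂ) • Kz.bd (fun i => f (.inl i)) (fun i => τ i a b c d) := by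
  obtain ⟨h1, h2, h3, h4⟩ := hτ
  rw [psi_apply]
  simp only [map_sum]
  simp only [D.Pi_Psi f π hπ _ _ _ _ _ _ (h4 _ _ _ _ _), he]
  have g : ∀ i j k p q, 2 * (τ i j k p q * (X (f (.inl i)) * C (ep j k a b * ep p q c d) -
      X (f (.inl j)) * C (ep i k a b * ep p q c d) + X (f (.inl k)) * C (ep i j a b * ep p q c d)))
      = (2 : ℂ) • ((ep j k a b * ep p q c d) • (X (f (.inl i)) * τ i j k p q) +
        (ep i k a b * ep p q c d) • (X (f (.inl j)) * τ j i k p q) +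
        (ep i j a b * ep p q c d) • (X (f (.inl k)) * τ k i j p q)) := by
    intro i j k p q
    rw [h1 j i k p q, h1 k i j p q, h2 i k j p q]
    simp only [smul_eq_C_mul]
    rw [show (C (2 : ℂ) : MvPolynomial γ ℂ) = 2 from map_ofNat C 2]
    ring
  simp only [g, ← Finset.smul_sum, Finset.sum_add_distrib]
  have base : ∑ i, ∑ j, ∑ k, ∑ p, ∑ q, (ep j k a b * ep p q c d) • (X (f (.inl i)) * τ i j k p q) =
      (4 : ℂ) • Kz.bd (fun i => f (.inl i)) (fun i => τ i a b c d) := by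
    rw [Kz.bd, Finset.smul_sum]
    refine Finset.sum_congr rfl fun i _ => ?_
    refine sum_ep4 (fun j k p q => X (f (.inl i)) * τ i j k p q) (fun j k p q => ?_)
      (fun j k p q => ?_) a b c d
    · rw [h2]; ring
    · rw [h3]; ring
  have b2 : ∑ i, ∑ j, ∑ k, ∑ p, ∑ q, (ep i k a b * ep p q c d) • (X (f (.inl j)) * τ j i k p q) =
      (4 : ℂ) • Kz.bd (fun i => f (.inl i)) (fun i => τ i a b c d) := by
    rw [← base, Finset.sum_comm]
  have b3 : ∑ i, ∑ j, ∑ k, ∑ p, ∑ q, (ep i j a b * ep p q c d) • (X (f (.inl k)) * τ k i j p q) =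
      (4 : ℂ) • Kz.bd (fun i => f (.inl i)) (fun i => τ i a b c d) := by
    rw [← base]
    let G : α → α → α → MvPolynomial γ ℂ := fun i j k => 
      ∑ p, ∑ q, (ep j k a b * ep p q c d) • (X (f (.inl i)) * τ i j k p q)
    have g1 := sum_cyc G
    have g2 := sum_cyc (fun i j k => G j k i)
    exact (g1.trans g2).symm
  rw [base, b2, b3]
  module

end Dat



open MvPolynomial

namespace Con
open Dat

variable {m n : ℕ}

theorem ep_lt {ι : Type} [LinearOrder ι] {i j a b : ι} (h : i < j) (h' : a < b) :
    ep i j a b = if a = i ∧ b = j then 1 else 0 := by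
  unfold ep dl
  by_cases h1 : a = i
  · subst h1
    by_cases h2 : b = j
    · subst h2; simp [h'.ne]
    · have : j ≠ b := Ne.symm h2
      have h3 : j ≠ a := h.ne'
      simp [h2, this, h3]
  · have : i ≠ a := Ne.symm h1
    by_cases h2 : i = b
    · subst h2
      have : j ≠ a := (h'.trans h).ne'
      simp [h1, this, h'.ne']
    · simp [h1, this, h2]

theorem ep_sw1 {ι : Type} [DecidableEq ι] (i j a b : ι) : ep i j a b = - ep j i a b := by
  unfold ep; ring

theorem ep_self {ι : Type} [DecidableEq ι] (i a b : ι) : ep i i a b = 0 := by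
  unfold ep; ring

/-- coefficient of the generator -/
def epw (i j : Fin m) (p q : Fin n) (w : MinorIdx m n) : ℂ :=
  ep i j w.1.1.1 w.1.1.2 * ep p q w.1.2.1 w.1.2.2

theorem ER {M : Type} [AddCommGroup M] [Module ℂ M] (ζ : Fin m → Fin m → Fin n → Fin n → M)
    (h1 : ∀ i j p q, ζ i j p q = - ζ j i p q) (h2 : ∀ i j p q, ζ i j p q = - ζ i j q p)
    (i j : Fin m) (p q : Fin n) :
    ∑ w : MinorIdx m n, epw i j p q w • ζ w.1.1.1 w.1.1.2 w.1.2.1 w.1.2.2 = ζ i j p q := by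
  have z : ∀ x : M, x = - x → x = 0 := fun x hx => by
    have : (2 : ℂ) • x = 0 := by
      rw [two_smul]; nth_rewrite 1 [hx]; simp
    exact (smul_eq_zero.1 this).resolve_left two_ne_zero
  have main : ∀ i j p q, i < j → p < q → 
      ∑ w : MinorIdx m n, epw i j p q w • ζ w.1.1.1 w.1.1.2 w.1.2.1 w.1.2.2 = ζ i j p q := by
    intro i j p q hij hpq
    refine (Finset.sum_eq_single (⟨((i, j), (p, q)), hij, hpq⟩ : MinorIdx m n) ?_ ?_).trans ?_
    · rintro ⟨⟨⟨a, b⟩, ⟨c, d⟩⟩, hab, hcd⟩ _ hne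
      simp only at hab hcd
      simp only [epw]
      rw [ep_lt hij hab, ep_lt hpq hcd]
      by_cases e1 : a = i ∧ b = j
      · by_cases e2 : c = p ∧ d = q
        · exfalso; apply hne
          obtain ⟨rfl, rfl⟩ := e1; obtain ⟨rfl, rfl⟩ := e2; rfl
        · simp [e2]
      · simp [e1]
    · exact fun h => absurd (Finset.mem_univ _) h
    · simp [epw, ep_lt, hij, hpq]
  have main2 : ∀ i j p q, i < j → 
      ∑ w : MinorIdx m n, epw i j p q w • ζ w.1.1.1 w.1.1.2 w.1.2.1 w.1.2.2 = ζ i j p q := by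
    intro i j p q hij
    rcases lt_trichotomy p q with h | h | h
    · exact main i j p q hij h
    · subst h
      rw [z _ (h2 i j p p)]
      simp [epw, ep_self]
    · rw [h2, ← main i j q p hij h, ← Finset.sum_neg_distrib]
      refine Finset.sum_congr rfl fun w _ => ?_
      simp only [epw]
      rw [ep_sw1 p q, ← neg_smul]; congr 1; ring
  rcases lt_trichotomy i j with h | h | h
  · exact main2 i j p q h
  · subst h
    rw [z _ (h1 i i p q)]
    simp [epw, ep_self]
  · rw [h1, ← main2 j i p q h, ← Finset.sum_neg_distrib]
    refine Finset.sum_congr rfl fun w _ => ?_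
    simp only [epw]
    rw [ep_sw1 i j, ← neg_smul]; congr 1; ring

abbrev SS (m n : ℕ) := MvPolynomial (Fin m × Fin n) ℂ
abbrev FF (m n : ℕ) := MinorIdx m n → SS m n
abbrev QQ (m n : ℕ) := FF m n ⧸ KosMod m n
abbrev RR (m n : ℕ) := MvPolynomial (Fin m ⊕ Fin n) ℂ

/-- evaluation on the free module -/
noncomputable def evF : FF m n →ₗ[SS m n] SS m n where
  toFun c := ∑ w, c w * minorΔ w
  map_add' a b := by simp [add_mul, Finset.sum_add_distrib]
  map_smul' a b := by simp [Finset.mul_sum, mul_assoc]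

theorem evF_apply (c : FF m n) : evF c = ∑ w, c w * minorΔ w := rfl

theorem kos_mem (c c' : FF m n) : evF c • c' - evF c' • c ∈ KosMod m n := by
  have e : evF c • c' - evF c' • c = ∑ w, ∑ w', (c w * c' w') •
      ((Pi.single w' (minorΔ w) - Pi.single w (minorΔ w') : FF m n)) := by
    ext1 v
    simp only [evF_apply, Pi.sub_apply, Pi.smul_apply, Finset.sum_apply, smul_eq_mul,
      mul_sub, Finset.sum_sub_distrib, Pi.single_apply]
    congr 1
    · rw [Finset.sum_mul]
      refine Finset.sum_congr rfl fun w _ => ?_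
      simp [mul_ite]; ring
    · rw [Finset.sum_mul, Finset.sum_comm]
      refine Finset.sum_congr rfl fun w _ => ?_
      simp [mul_ite]; ring
  rw [e]
  refine Submodule.sum_mem _ fun w _ => Submodule.sum_mem _ fun w' _ => Submodule.smul_mem _ _ ?_
  exact Submodule.subset_span ⟨w', w, rfl⟩

theorem kos_le_ev : KosMod m n ≤ LinearMap.ker (evF (m := m) (n := n)) := by
  refine Submodule.span_le.2 ?_
  rintro k ⟨w, w', rfl⟩
  simp [evF_apply, sub_mul, Pi.single_apply, Finset.sum_sub_distrib]
  ring

noncomputable def eF (i j : Fin m) (p q : Fin n) : FF m n := fun w => C (epw i j p q w)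

theorem evF_e (i j : Fin m) (p q : Fin n) : evF (eF i j p q) =
    X (i, p) * X (j, q) - X (i, q) * X (j, p) := by
  have := ER (fun i j p q => (X (i, p) * X (j, q) - X (i, q) * X (j, p) : SS m n))
    (fun i j p q => by ring) (fun i j p q => by ring) i j p q
  rw [← this, evF_apply]
  refine Finset.sum_congr rfl fun w _ => ?_
  rw [smul_eq_C_mul]; rfl

/-- the concrete data -/
noncomputable def D (m n : ℕ) : Dat (Fin m) (Fin n) (SS m n) (QQ m n) where
  x i p := X (i, p)
  e i j p q := (KosMod m n).mkQ (eF i j p q)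
  ev := (KosMod m n).liftQ evF kos_le_ev
  anti1 i j p q := by
    rw [← map_neg]; congr 1; ext1 w
    simp only [eF, epw, Pi.neg_apply]
    rw [ep_sw1 i j, ← map_neg]; congr 1; ring
  anti2 i j p q := by
    rw [← map_neg]; congr 1; ext1 w
    simp only [eF, epw, Pi.neg_apply]
    rw [ep_sw1 p q, ← map_neg]; congr 1; ring
  ev_e i j p q := by
    simp only [Submodule.mkQ_apply, Submodule.liftQ_apply]
    exact evF_e i j p q
  comm i j p q i' j' p' q' := by
    rw [← evF_e, ← evF_e, ← map_smul, ← map_smul, ← sub_eq_zero, ← map_sub]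
    simp only [Submodule.mkQ_apply]
    rw [Submodule.Quotient.mk_eq_zero]
    exact kos_mem _ _
  kill i j p q h hh := by
    obtain ⟨c, rfl⟩ := (KosMod m n).mkQ_surjective h
    simp only [Submodule.mkQ_apply, Submodule.liftQ_apply] at hh
    rw [← evF_e, ← map_smul]
    simp only [Submodule.mkQ_apply]
    rw [Submodule.Quotient.mk_eq_zero]
    have := kos_mem (eF i j p q) c
    rw [hh, zero_smul, sub_zero] at this
    exact this

/-- Segre substitution -/
noncomputable def sg (m n : ℕ) : SS m n →ₐ[ℂ] RR m n := aeval fun a => X (.inl a.1) * X (.inr a.2)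

noncomputable def PiF (m n : ℕ) : FF m n →ₛₗ[(sg m n : SS m n →+* RR m n)] (MinorIdx m n → RR m n) where
  toFun c w := sg m n (c w)
  map_add' a b := by ext1 w; simp
  map_smul' a b := by ext1 w; simp

theorem sg_minor (w : MinorIdx m n) : sg m n (minorΔ w) = 0 := by
  simp [sg, minorΔ]; ring

theorem PiF_kos : KosMod m n ≤ LinearMap.ker (PiF m n) := by
  refine Submodule.span_le.2 ?_
  rintro k ⟨w, w', rfl⟩
  simp only [SetLike.mem_coe, LinearMap.mem_ker]
  ext1 v
  simp only [PiF, LinearMap.coe_mk, AddHom.coe_mk, Pi.sub_apply, map_sub, Pi.single_apply, Pi.zero_apply]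
  split_ifs <;> simp [sg_minor]

/-- the map `Π` on the quotient -/
noncomputable def PiQ (m n : ℕ) : QQ m n →ₗ[ℂ] (MinorIdx m n → RR m n) where
  toFun := (KosMod m n).liftQ (PiF m n) PiF_kos
  map_add' := map_add _
  map_smul' c z := by
    rw [← algebraMap_smul (SS m n) c z, LinearMap.map_smulₛₗ]
    simp only [RingHom.coe_coe, AlgHom.commutes, RingHom.id_apply]
    exact algebraMap_smul (RR m n) c _

theorem PiQ_mk (c : FF m n) (w : MinorIdx m n) : PiQ m n ((KosMod m n).mkQ c) w = sg m n (c w) := rfl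

theorem PiQ_smul (a : SS m n) (z : QQ m n) (w) : PiQ m n (a • z) w = sg m n a * PiQ m n z w := by
  obtain ⟨c, rfl⟩ := (KosMod m n).mkQ_surjective z
  rw [← map_smul, PiQ_mk, PiQ_mk]; simp

noncomputable abbrev f0 (m n : ℕ) : Fin m ⊕ Fin n ≃ Fin m ⊕ Fin n := Equiv.refl _
noncomputable abbrev f1 (m n : ℕ) : Fin n ⊕ Fin m ≃ Fin m ⊕ Fin n :=
  (Equiv.sumComm (Fin n) (Fin m)).trans (f0 m n)

theorem PiQ_psi {κ : ℕ} (τ) (hτ : τ ∈ TV (f0 m n) κ) (w : MinorIdx m n) :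
    PiQ m n ((D m n).psi (f0 m n) τ) w =
      (24 : ℂ) • Kz.bd Sum.inl (fun i => τ i w.1.1.1 w.1.1.2 w.1.2.1 w.1.2.2) := by
  refine (D m n).Pi_psi (f0 m n) (LinearMap.proj w ∘ₗ PiQ m n) ?_ _ _ _ _ ?_ τ hτ
  · intro i p z
    simp only [LinearMap.comp_apply, LinearMap.proj_apply, PiQ_smul]
    simp [D, sg]
  · intro i j p q
    simp only [LinearMap.comp_apply, LinearMap.proj_apply]
    change PiQ m n ((KosMod m n).mkQ (eF i j p q)) w = _
    rw [PiQ_mk, eF, ← algebraMap_eq, AlgHom.commutes]; rfl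

theorem PiQ_psi' {κ : ℕ} (τ) (hτ : τ ∈ TV (f1 m n) κ) (w : MinorIdx m n) :
    PiQ m n ((D m n).tr.psi (f1 m n) τ) w =
      (24 : ℂ) • Kz.bd Sum.inr (fun i => τ i w.1.2.1 w.1.2.2 w.1.1.1 w.1.1.2) := by
  refine (D m n).tr.Pi_psi (f1 m n) (LinearMap.proj w ∘ₗ PiQ m n) ?_ _ _ _ _ ?_ τ hτ
  · intro i p z
    simp only [LinearMap.comp_apply, LinearMap.proj_apply, PiQ_smul]
    simp [D, sg, tr, mul_comm]
  · intro i j p q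
    simp only [LinearMap.comp_apply, LinearMap.proj_apply]
    change PiQ m n ((KosMod m n).mkQ (eF p q i j)) w = _
    rw [PiQ_mk, eF, ← algebraMap_eq, AlgHom.commutes, mul_comm]; rfl

end Con



open MvPolynomial

namespace Con
open Dat

variable {m n : ℕ}

theorem poly_hom_ext {γ V : Type} [AddCommGroup V] [Module ℂ V] {k : ℕ}
    (F G : MvPolynomial γ ℂ →ₗ[ℂ] V)
    (h : ∀ N : Multiset γ, Multiset.card N = k → F (pm N) = G (pm N))
    (P : MvPolynomial γ ℂ) (hP : P ∈ homogeneousSubmodule γ ℂ k) : F P = G P := by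
  classical
  rw [P.as_sum]
  simp only [map_sum]
  refine Finset.sum_congr rfl fun e he => ?_
  have hd : e.degree = k := by
    have := hP (mem_support_iff.1 he)
    rw [← this, Finsupp.degree_eq_weight_one]; rfl
  have hpm : monomial e (coeff e P) = coeff e P • pm (Finsupp.toMultiset e) := by
    rw [pm_eq]; simp [smul_monomial]
  rw [hpm, map_smul, map_smul, h]
  rw [Finsupp.card_toMultiset, ← hd]; rfl

/-- target submodule -/
noncomputable def UU (m n k : ℕ) : Submodule ℂ (QQ m n) :=
  Submodule.span ℂ {z | ∃ (N : Multiset (Fin m × Fin n)) (i j l : Fin m) (r p q : Fin n),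
    Multiset.card N = k ∧
    z = (D m n).mon N • ((D m n).E i j l r p q - (D m n).tr.E p q r i j l)}

theorem mon_pm (N : Multiset (Fin m × Fin n)) : (D m n).mon N = pm N := rfl

theorem epw_delta (v w : MinorIdx m n) :
    epw w.1.1.1 w.1.1.2 w.1.2.1 w.1.2.2 v = if v = w then 1 else 0 := by
  obtain ⟨⟨⟨a, b⟩, ⟨c, d⟩⟩, hab, hcd⟩ := v
  obtain ⟨⟨⟨i, j⟩, ⟨p, q⟩⟩, hij, hpq⟩ := w
  simp only at hab hcd hij hpq
  simp only [epw]
  rw [ep_lt hij hab, ep_lt hpq hcd]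
  by_cases e1 : a = i ∧ b = j
  · by_cases e2 : c = p ∧ d = q
    · obtain ⟨rfl, rfl⟩ := e1; obtain ⟨rfl, rfl⟩ := e2
      rw [if_pos ⟨rfl, rfl⟩, if_pos ⟨rfl, rfl⟩, mul_one]
      exact (if_pos rfl).symm
    · rw [if_neg e2, mul_zero, if_neg]
      intro h
      have := congrArg Subtype.val h
      simp only [Prod.mk.injEq] at this
      exact e2 this.2
  · rw [if_neg e1, zero_mul, if_neg]
    intro h
    have := congrArg Subtype.val h
    simp only [Prod.mk.injEq] at this
    exact e1 this.1

theorem mk_expand (c : FF m n) : (KosMod m n).mkQ c =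
    ∑ w : MinorIdx m n, c w • (D m n).e w.1.1.1 w.1.1.2 w.1.2.1 w.1.2.2 := by
  have : c = ∑ w : MinorIdx m n, c w • eF w.1.1.1 w.1.1.2 w.1.2.1 w.1.2.2 := by
    ext1 v
    simp only [Finset.sum_apply, Pi.smul_apply, eF, epw_delta]
    simp
  conv_lhs => rw [this]
  rw [map_sum]
  simp only [map_smul]
  rfl

theorem syz_mem_U {d : ℕ} (hd : 3 ≤ d) (c : FF m n) (hc : c ∈ Syz m n d) :
    (KosMod m n).mkQ c ∈ UU m n (d - 3) := by
  classical
  obtain ⟨hc1, hc2⟩ := hc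
  let G := QQ m n ⧸ UU m n (d - 3)
  let μ : QQ m n →ₗ[ℂ] G := (UU m n (d - 3)).mkQ
  let ε : Fin m × Fin n → Fin m × Fin n → Multiset (Fin m × Fin n) → G := fun a b N =>
    if Multiset.card N = d - 2 then μ ((D m n).mon N • (D m n).e a.1 b.1 a.2 b.2) else 0
  obtain ⟨φ, hφ⟩ := newman ε
    (by
      intro a b N
      simp only [ε]
      rw [(D m n).anti1 a.1, (D m n).anti2 b.1, neg_neg])
    (by
      intro a b N
      simp only [ε, sw]
      rw [(D m n).anti2 a.1]
      split_ifs <;> simp)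
    (by
      intro a b c d' N
      simp only [ε, Multiset.card_cons]
      split_ifs
      · rw [← map_sub, ← map_sub]
        congr 1
        simp only [mon_cons, sw]
        have := congrArg (fun z => (D m n).mon N • z) ((D m n).comm a.1 b.1 a.2 b.2 c.1 d'.1 c.2 d'.2)
        linear_combination (norm := module) -this
      · simp)
    (by
      intro a b c N
      simp only [ε, Multiset.card_cons]
      split_ifs with hN
      · rw [← map_add, ← map_add, ← sub_eq_zero, ← map_sub]
        have hm : (D m n).mon N • ((D m n).E a.1 b.1 c.1 c.2 a.2 b.2 -
            (D m n).tr.E a.2 b.2 c.2 a.1 b.1 c.1) ∈ UU m n (d - 3) :=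
          Submodule.subset_span ⟨N, _, _, _, _, _, _, by omega, rfl⟩
        refine (Submodule.Quotient.mk_eq_zero _).2 ?_
        convert hm using 1
        simp only [mon_cons, sw, E, tr]
        module
      · simp)
  let Φ : SS m n →ₗ[ℂ] G := (basisMonomials _ ℂ).constr ℂ (fun e => φ (Finsupp.toMultiset e))
  have hΦ : ∀ N, Φ (pm N) = φ N := by
    intro N
    have e : ∀ e0, Φ (monomial e0 (1 : ℂ)) = φ (Finsupp.toMultiset e0) := by
      intro e0
      have := (basisMonomials (Fin m × Fin n) ℂ).constr_basis ℂ
        (fun e => φ (Finsupp.toMultiset e)) e0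
      rw [← this, coe_basisMonomials]
    rw [pm_eq, e]
    simp
  have key : ∀ w : MinorIdx m n, ∀ P ∈ homogeneousSubmodule (Fin m × Fin n) ℂ (d - 2),
      μ (P • (D m n).e w.1.1.1 w.1.1.2 w.1.2.1 w.1.2.2) = Φ (P * minorΔ w) := by
    intro w
    let F1 : SS m n →ₗ[ℂ] QQ m n := 
      (LinearMap.toSpanSingleton (SS m n) (QQ m n)
        ((D m n).e w.1.1.1 w.1.1.2 w.1.2.1 w.1.2.2)).restrictScalars ℂ
    refine poly_hom_ext (μ ∘ₗ F1) (Φ ∘ₗ LinearMap.mulRight ℂ (minorΔ w)) ?_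
    intro N hN
    simp only [LinearMap.comp_apply, LinearMap.mulRight_apply]
    have e1 : μ (F1 (pm N)) = ε (w.1.1.1, w.1.2.1) (w.1.1.2, w.1.2.2) N := by
      simp only [ε]
      rw [if_pos hN]; rfl
    have e2 : pm N * minorΔ w = pm ((w.1.1.1, w.1.2.1) ::ₘ (w.1.1.2, w.1.2.2) ::ₘ N) -
        pm ((w.1.1.1, w.1.2.2) ::ₘ (w.1.1.2, w.1.2.1) ::ₘ N) := by
      simp only [pm, minorΔ, Multiset.map_cons, Multiset.prod_cons]; ring
    rw [e1, hφ, e2, map_sub, hΦ, hΦ]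
    rfl
  have : μ ((KosMod m n).mkQ c) = 0 := by
    rw [mk_expand, map_sum]
    rw [Finset.sum_congr rfl fun w _ => key w (c w) (hc1 w), ← map_sum, hc2, map_zero]
  exact (Submodule.Quotient.mk_eq_zero _).1 this

theorem half_smul (y : QQ m n) : y = (2 : ℂ)⁻¹ • ((2 : ℤ) • y) := by
  rw [← Int.cast_smul_eq_zsmul ℂ, smul_smul]
  have : ((2 : ℂ)⁻¹ * ((2 : ℤ) : ℂ)) = 1 := by norm_num
  rw [this, one_smul]

theorem third_smul (y : QQ m n) : y = (3 : ℂ)⁻¹ • ((3 : ℤ) • y) := by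
  rw [← Int.cast_smul_eq_zsmul ℂ, smul_smul]
  have : ((3 : ℂ)⁻¹ * ((3 : ℤ) : ℂ)) = 1 := by norm_num
  rw [this, one_smul]

theorem U_le {κ : ℕ} (hκ : 1 ≤ κ) : UU m n (κ + 1) ≤
    (TV (f0 m n) κ).map ((D m n).psi (f0 m n)) ⊔ (TV (f1 m n) κ).map ((D m n).tr.psi (f1 m n)) := by
  set H := (TV (f0 m n) κ).map ((D m n).psi (f0 m n)) ⊔
    (TV (f1 m n) κ).map ((D m n).tr.psi (f1 m n)) with hH
  have hV : ∀ (N : Multiset (Fin m × Fin n)) (u i j k p q r v), Multiset.card N = κ →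
      (D m n).mon N • (D m n).Eh u i j k p q r v ∈ H := by
    intro N u i j k p q r v hN
    have := (D m n).Psi_mem_map (f0 m n) hκ i j k p q (pm (tmon (f0 m n) (N, u, r, v))) (by
      have := Bi_monomial_mem (f0 m n) (u ::ₘ N.map Prod.fst) (r ::ₘ v ::ₘ N.map Prod.snd)
      simp only [Multiset.card_cons, Multiset.card_map, hN] at this
      exact this)
    rw [Psi_mon] at this
    exact Submodule.mem_sup_left this
  have hW : ∀ (N : Multiset (Fin m × Fin n)) (u i j k p q r v), Multiset.card N = κ →
      (D m n).mon N • (D m n).tr.Eh u i j k p q r v ∈ H := by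
    intro N u i j k p q r v hN
    have := (D m n).tr.Psi_mem_map (f1 m n) hκ i j k p q (pm (tmon (f1 m n) (N.map Prod.swap, u, r, v))) (by
      have := Bi_monomial_mem (f1 m n) (u ::ₘ (N.map Prod.swap).map Prod.fst)
        (r ::ₘ v ::ₘ (N.map Prod.swap).map Prod.snd)
      simp only [Multiset.card_cons, Multiset.card_map, hN] at this
      exact this)
    rw [Psi_mon, val] at this
    have hm : (D m n).tr.mon (N.map Prod.swap) = (D m n).mon N := by
      simp [mon, tr]
    simp only [hm] at this
    exact Submodule.mem_sup_right this
  refine Submodule.span_le.2 ?_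
  rintro z ⟨N, i, j, k, r, p, q, hN, rfl⟩
  obtain ⟨⟨u, v⟩, N, rfl⟩ := exists_cons_card N hN
  have hN' : Multiset.card N = κ := by simpa using hN
  have hl : ∀ i j k r p q, (D m n).mon N • (D m n).x u v • (D m n).lam i j k r p q ∈ H := by
    intro i j k r p q
    have := congrArg (fun z => (D m n).mon N • z) ((D m n).two_x_lam u i j k p q r v)
    simp only [smul_add] at this
    have h2 : (D m n).mon N • (D m n).x u v • (D m n).lam i j k r p q = (2 : ℂ)⁻¹ •
        ((D m n).mon N • (D m n).Eh u i j k p q r v + (D m n).mon N • (D m n).Eh u i j k r q p v) := by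
      rw [← this, smul_comm _ (2 : ℤ)]
      exact half_smul _
    rw [h2]
    exact Submodule.smul_mem _ _ (Submodule.add_mem _ (hV _ _ _ _ _ _ _ _ _ hN') (hV _ _ _ _ _ _ _ _ _ hN'))
  have hl' : ∀ i j k r p q, (D m n).mon N • (D m n).x u v • (D m n).tr.lam i j k r p q ∈ H := by
    intro i j k r p q
    have := congrArg (fun z => (D m n).mon N • z) ((D m n).tr.two_x_lam v i j k p q r u)
    simp only [smul_add] at this
    have h2 : (D m n).mon N • (D m n).x u v • (D m n).tr.lam i j k r p q = (2 : ℂ)⁻¹ •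
        ((D m n).mon N • (D m n).tr.Eh v i j k p q r u + (D m n).mon N • (D m n).tr.Eh v i j k r q p u) := by
      rw [← this, smul_comm _ (2 : ℤ)]
      exact half_smul _
    rw [h2]
    exact Submodule.smul_mem _ _ (Submodule.add_mem _ (hW _ _ _ _ _ _ _ _ _ hN') (hW _ _ _ _ _ _ _ _ _ hN'))
  have h3 := congrArg (fun z => (D m n).mon N • (D m n).x u v • z) ((D m n).three_E i j k p q r)
  simp only [smul_sub] at h3
  have h4 : (D m n).mon ((u, v) ::ₘ N) • ((D m n).E i j k r p q - (D m n).tr.E p q r i j k) =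
      (3 : ℂ)⁻¹ • (((D m n).mon N • (D m n).x u v • (D m n).lam i j k r p q -
      (D m n).mon N • (D m n).x u v • (D m n).lam i j k r q p) -
      ((D m n).mon N • (D m n).x u v • (D m n).tr.lam p q r i j k -
      (D m n).mon N • (D m n).x u v • (D m n).tr.lam p q r i k j)) := by
    rw [← h3, mon_cons, mul_comm, mul_smul]
    simp only [smul_comm _ (3 : ℤ), ← smul_sub]
    exact (third_smul _).trans (smul_comm _ _ _)
  rw [SetLike.mem_coe, h4]
  exact Submodule.smul_mem _ _ (Submodule.sub_mem _ (Submodule.sub_mem _ (hl _ _ _ _ _ _) (hl _ _ _ _ _ _))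
    (Submodule.sub_mem _ (hl' _ _ _ _ _ _) (hl' _ _ _ _ _ _)))

end Con



open MvPolynomial

namespace Con
open Dat

variable {m n : ℕ}

/-- contraction in the first and second group of variables -/
noncomputable abbrev bV (y : Fin m → RR m n) : RR m n := Kz.bd Sum.inl y
noncomputable abbrev bW (y : Fin n → RR m n) : RR m n := Kz.bd Sum.inr y

noncomputable def arr (τ : Fin m → Fin m → Fin m → Fin n → Fin n → RR m n)
    (τ' : Fin n → Fin n → Fin n → Fin m → Fin m → RR m n) (j k : Fin m) (p q : Fin n) : RR m n :=
  bV (fun i => τ i j k p q) + bW (fun r => τ' r p q j k)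

theorem arr_alt1 {κ : ℕ} {τ τ'} (hτ : τ ∈ TV (f0 m n) κ) (hτ' : τ' ∈ TV (f1 m n) κ) (j k p q) :
    arr τ τ' j k p q = - arr τ τ' k j p q := by
  obtain ⟨h1, h2, h3, h4⟩ := hτ
  obtain ⟨k1, k2, k3, k4⟩ := hτ'
  simp only [arr, neg_add, bV, bW, ← Kz.bd_neg]
  congr 2
  · ext1 i; exact h2 _ _ _ _ _
  · ext1 i; exact k3 _ _ _ _ _

theorem arr_alt2 {κ : ℕ} {τ τ'} (hτ : τ ∈ TV (f0 m n) κ) (hτ' : τ' ∈ TV (f1 m n) κ) (j k p q) :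
    arr τ τ' j k p q = - arr τ τ' j k q p := by
  obtain ⟨h1, h2, h3, h4⟩ := hτ
  obtain ⟨k1, k2, k3, k4⟩ := hτ'
  simp only [arr, neg_add, bV, bW, ← Kz.bd_neg]
  congr 2
  · ext1 i; exact h3 _ _ _ _ _
  · ext1 i; exact k2 _ _ _ _ _

theorem PiQ_arr {κ : ℕ} {τ τ'} (hτ : τ ∈ TV (f0 m n) κ) (hτ' : τ' ∈ TV (f1 m n) κ) (w : MinorIdx m n) :
    PiQ m n ((D m n).psi (f0 m n) τ + (D m n).tr.psi (f1 m n) τ') w =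
      (24 : ℂ) • arr τ τ' w.1.1.1 w.1.1.2 w.1.2.1 w.1.2.2 := by
  rw [map_add, Pi.add_apply, PiQ_psi τ hτ, PiQ_psi' τ' hτ', ← smul_add]
  rfl

theorem decomp {κ : ℕ} (hκ : 1 ≤ κ) (c : FF m n) (hc : c ∈ Syz m n (κ + 4)) :
    ∃ τ ∈ TV (f0 m n) κ, ∃ τ' ∈ TV (f1 m n) κ,
      (KosMod m n).mkQ c = (D m n).psi (f0 m n) τ + (D m n).tr.psi (f1 m n) τ' := by
  have h1 : (KosMod m n).mkQ c ∈ UU m n (κ + 1) :=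
    syz_mem_U (d := κ + 4) (Nat.le_add_left 3 (κ + 1)) c hc
  have := U_le hκ h1
  obtain ⟨y, ⟨τ, hτ, rfl⟩, z, ⟨τ', hτ', rfl⟩, h⟩ := Submodule.mem_sup.1 this
  exact ⟨τ, hτ, τ', hτ', h.symm⟩

theorem inj_thm {κ : ℕ} (hκ : 1 ≤ κ) (c : FF m n) (hc : c ∈ Syz m n (κ + 4))
    (h : ∀ w, sg m n (c w) = 0) : c ∈ KosMod m n := by
  obtain ⟨τ, hτ, τ', hτ', e⟩ := decomp hκ c hc
  have h0 : ∀ w : MinorIdx m n, arr τ τ' w.1.1.1 w.1.1.2 w.1.2.1 w.1.2.2 = 0 := by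
    intro w
    have := PiQ_arr hτ hτ' w
    rw [← e, PiQ_mk, h] at this
    exact (smul_eq_zero.1 this.symm).resolve_left (by norm_num)
  have h1 : ∀ j k p q, arr τ τ' j k p q = 0 := by
    intro j k p q
    rw [← ER (arr τ τ') (arr_alt1 hτ hτ') (arr_alt2 hτ hτ') j k p q]
    exact Finset.sum_eq_zero fun w _ => by rw [h0, smul_zero]
  have := core_inj (f0 m n) (D m n) hκ τ τ' hτ hτ' h1
  rw [← (Submodule.Quotient.mk_eq_zero (KosMod m n))]
  exact e.trans this

/-- extension to an alternating array -/
noncomputable def ex (g : MinorIdx m n → RR m n) (i j : Fin m) (p q : Fin n) : RR m n :=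
  ∑ w, epw i j p q w • g w

theorem ex_alt1 (g : MinorIdx m n → RR m n) (i j p q) : ex g i j p q = - ex g j i p q := by
  unfold ex
  rw [← Finset.sum_neg_distrib]
  refine Finset.sum_congr rfl fun w _ => ?_
  rw [← neg_smul]; congr 1
  simp only [epw]; rw [ep_sw1 i j]; ring

theorem ex_alt2 (g : MinorIdx m n → RR m n) (i j p q) : ex g i j p q = - ex g i j q p := by
  unfold ex
  rw [← Finset.sum_neg_distrib]
  refine Finset.sum_congr rfl fun w _ => ?_
  rw [← neg_smul]; congr 1
  simp only [epw]; rw [ep_sw1 p q]; ring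

theorem ex_res (g : MinorIdx m n → RR m n) (w : MinorIdx m n) :
    ex g w.1.1.1 w.1.1.2 w.1.2.1 w.1.2.2 = g w := by
  unfold ex
  refine (Finset.sum_eq_single w ?_ ?_).trans ?_
  · intro v _ hv; rw [epw_delta, if_neg hv, zero_smul]
  · exact fun h => absurd (Finset.mem_univ _) h
  · rw [epw_delta, if_pos rfl, one_smul]

theorem ex_mem {V : Submodule ℂ (RR m n)} (g : MinorIdx m n → RR m n) (h : ∀ w, g w ∈ V) (i j p q) :
    ex g i j p q ∈ V :=
  Submodule.sum_mem _ fun w _ => Submodule.smul_mem _ _ (h w)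

theorem ex_add (g g' : MinorIdx m n → RR m n) (i j p q) :
    ex (g + g') i j p q = ex g i j p q + ex g' i j p q := by
  simp [ex, Finset.sum_add_distrib]

theorem ex_smul (c : ℂ) (g : MinorIdx m n → RR m n) (i j p q) :
    ex (c • g) i j p q = c • ex g i j p q := by
  simp only [ex, Finset.smul_sum, Pi.smul_apply]
  exact Finset.sum_congr rfl fun w _ => smul_comm _ _ _

/-- the double contraction -/
noncomputable def TT (m n : ℕ) : (MinorIdx m n → RR m n) →ₗ[ℂ] (Fin m → Fin n → RR m n) where
  toFun g i p := bV fun j => bW fun q => ex g j i q p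
  map_add' g g' := by
    ext1 i; ext1 p
    simp only [ex_add, Pi.add_apply, bV, bW, Kz.bd_add]
  map_smul' c g := by
    ext1 i; ext1 p
    simp only [ex_smul, Pi.smul_apply, bV, bW, Kz.bd_smul, RingHom.id_apply]

theorem TT_apply (g : MinorIdx m n → RR m n) (i p) :
    TT m n g i p = bV fun j => bW fun q => ex g j i q p := rfl

theorem bd_bd_alt {γ ι : Type} [Fintype ι] (s : ι → γ) (y : ι → ι → MvPolynomial γ ℂ)
    (hy : ∀ i j, y i j = - y j i) : Kz.bd s (fun i => Kz.bd s (fun j => y i j)) = 0 := by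
  have h : Kz.bd s (fun i => Kz.bd s (fun j => y i j)) =
      - Kz.bd s (fun i => Kz.bd s (fun j => y i j)) := by
    conv_lhs => rw [Kz.bd_bd s s]
    rw [← Kz.bd_neg]; congr 1; ext1 i
    rw [← Kz.bd_neg]; congr 1; ext1 j
    exact hy _ _
  have h2 := add_eq_zero_iff_eq_neg.2 h
  rw [← two_mul] at h2
  exact (mul_eq_zero.1 h2).resolve_left two_ne_zero

theorem T_arr {κ : ℕ} {τ τ'} (hτ : τ ∈ TV (f0 m n) κ) (hτ' : τ' ∈ TV (f1 m n) κ) (i p) :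
    (bV fun j => bW fun q => arr τ τ' j i q p) = 0 := by
  obtain ⟨h1, h2, h3, h4⟩ := hτ
  obtain ⟨k1, k2, k3, k4⟩ := hτ'
  simp only [arr, bV, bW, Kz.bd_add]
  have e2 : ∀ j, Kz.bd Sum.inr (fun q => Kz.bd Sum.inr (fun r => τ' r q p j i)) = 0 := fun j =>
    bd_bd_alt _ _ fun q r => k1 _ _ _ _ _
  simp only [e2, Kz.bd_zero, add_zero]
  have e3 : ∀ j, Kz.bd Sum.inr (fun q => Kz.bd Sum.inl fun i1 => τ i1 j i q p) =
      Kz.bd Sum.inl (fun i1 => Kz.bd Sum.inr fun q => τ i1 j i q p) := fun j => Kz.bd_bd _ _ _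
  simp only [e3]
  refine bd_bd_alt _ _ fun j k => ?_
  rw [← Kz.bd_neg]; congr 1; ext1 q
  exact h1 _ _ _ _ _

theorem sg_hom {k : ℕ} (P : SS m n) (hP : P ∈ homogeneousSubmodule (Fin m × Fin n) ℂ k) :
    sg m n P ∈ Bi (f0 m n) k k := by
  have := poly_hom_ext ((Bi (f0 m n) k k).mkQ ∘ₗ (sg m n).toLinearMap) 0 (k := k) ?_ P hP
  · exact (Submodule.Quotient.mk_eq_zero _).1 this
  · intro N hN
    refine (Submodule.Quotient.mk_eq_zero _).2 ?_
    have := Bi_monomial_mem (f0 m n) (N.map Prod.fst) (N.map Prod.snd)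
    simp only [Multiset.card_map, hN] at this
    convert this using 1
    simp [pm, sg, map_multiset_prod, Multiset.prod_map_mul]

/-- images of homogeneous families -/
noncomputable def HQ (m n k : ℕ) : Submodule ℂ (QQ m n) :=
  (Submodule.pi Set.univ (fun _ : MinorIdx m n => homogeneousSubmodule (Fin m × Fin n) ℂ k)).map
    ((KosMod m n).mkQ.restrictScalars ℂ)

theorem HQ_e (i j p q) : (D m n).e i j p q ∈ HQ m n 0 := by
  refine ⟨eF i j p q, ?_, rfl⟩
  intro w _
  exact isHomogeneous_C _ _

theorem HQ_x (i p) {k : ℕ} {z : QQ m n} (hz : z ∈ HQ m n k) : (D m n).x i p • z ∈ HQ m n (k + 1) := by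
  obtain ⟨c, hc, rfl⟩ := hz
  refine ⟨(X (i, p) : SS m n) • c, ?_, map_smul (KosMod m n).mkQ _ _⟩
  intro w _
  rw [add_comm]
  exact (isHomogeneous_X ℂ (i, p)).mul (hc w trivial)

end Con

namespace Dat
variable {α β S Q : Type} [CommRing S] [AddCommGroup Q] [Module S Q] (D : Dat α β S Q) [Module ℂ Q]

theorem mon_Eh_mem (H : ℕ → Submodule ℂ Q) (he : ∀ i j p q, D.e i j p q ∈ H 0)
    (hx : ∀ i p k z, z ∈ H k → D.x i p • z ∈ H (k + 1)) (N : Multiset (α × β)) (u i j k p q r v) :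
    D.mon N • D.Eh u i j k p q r v ∈ H (Multiset.card N + 2) := by
  induction N using Multiset.induction_on with
  | empty =>
    rw [mon_zero, one_smul]
    have hE : ∀ i j k r p q, D.E i j k r p q ∈ H 1 := fun i j k r p q =>
      Submodule.add_mem _ (Submodule.sub_mem _ (hx _ _ _ _ (he _ _ _ _)) (hx _ _ _ _ (he _ _ _ _)))
        (hx _ _ _ _ (he _ _ _ _))
    have hl : ∀ i j k r p q, D.lam i j k r p q ∈ H 1 := fun i j k r p q =>
      Submodule.add_mem _ (hE _ _ _ _ _ _) (hE _ _ _ _ _ _)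
    exact Submodule.sub_mem _ (Submodule.add_mem _ (hx _ _ _ _ (hl _ _ _ _ _ _))
      (hx _ _ _ _ (hl _ _ _ _ _ _))) (hx _ _ _ _ (hl _ _ _ _ _ _))
  | cons a N ih =>
    rw [mon_cons, mul_smul, Multiset.card_cons]
    have := hx a.1 a.2 _ _ ih
    rwa [add_right_comm] at this

end Dat

namespace Con
open Dat
variable {m n : ℕ}

/-- syzygies in the quotient -/
noncomputable def SQ (m n κ : ℕ) : Submodule ℂ (QQ m n) :=
  HQ m n (κ + 2) ⊓ LinearMap.ker ((D m n).ev.restrictScalars ℂ)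

theorem SQ_lift {κ : ℕ} {z : QQ m n} (hz : z ∈ SQ m n κ) :
    ∃ c ∈ Syz m n (κ + 4), (KosMod m n).mkQ c = z := by
  obtain ⟨⟨c, hc, rfl⟩, h2⟩ := hz
  refine ⟨c, ⟨fun w => hc w trivial, ?_⟩, rfl⟩
  exact h2

end Con

namespace Dat
variable {α β γ : Type} [Fintype α] [Fintype β] (f : α ⊕ β ≃ γ)
variable {S Q : Type} [CommRing S] [AddCommGroup Q] [Module S Q] (D : Dat α β S Q) [Module ℂ Q]

theorem psi_mem_sub {κ : ℕ} (W : Submodule ℂ Q)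
    (hW : ∀ (N : Multiset (α × β)) (u i j k p q r v), Multiset.card N = κ →
      D.mon N • D.Eh u i j k p q r v ∈ W) (τ) (hτ : τ ∈ TV f κ) : D.psi f τ ∈ W := by
  rw [psi_apply]
  refine Submodule.sum_mem _ fun i _ => Submodule.sum_mem _ fun j _ => Submodule.sum_mem _ fun k _ =>
    Submodule.sum_mem _ fun p _ => Submodule.sum_mem _ fun q _ => ?_
  have := Bi_ext f (a := κ + 1) (b := κ + 2) (W.mkQ ∘ₗ D.Psi f i j k p q) 0 ?_ _ (hτ.2.2.2 i j k p q)
  · exact (Submodule.Quotient.mk_eq_zero _).1 this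
  · intro A B hA hB
    refine (Submodule.Quotient.mk_eq_zero _).2 ?_
    obtain ⟨u, A, rfl⟩ := exists_cons_card A hA
    obtain ⟨r, B, rfl⟩ := exists_cons_card B hB
    simp only [Multiset.card_cons, add_left_inj] at hA hB
    obtain ⟨v, B, rfl⟩ := exists_cons_card B hB
    simp only [Multiset.card_cons, add_left_inj] at hB
    obtain ⟨N, rfl, rfl, hN⟩ := exists_zip A B hA hB
    have := D.Psi_mon f i j k p q (N, u, r, v)
    rw [tmon] at this
    rw [this]
    exact hW _ _ _ _ _ _ _ _ _ (by simpa using hA)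

end Dat

namespace Con
open Dat
variable {m n : ℕ}

theorem psi_SQ {κ : ℕ} {τ τ'} (hτ : τ ∈ TV (f0 m n) κ) (hτ' : τ' ∈ TV (f1 m n) κ) :
    (D m n).psi (f0 m n) τ + (D m n).tr.psi (f1 m n) τ' ∈ SQ m n κ := by
  refine Submodule.add_mem _ (psi_mem_sub _ _ _ ?_ _ hτ) (psi_mem_sub _ _ _ ?_ _ hτ')
  · rintro N u i j k p q r v rfl
    refine ⟨mon_Eh_mem _ (HQ m n) HQ_e (fun i p k z hz => HQ_x i p hz) _ _ _ _ _ _ _ _ _, ?_⟩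
    change (D m n).ev _ = 0
    rw [map_smul, ev_Eh, smul_zero]
  · rintro N u i j k p q r v rfl
    refine ⟨mon_Eh_mem _ (HQ m n) (fun p q i j => HQ_e i j p q) (fun i p k z hz => HQ_x p i hz) _ _ _ _ _ _ _ _ _, ?_⟩
    change (D m n).tr.ev _ = 0
    rw [map_smul, ev_Eh, smul_zero]

end Con



open MvPolynomial

namespace Kz
variable {γ ι : Type} (s : ι → γ)
theorem D2_alt12 (y : ι → ι → MvPolynomial γ ℂ) (hy : ∀ q r, y q r = - y r q) (p q r : ι) :
    D2 s y p q r = - D2 s y q p r := by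
  unfold D2
  rw [hy q r, hy r p, hy p q]
  simp only [map_neg]; ring
theorem D2_alt23 (y : ι → ι → MvPolynomial γ ℂ) (hy : ∀ q r, y q r = - y r q) (p q r : ι) :
    D2 s y p q r = - D2 s y p r q := by
  unfold D2
  rw [hy q r, hy r p, hy p q]
  simp only [map_neg]; ring
end Kz

namespace Con
open Dat

variable {m n : ℕ}

theorem exact_thm {κ : ℕ} (g : MinorIdx m n → RR m n) (hg : ∀ w, g w ∈ Bi (f0 m n) (κ + 2) (κ + 2))
    (h0 : ∀ i p, TT m n g i p = 0) :
    ∃ τ ∈ TV (f0 m n) κ, ∃ τ' ∈ TV (f1 m n) κ, ∀ j k p q, ex g j k p q = arr τ τ' j k p q := by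
  have hζ := ex_mem g hg
  have a1 := ex_alt1 g
  have a2 := ex_alt2 g
  simp only [TT_apply] at h0
  revert hζ a1 a2 h0
  generalize ex g = ζ
  intro h0 hζ a1 a2
  let c : ℂ := ((κ + 2 + 2 : ℕ) : ℂ)⁻¹
  let η : Fin m → Fin m → Fin n → Fin n → RR m n := fun j k p q =>
    c • (pderiv (Sum.inl j) (bV fun i => ζ i k p q) - pderiv (Sum.inl k) (bV fun i => ζ i j p q))
  have hηBi : ∀ j k p q, η j k p q ∈ Bi (f0 m n) (κ + 2) (κ + 2) := fun j k p q =>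
    Submodule.smul_mem _ _ (Submodule.sub_mem _
      (Bi_pd_inl (f0 m n) j (Bi_bd_inl (f0 m n) fun i => hζ i k p q))
      (Bi_pd_inl (f0 m n) k (Bi_bd_inl (f0 m n) fun i => hζ i j p q)))
  have η1 : ∀ j k p q, η j k p q = - η k j p q := by
    intro j k p q
    simp only [η, ← smul_neg, neg_sub]
  have hb : ∀ k p q, (bV fun i => ζ i k p q) = - (bV fun i => ζ i k q p) := by
    intro k p q
    simp only [bV]
    rw [← Kz.bd_neg]; congr 1; ext1 i; exact a2 _ _ _ _
  have η2 : ∀ j k p q, η j k p q = - η j k q p := by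
    intro j k p q
    simp only [η, ← smul_neg]
    rw [hb k p q, hb j p q]
    simp only [map_neg]; congr 1; ring
  have hb0 : ∀ k q, Kz.bd Sum.inr (fun p => Kz.bd Sum.inl fun i => ζ i k p q) = 0 := by
    intro k q
    rw [← h0 k q]
    exact Kz.bd_bd _ _ _
  have η0 : ∀ j k q, Kz.bd Sum.inr (fun p => η j k p q) = 0 := by
    intro j k q
    simp only [η]
    rw [Kz.bd_smul, Kz.bd_sub, ← Kz.pd_bd' Sum.inr (Sum.inl j) (by simp),
      ← Kz.pd_bd' Sum.inr (Sum.inl k) (by simp), hb0, hb0]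
    simp
  refine ⟨fun i j k p q => c • Kz.D2 Sum.inl (fun j k => ζ j k p q) i j k, ⟨?_, ?_, ?_, ?_⟩,
    fun r p q j k => c • Kz.D2 Sum.inr (η j k) r p q, ⟨?_, ?_, ?_, ?_⟩, ?_⟩
  · intro i j k p q
    simp only
    rw [Kz.D2_alt12 _ _ (fun _ _ => a1 _ _ _ _), smul_neg]
  · intro i j k p q
    simp only
    rw [Kz.D2_alt23 _ _ (fun _ _ => a1 _ _ _ _), smul_neg]
  · intro i j k p q
    simp only [Kz.D2]
    rw [a2 j k, a2 k i, a2 i j, ← smul_neg]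
    simp only [map_neg]; congr 1; ring
  · intro i j k p q
    exact Submodule.smul_mem _ _ (Submodule.add_mem _ (Submodule.add_mem _
      (Bi_pd_inl (f0 m n) _ (hζ _ _ _ _)) (Bi_pd_inl (f0 m n) _ (hζ _ _ _ _)))
      (Bi_pd_inl (f0 m n) _ (hζ _ _ _ _)))
  · intro i j k p q
    simp only
    rw [Kz.D2_alt12 _ _ (fun _ _ => η2 _ _ _ _), smul_neg]
  · intro i j k p q
    simp only
    rw [Kz.D2_alt23 _ _ (fun _ _ => η2 _ _ _ _), smul_neg]
  · intro i j k p q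
    simp only [Kz.D2]
    rw [η1 p q j k, η1 p q k i, η1 p q i j, map_neg, map_neg, map_neg]
    module
  · intro i j k p q
    rw [Bi_swap]
    exact Submodule.smul_mem _ _ (Submodule.add_mem _ (Submodule.add_mem _
      (Bi_pd_inr (f0 m n) _ (hηBi _ _ _ _)) (Bi_pd_inr (f0 m n) _ (hηBi _ _ _ _)))
      (Bi_pd_inr (f0 m n) _ (hηBi _ _ _ _)))
  · intro j k p q
    have e1 := Kz.kform (Sum.inl : Fin m → Fin m ⊕ Fin n) Sum.inl_injective (fun j k => ζ j k p q) (κ + 2)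
      (fun j k => Eu_inl (f0 m n) (hζ j k p q)) (fun j k => a1 _ _ _ _) j k
    have e2 := Kz.kform (Sum.inr : Fin n → Fin m ⊕ Fin n) Sum.inr_injective (η j k) (κ + 2)
      (fun p q => Eu_inr (f0 m n) (hηBi j k p q)) (fun p q => η2 _ _ _ _) p q
    rw [η0, η0, map_zero, map_zero, sub_zero, smul_zero, sub_eq_zero] at e2
    simp only [arr]
    rw [sub_eq_iff_eq_add'] at e1
    refine e1.trans ?_
    congr 1

/-- the range -/
noncomputable def GG (m n a : ℕ) : Submodule ℂ (MinorIdx m n → RR m n) :=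
  Submodule.pi Set.univ fun _ => Bi (f0 m n) a a

/-- the composite map -/
noncomputable def PP (m n : ℕ) : FF m n →ₗ[ℂ] (MinorIdx m n → RR m n) :=
  PiQ m n ∘ₗ ((KosMod m n).mkQ.restrictScalars ℂ)

theorem PP_apply (c : FF m n) (w) : PP m n c w = sg m n (c w) := rfl

theorem range_char {κ : ℕ} (hκ : 1 ≤ κ) : (Syz m n (κ + 4)).map (PP m n) =
    GG m n (κ + 2) ⊓ LinearMap.ker (TT m n) := by
  apply le_antisymm
  · rintro _ ⟨c, hc, rfl⟩
    refine ⟨fun w _ => ?_, ?_⟩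
    · exact sg_hom _ (hc.1 w)
    · obtain ⟨τ, hτ, τ', hτ', e⟩ := decomp hκ c hc
      have h : PP m n c = (24 : ℂ) • fun w : MinorIdx m n => arr τ τ' w.1.1.1 w.1.1.2 w.1.2.1 w.1.2.2 := by
        ext1 w
        refine Eq.trans ?_ (PiQ_arr hτ hτ' w)
        rw [← e]; rfl
      rw [SetLike.mem_coe, LinearMap.mem_ker, h, map_smul]
      refine smul_eq_zero_of_right _ ?_
      ext1 i; ext1 p
      rw [TT_apply]
      have h3 : ∀ j q, ex (fun w : MinorIdx m n => arr τ τ' w.1.1.1 w.1.1.2 w.1.2.1 w.1.2.2) j i q p =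
          arr τ τ' j i q p := fun j q =>
        ER (arr τ τ') (arr_alt1 hτ hτ') (arr_alt2 hτ hτ') j i q p
      simp only [h3]
      exact T_arr hτ hτ' i p
  · rintro g ⟨h1, h2⟩
    obtain ⟨τ, hτ, τ', hτ', e⟩ := exact_thm g (fun w => h1 w trivial)
      (fun i p => by rw [LinearMap.mem_ker.1 h2]; rfl)
    obtain ⟨c, hc, hc2⟩ := SQ_lift (psi_SQ hτ hτ')
    refine ⟨(24 : ℂ)⁻¹ • c, Submodule.smul_mem _ _ hc, ?_⟩
    rw [map_smul]
    ext1 w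
    have e3 : PP m n c w = (24 : ℂ) • arr τ τ' w.1.1.1 w.1.1.2 w.1.2.1 w.1.2.2 := by
      rw [← PiQ_arr hτ hτ' w, ← hc2]; rfl
    rw [Pi.smul_apply, e3, ← e, ex_res, smul_smul]
    norm_num

theorem finrank_eq {κ : ℕ} (hκ : 1 ≤ κ) :
    Module.finrank ℂ (↥(Syz m n (κ + 4)) ⧸ Submodule.comap (Syz m n (κ + 4)).subtype (Kos m n (κ + 4))) =
    Module.finrank ℂ ↥(GG m n (κ + 2) ⊓ LinearMap.ker (TT m n)) := by
  rw [← range_char hκ]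
  let L : ↥(Syz m n (κ + 4)) →ₗ[ℂ] (MinorIdx m n → RR m n) := PP m n ∘ₗ (Syz m n (κ + 4)).subtype
  have hk : Submodule.comap (Syz m n (κ + 4)).subtype (Kos m n (κ + 4)) = LinearMap.ker L := by
    ext ⟨c, hc⟩
    simp only [Submodule.mem_comap, Submodule.subtype_apply, LinearMap.mem_ker, Kos, Submodule.mem_inf]
    constructor
    · rintro ⟨-, h⟩
      change PiQ m n ((KosMod m n).mkQ c) = 0
      have : (KosMod m n).mkQ c = 0 := (Submodule.Quotient.mk_eq_zero _).2 h
      rw [this, map_zero]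
    · intro h
      refine ⟨hc, inj_thm hκ c hc fun w => ?_⟩
      exact congrFun h w
  have hr : (Syz m n (κ + 4)).map (PP m n) = LinearMap.range L := by
    rw [LinearMap.range_comp, Submodule.range_subtype]
  rw [hk, hr]
  exact (LinearMap.quotKerEquivRange L).finrank_eq

end Con



open MvPolynomial

namespace Lin

theorem rn {V W : Type} [AddCommGroup V] [Module ℂ V] [AddCommGroup W] [Module ℂ W]
    (A : Submodule ℂ V) [FiniteDimensional ℂ A] (f : V →ₗ[ℂ] W) :
    Module.finrank ℂ (A.map f) + Module.finrank ℂ ↥(A ⊓ LinearMap.ker f) = Module.finrank ℂ A := by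
  rw [← LinearMap.finrank_range_add_finrank_ker (f ∘ₗ A.subtype)]
  congr 1
  · rw [LinearMap.range_comp, Submodule.range_subtype]
  · have : LinearMap.ker (f ∘ₗ A.subtype) = (A ⊓ LinearMap.ker f).comap A.subtype := by
      ext x; simp
    rw [this]
    exact (Submodule.comapSubtypeEquivOfLe inf_le_left).finrank_eq.symm

/-- families in a subspace -/
noncomputable def pw (ι : Type) {M : Type} [AddCommGroup M] [Module ℂ M] (V : Submodule ℂ M) :
    Submodule ℂ (ι → M) := Submodule.pi Set.univ fun _ => V

theorem mem_pw {ι M : Type} [AddCommGroup M] [Module ℂ M] {V : Submodule ℂ M} {y : ι → M} :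
    y ∈ pw ι V ↔ ∀ i, y i ∈ V := by
  simp [pw, Submodule.mem_pi]

/-- equivalence with functions -/
noncomputable def pwEquiv (ι : Type) {M : Type} [AddCommGroup M] [Module ℂ M] (V : Submodule ℂ M) :
    (ι → V) ≃ₗ[ℂ] pw ι V where
  toFun y := ⟨fun i => y i, mem_pw.2 fun i => (y i).2⟩
  map_add' a b := rfl
  map_smul' a b := rfl
  invFun y i := ⟨y.1 i, mem_pw.1 y.2 i⟩
  left_inv y := rfl
  right_inv y := rfl

instance pw_fin (ι : Type) [Finite ι] {M : Type} [AddCommGroup M] [Module ℂ M] (V : Submodule ℂ M)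
    [FiniteDimensional ℂ V] : FiniteDimensional ℂ (pw ι V) :=
  Module.Finite.equiv (pwEquiv ι V)

theorem finrank_pw (ι : Type) [Fintype ι] {M : Type} [AddCommGroup M] [Module ℂ M] (V : Submodule ℂ M)
    [FiniteDimensional ℂ V] :
    Module.finrank ℂ (pw ι V) = Fintype.card ι * Module.finrank ℂ V := by
  rw [← (pwEquiv ι V).finrank_eq, Module.finrank_pi_fintype]
  simp

end Lin

namespace Dat
variable {m n : ℕ} {γ : Type} (f : Fin m ⊕ Fin n ≃ γ)

noncomputable def bfam (a b : ℕ) (x : Sym (Fin m) a × Sym (Fin n) b) : MvPolynomial γ ℂ :=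
  pm ((x.1 : Multiset (Fin m)).map (fun i => f (.inl i)) + (x.2 : Multiset (Fin n)).map (fun j => f (.inr j)))

theorem bfam_li (a b : ℕ) : LinearIndependent ℂ (bfam f a b) := by
  classical
  have h := (basisMonomials γ ℂ).linearIndependent
  have h2 := h.comp (fun x : Sym (Fin m) a × Sym (Fin n) b => Multiset.toFinsupp
    ((x.1 : Multiset (Fin m)).map (fun i => f (.inl i)) + (x.2 : Multiset (Fin n)).map (fun j => f (.inr j)))) (by
      rintro ⟨A, B⟩ ⟨A', B'⟩ e
      have := add_inj_sum f _ _ _ _ (Multiset.toFinsupp.injective e)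
      exact Prod.ext (Subtype.ext this.1) (Subtype.ext this.2))
  have e : bfam f a b = (⇑(basisMonomials γ ℂ)) ∘ (fun x : Sym (Fin m) a × Sym (Fin n) b =>
      Multiset.toFinsupp ((x.1 : Multiset (Fin m)).map (fun i => f (.inl i)) +
        (x.2 : Multiset (Fin n)).map (fun j => f (.inr j)))) := by
    funext x
    simp only [bfam, Function.comp, coe_basisMonomials]
    rw [pm_eq]
  rw [e]
  exact h2

theorem Bi_range (a b : ℕ) : Bi f a b = Submodule.span ℂ (Set.range (bfam f a b)) := by
  rw [Bi_span]
  congr 1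
  ext P
  constructor
  · rintro ⟨A, B, h1, h2, rfl⟩
    exact ⟨(⟨A, h1⟩, ⟨B, h2⟩), rfl⟩
  · rintro ⟨⟨⟨A, h1⟩, ⟨B, h2⟩⟩, rfl⟩
    exact ⟨A, B, h1, h2, rfl⟩

instance Bi_fin (a b : ℕ) : FiniteDimensional ℂ (Bi f a b) := by
  rw [Bi_range]
  exact FiniteDimensional.span_of_finite ℂ (Set.finite_range _)

theorem finrank_Bi (a b : ℕ) : Module.finrank ℂ (Bi f a b) = Nat.multichoose m a * Nat.multichoose n b := by
  rw [Bi_range, finrank_span_eq_card (bfam_li f a b), Fintype.card_prod,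
    Sym.card_sym_eq_multichoose, Sym.card_sym_eq_multichoose]
  simp

end Dat

namespace Con
open Dat Lin

variable {m n : ℕ}

theorem card_lt (k : ℕ) : Fintype.card {x : Fin k × Fin k // x.1 < x.2} = k.choose 2 := by
  rw [Fintype.card_subtype, Finset.card_filter, Fintype.sum_prod_type_right]
  have : ∀ j : Fin k, (∑ i : Fin k, if i < j then 1 else 0) = (j : ℕ) := by
    intro j
    have h : Finset.univ.filter (fun i : Fin k => i < j) = Finset.Iio j := by ext; simp
    rw [← Finset.card_filter, h, Fin.card_Iio]
  simp only [this]
  rw [Fin.sum_univ_eq_sum_range (fun i => i), Finset.sum_range_id, Nat.choose_two_right]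

theorem card_minor (m n : ℕ) : Fintype.card (MinorIdx m n) = m.choose 2 * n.choose 2 := by
  rw [← card_lt, ← card_lt, ← Fintype.card_prod]
  exact Fintype.card_congr
    { toFun := fun w => (⟨w.1.1, w.2.1⟩, ⟨w.1.2, w.2.2⟩)
      invFun := fun x => ⟨(x.1.1, x.2.1), x.1.2, x.2.2⟩
      left_inv := fun w => rfl
      right_inv := fun w => rfl }

theorem finrank_GG (a : ℕ) : Module.finrank ℂ (GG m n a) =
    m.choose 2 * n.choose 2 * (Nat.multichoose m a * Nat.multichoose n a) := by
  rw [← card_minor, ← finrank_Bi (f0 m n)]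
  exact finrank_pw _ _

/-- linear version of the contractions -/
noncomputable def LV (m n : ℕ) : (Fin m → RR m n) →ₗ[ℂ] RR m n where
  toFun y := bV y
  map_add' y z := Kz.bd_add _ _ _
  map_smul' c y := Kz.bd_smul _ _ _

noncomputable def dV (m n : ℕ) : (Fin m → Fin n → RR m n) →ₗ[ℂ] (Fin n → RR m n) where
  toFun y p := bV fun i => y i p
  map_add' y z := by ext1 p; exact Kz.bd_add _ _ _
  map_smul' c y := by ext1 p; exact Kz.bd_smul _ _ _

noncomputable def dW (m n : ℕ) : (Fin m → Fin n → RR m n) →ₗ[ℂ] (Fin m → RR m n) where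
  toFun y i := bW (y i)
  map_add' y z := by ext1 p; exact Kz.bd_add _ _ _
  map_smul' c y := by ext1 p; exact Kz.bd_smul _ _ _

/-- all arrays -/
noncomputable def AA (m n e : ℕ) : Submodule ℂ (Fin m → Fin n → RR m n) :=
  pw (Fin m) (pw (Fin n) (Bi (f0 m n) e e))

instance (e : ℕ) : FiniteDimensional ℂ (AA m n e) := by unfold AA; infer_instance

theorem mem_AA {e : ℕ} {y : Fin m → Fin n → RR m n} :
    y ∈ AA m n e ↔ ∀ i p, y i p ∈ Bi (f0 m n) e e := by
  simp [AA, mem_pw]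

noncomputable def YY (m n e : ℕ) : Submodule ℂ (Fin m → Fin n → RR m n) :=
  (AA m n e ⊓ LinearMap.ker (dV m n)) ⊓ LinearMap.ker (dW m n)

theorem nat_mul_eq (c : ℕ) (P : RR m n) : (c : RR m n) * P = (c : ℂ) • P := by
  rw [smul_eq_C_mul]; simp

theorem eul_V {a b : ℕ} {P : RR m n} (hP : P ∈ Bi (f0 m n) (a + 1) b) :
    (bV fun i => ((a + 1 : ℕ) : ℂ)⁻¹ • pderiv (Sum.inl i) P) = P := by
  rw [bV, Kz.bd_smul]
  have := Kz.bd_pd _ (Eu_inl (f0 m n) hP)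
  rw [nat_mul_eq] at this
  have hc : ((a + 1 : ℕ) : ℂ) ≠ 0 := Nat.cast_ne_zero.2 (by omega)
  rw [inv_smul_eq_iff₀ hc]
  exact this

theorem eul_W {a b : ℕ} {P : RR m n} (hP : P ∈ Bi (f0 m n) a (b + 1)) :
    (bW fun i => ((b + 1 : ℕ) : ℂ)⁻¹ • pderiv (Sum.inr i) P) = P := by
  rw [bW, Kz.bd_smul]
  have := Kz.bd_pd _ (Eu_inr (f0 m n) hP)
  rw [nat_mul_eq] at this
  have hc : ((b + 1 : ℕ) : ℂ) ≠ 0 := Nat.cast_ne_zero.2 (by omega)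
  rw [inv_smul_eq_iff₀ hc]
  exact this

/-- intermediate kernel -/
noncomputable def UV (m n e : ℕ) : Submodule ℂ (Fin m → RR m n) :=
  pw (Fin m) (Bi (f0 m n) e (e + 1)) ⊓ LinearMap.ker (LV m n)

theorem finrank_UV (e : ℕ) : Nat.multichoose m (e + 1) * Nat.multichoose n (e + 1) +
    Module.finrank ℂ (UV m n e) = m * (Nat.multichoose m e * Nat.multichoose n (e + 1)) := by
  have h := rn (pw (Fin m) (Bi (f0 m n) e (e + 1))) (LV m n)
  rw [finrank_pw, finrank_Bi, Fintype.card_fin] at h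
  have hE : (pw (Fin m) (Bi (f0 m n) e (e + 1))).map (LV m n) = Bi (f0 m n) (e + 1) (e + 1) := by
    apply le_antisymm
    · rintro _ ⟨y, hy, rfl⟩
      exact Bi_bd_inl (f0 m n) (mem_pw.1 hy)
    · intro P hP
      exact ⟨_, mem_pw.2 fun i => Submodule.smul_mem _ _ (Bi_pd_inl (f0 m n) i hP), eul_V hP⟩
  rw [hE, finrank_Bi] at h
  exact h

theorem finrank_K (e : ℕ) : n * (Nat.multichoose m (e + 1) * Nat.multichoose n e) +
    Module.finrank ℂ ↥(AA m n e ⊓ LinearMap.ker (dV m n)) =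
    m * (n * (Nat.multichoose m e * Nat.multichoose n e)) := by
  have h := rn (AA m n e) (dV m n)
  have h2 : Module.finrank ℂ (AA m n e) = m * (n * (Nat.multichoose m e * Nat.multichoose n e)) := by
    unfold AA
    rw [finrank_pw, finrank_pw, finrank_Bi, Fintype.card_fin, Fintype.card_fin]
  have h3 : n * (Nat.multichoose m (e + 1) * Nat.multichoose n e) =
      Module.finrank ℂ (pw (Fin n) (Bi (f0 m n) (e + 1) e)) := by
    rw [finrank_pw, finrank_Bi, Fintype.card_fin]
  have hE : (AA m n e).map (dV m n) = pw (Fin n) (Bi (f0 m n) (e + 1) e) := by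
    apply le_antisymm
    · rintro _ ⟨y, hy, rfl⟩
      exact mem_pw.2 fun p => Bi_bd_inl (f0 m n) fun i => mem_AA.1 hy i p
    · intro P hP
      refine ⟨fun i p => ((e + 1 : ℕ) : ℂ)⁻¹ • pderiv (Sum.inl i) (P p), mem_AA.2 fun i p =>
        Submodule.smul_mem _ _ (Bi_pd_inl (f0 m n) i (mem_pw.1 hP p)), ?_⟩
      ext1 p
      exact eul_V (mem_pw.1 hP p)
  rw [hE, ← h3, h2] at h
  exact h

instance (e : ℕ) : FiniteDimensional ℂ ↥(AA m n e ⊓ LinearMap.ker (dV m n)) :=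
  Submodule.finiteDimensional_of_le inf_le_left

theorem finrank_YY (e : ℕ) : Module.finrank ℂ (UV m n e) + Module.finrank ℂ (YY m n e) =
    Module.finrank ℂ ↥(AA m n e ⊓ LinearMap.ker (dV m n)) := by
  have h := rn (AA m n e ⊓ LinearMap.ker (dV m n)) (dW m n)
  suffices hE : (AA m n e ⊓ LinearMap.ker (dV m n)).map (dW m n) = UV m n e by
    rw [hE] at h
    exact h
  symm
  apply le_antisymm
  · intro u hu
    obtain ⟨h1, h2⟩ := hu
    replace h1 := mem_pw.1 h1
    refine ⟨fun i p => ((e + 1 : ℕ) : ℂ)⁻¹ • pderiv (Sum.inr p) (u i), ⟨mem_AA.2 fun i p =>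
      Submodule.smul_mem _ _ (Bi_pd_inr (f0 m n) p (h1 i)), ?_⟩, ?_⟩
    · ext1 p
      change (bV fun i => ((e + 1 : ℕ) : ℂ)⁻¹ • pderiv (Sum.inr p) (u i)) = 0
      rw [bV, Kz.bd_smul, ← Kz.pd_bd' Sum.inl (Sum.inr p) (by simp)]
      have : Kz.bd Sum.inl u = 0 := h2
      rw [this, map_zero, smul_zero]
    · ext1 i
      exact eul_W (h1 i)
  · rintro _ ⟨y, ⟨hy, hy2⟩, rfl⟩
    refine ⟨mem_pw.2 fun i => Bi_bd_inr (f0 m n) (mem_AA.1 hy i), ?_⟩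
    change Kz.bd Sum.inl (fun i => Kz.bd Sum.inr (y i)) = 0
    rw [Kz.bd_bd]
    have : ∀ p, Kz.bd Sum.inl (fun i => y i p) = 0 := fun p => congrFun hy2 p
    simp only [this, Kz.bd_zero]

theorem map_TT (a : ℕ) : (GG m n a).map (TT m n) = YY m n (a + 1) := by
  apply le_antisymm
  · rintro _ ⟨g, hg, rfl⟩
    have hg' : ∀ w, g w ∈ Bi (f0 m n) a a := fun w => hg w trivial
    refine ⟨⟨mem_AA.2 fun i p => ?_, ?_⟩, ?_⟩
    · exact Bi_bd_inl (f0 m n) fun j => Bi_bd_inr (f0 m n) fun q => ex_mem g hg' _ _ _ _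
    · ext1 p
      change Kz.bd Sum.inl (fun i => Kz.bd Sum.inl fun j => Kz.bd Sum.inr fun q => ex g j i q p) = 0
      refine bd_bd_alt _ _ fun i j => ?_
      rw [← Kz.bd_neg]; congr 1; ext1 q; exact ex_alt1 _ _ _ _ _
    · ext1 i
      change Kz.bd Sum.inr (fun p => Kz.bd Sum.inl fun j => Kz.bd Sum.inr fun q => ex g j i q p) = 0
      rw [Kz.bd_bd]
      have : ∀ j, Kz.bd Sum.inr (fun p => Kz.bd Sum.inr fun q => ex g j i q p) = 0 := fun j =>
        bd_bd_alt _ _ fun p q => ex_alt2 _ _ _ _ _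
      simp only [this, Kz.bd_zero]
  · rintro y ⟨⟨hA, hV⟩, hW⟩
    replace hA := mem_AA.1 hA
    have hV' : ∀ p, Kz.bd Sum.inl (fun i => y i p) = 0 := fun p => congrFun hV p
    have hW' : ∀ i, Kz.bd Sum.inr (fun p => y i p) = 0 := fun i => congrFun hW i
    have hc : ((a + 1 + 1 : ℕ) : ℂ) ≠ 0 := Nat.cast_ne_zero.2 (by omega)
    let c : ℂ := ((a + 1 + 1 : ℕ) : ℂ)⁻¹
    let ζ : Fin m → Fin m → Fin n → Fin n → RR m n := fun j i q p =>
      (c * c) • Kz.D1 Sum.inl (fun i => Kz.D1 Sum.inr (y i) q p) j i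
    have z1 : ∀ i j p q, ζ i j p q = - ζ j i p q := by
      intro i j p q
      simp only [ζ, Kz.D1, ← smul_neg, neg_sub]
    have z2 : ∀ i j p q, ζ i j p q = - ζ i j q p := by
      intro i j p q
      simp only [ζ, Kz.D1, ← smul_neg, map_sub]; congr 1; ring
    have zB : ∀ i j p q, ζ i j p q ∈ Bi (f0 m n) a a := by
      intro i j p q
      have : ∀ i q p, Kz.D1 Sum.inr (y i) q p ∈ Bi (f0 m n) (a + 1) a := fun i q p =>
        Submodule.sub_mem _ (Bi_pd_inr (f0 m n) _ (hA _ _)) (Bi_pd_inr (f0 m n) _ (hA _ _))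
      exact Submodule.smul_mem _ _ (Submodule.sub_mem _ (Bi_pd_inl (f0 m n) _ (this _ _ _))
        (Bi_pd_inl (f0 m n) _ (this _ _ _)))
    refine ⟨fun w => ζ w.1.1.1 w.1.1.2 w.1.2.1 w.1.2.2, fun w _ => zB _ _ _ _, ?_⟩
    ext1 i; ext1 p
    rw [TT_apply]
    have h3 : ∀ j q, ex (fun w : MinorIdx m n => ζ w.1.1.1 w.1.1.2 w.1.2.1 w.1.2.2) j i q p =
        ζ j i q p := fun j q => ER ζ z1 z2 j i q p
    simp only [h3]
    have eW : ∀ j, Kz.bd Sum.inr (fun q => Kz.D1 Sum.inr (y j) q p) = ((a + 1 + 1 : ℕ) : ℂ) • y j p := by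
      intro j
      rw [Kz.kos1 _ Sum.inr_injective (y j) (a + 1) (fun q => Eu_inr (f0 m n) (hA j q)), hW' j,
        map_zero, sub_zero, nat_mul_eq]
    have eV : Kz.bd Sum.inl (fun j => Kz.D1 Sum.inl (fun i => y i p) j i) = ((a + 1 + 1 : ℕ) : ℂ) • y i p := by
      rw [Kz.kos1 _ Sum.inl_injective (fun i => y i p) (a + 1) (fun q => Eu_inl (f0 m n) (hA q p)), hV' p,
        map_zero, sub_zero, nat_mul_eq]
    have e5 : ∀ j, Kz.bd Sum.inr (fun q => ζ j i q p) =
        c • Kz.D1 Sum.inl (fun i => y i p) j i := by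
      intro j
      simp only [ζ]
      rw [Kz.bd_smul]
      change (c * c) • Kz.bd Sum.inr (fun q => pderiv (Sum.inl j) (Kz.D1 Sum.inr (y i) q p) -
        pderiv (Sum.inl i) (Kz.D1 Sum.inr (y j) q p)) =
        c • (pderiv (Sum.inl j) (y i p) - pderiv (Sum.inl i) (y j p))
      rw [Kz.bd_sub, ← Kz.pd_bd' Sum.inr (Sum.inl j) (by simp), ← Kz.pd_bd' Sum.inr (Sum.inl i) (by simp),
        eW, eW, Derivation.map_smul, Derivation.map_smul, ← smul_sub, smul_smul, mul_assoc, inv_mul_cancel₀ hc, mul_one]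
    simp only [bV, bW, e5]
    rw [Kz.bd_smul, eV, smul_smul, inv_mul_cancel₀ hc, one_smul]

theorem dim_main (a : ℕ) :
    Module.finrank ℂ (YY m n (a + 1)) + Module.finrank ℂ ↥(GG m n a ⊓ LinearMap.ker (TT m n)) =
    m.choose 2 * n.choose 2 * (Nat.multichoose m a * Nat.multichoose n a) := by
  haveI : FiniteDimensional ℂ (GG m n a) := pw_fin (MinorIdx m n) (Bi (f0 m n) a a)
  have := rn (GG m n a) (TT m n)
  rw [map_TT, finrank_GG] at this
  exact this

end Con



open MvPolynomial

namespace Con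

theorem arith_B (d k : ℕ) (hd : 5 ≤ d) (hk : 1 ≤ k) :
    Nat.choose (k + d - 2) (d - 1) * (d - 1) * (k - 1) / d + Nat.multichoose k d =
      k * Nat.multichoose k (d - 1) := by
  obtain ⟨e, rfl⟩ : ∃ e, d = e + 1 := ⟨d - 1, by omega⟩
  obtain ⟨j, rfl⟩ : ∃ j, k = j + 1 := ⟨k - 1, by omega⟩
  rw [Nat.multichoose_eq, Nat.multichoose_eq]
  have e1 : j + 1 + (e + 1) - 2 = j + e := by omega
  have e2 : j + 1 + (e + 1) - 1 = j + e + 1 := by omega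
  have e3 : j + 1 + (e + 1 - 1) - 1 = j + e := by omega
  rw [e1, e2, e3]
  simp only [Nat.add_sub_cancel]
  have h := Nat.add_one_mul_choose_eq (j + e) e
  generalize (j + e).choose e = s at *
  generalize (j + e + 1).choose (e + 1) = S at *
  have hle : S ≤ (j + 1) * s := by
    have : S * (e + 1) ≤ (j + 1) * s * (e + 1) := by rw [← h]; nlinarith [Nat.zero_le (j * e * s)]
    exact Nat.le_of_mul_le_mul_right this (Nat.succ_pos e)
  obtain ⟨B, hB⟩ := Nat.exists_eq_add_of_le hle
  have : s * e * j = (e + 1) * B := by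
    zify at *
    linear_combination (e + 1 : ℤ) * hB - h
  rw [this, Nat.mul_div_cancel_left _ (Nat.succ_pos e), hB, add_comm]

theorem arith_A (d k : ℕ) (hd : 5 ≤ d) (hk : 1 ≤ k) :
    Nat.choose (k + d - 3) (d - 2) * (d - 2) * (k - 1) * (k - 2) / (2 * d) +
    Nat.choose (k + d - 2) (d - 1) * (d - 1) * (k - 1) / d =
      k.choose 2 * Nat.multichoose k (d - 2) := by
  have hB := arith_B d k hd hk
  generalize hBB : Nat.choose (k + d - 2) (d - 1) * (d - 1) * (k - 1) / d = B at *
  obtain ⟨e, rfl⟩ : ∃ e, d = e + 2 := ⟨d - 2, by omega⟩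
  obtain ⟨j, rfl⟩ : ∃ j, k = j + 1 := ⟨k - 1, by omega⟩
  rw [Nat.multichoose_eq, Nat.multichoose_eq] at hB
  rw [Nat.multichoose_eq]
  have e1 : j + 1 + (e + 2) - 1 = j + e + 1 + 1 := by omega
  have e2 : j + 1 + (e + 2 - 1) - 1 = j + e + 1 := by omega
  have e3 : j + 1 + (e + 2) - 3 = j + e := by omega
  have e4 : j + 1 + (e + 2 - 2) - 1 = j + e := by omega
  have e5 : e + 2 - 1 = e + 1 := by omega
  rw [e1, e2, e5] at hB
  rw [e3, e4]
  have h := Nat.add_one_mul_choose_eq (j + e) e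
  have h' := Nat.add_one_mul_choose_eq (j + e + 1) (e + 1)
  have hc := Nat.triangle_succ j
  have hc2 : (j + 1).choose 2 * 2 = (j + 1) * j := by
    rw [Nat.choose_two_right, Nat.add_sub_cancel]
    exact Nat.div_mul_cancel (Nat.even_mul_pred_self (j + 1)).two_dvd
  simp only [Nat.add_sub_cancel]
  have e6 : j + 1 - 2 = j - 1 := by omega
  rw [e6]
  clear hc hBB e1 e2 e3 e4 e5 e6
  generalize (j + e).choose e = q at *
  generalize (j + e + 1).choose (e + 1) = s at *
  generalize (j + e + 1 + 1).choose (e + 1 + 1) = S at *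
  generalize (j + 1).choose 2 = c at *
  rcases Nat.eq_zero_or_pos j with rfl | hj
  · have hc0 : c = 0 := by omega
    subst hc0
    have : B = 0 := by
      zify at *
      have : (e + 2 : ℤ) * B = 0 := by linear_combination (e + 2 : ℤ) * hB + h'
      rcases mul_eq_zero.1 this with h | h
      · omega
      · exact h
    simp [this]
  · obtain ⟨i, rfl⟩ : ∃ i, j = i + 1 := ⟨j - 1, by omega⟩
    have key : q * e * (i + 1) * (i + 1 - 1) + 2 * (e + 2) * B = 2 * (e + 2) * (c * q) := by
      simp only [Nat.add_sub_cancel]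
      zify at *
      linear_combination 2 * (e + 2 : ℤ) * hB + 2 * h' - (e + 2 : ℤ) * q * hc2 - 2 * (i + 1) * h
    have hle : B ≤ c * q := by
      have : 2 * (e + 2) * B ≤ 2 * (e + 2) * (c * q) := by rw [← key]; exact Nat.le_add_left _ _
      exact Nat.le_of_mul_le_mul_left this (by omega)
    obtain ⟨A, hA⟩ := Nat.exists_eq_add_of_le hle
    have : q * e * (i + 1) * (i + 1 - 1) = 2 * (e + 2) * A := by
      rw [hA, add_comm] at key
      exact Nat.add_left_cancel (key.trans (mul_add _ _ _))
    rw [this, Nat.mul_div_cancel_left _ (by omega), hA, add_comm]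

end Con


/-- For `d ≥ 5`, with `A(k) = C(k+d−3, d−2)·(d−2)·(k−1)·(k−2)/(2d)` and
`B(k) = C(k+d−2, d−1)·(d−1)·(k−1)/d`, the degree-`d` part of the first Koszul
homology of the 2×2 minors, `Syz_d / Kos_d`, has dimension
`A(m)A(n) + A(m)B(n) + B(m)A(n)`. -/
theorem dim_koszul_homology_minors_high_degree (m n : ℕ) (hm : 1 ≤ m) (hn : 1 ≤ n)
    (d : ℕ) (hd : 5 ≤ d) (A B : ℕ → ℕ)
    (hA : ∀ k, A k = Nat.choose (k + d - 3) (d - 2) * (d - 2) * (k - 1) * (k - 2) / (2 * d))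
    (hB : ∀ k, B k = Nat.choose (k + d - 2) (d - 1) * (d - 1) * (k - 1) / d) :
    Module.finrank ℂ
      (↥(Syz m n d) ⧸ Submodule.comap (Syz m n d).subtype (Kos m n d)) =
      A m * A n + A m * B n + B m * A n := by
  have a1 := Con.arith_A d m hd hm
  have a2 := Con.arith_A d n hd hn
  have b1 := Con.arith_B d m hd hm
  have b2 := Con.arith_B d n hd hn
  rw [← hA, ← hB] at a1 a2
  rw [← hB] at b1 b2
  clear hA hB
  obtain ⟨κ, rfl⟩ : ∃ κ, d = κ + 4 := ⟨d - 4, by omega⟩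
  rw [Con.finrank_eq (by omega)]
  have h1 := Con.dim_main (m := m) (n := n) (κ + 2)
  have h2 := Con.finrank_YY (m := m) (n := n) (κ + 2 + 1)
  have h3 := Con.finrank_K (m := m) (n := n) (κ + 2 + 1)
  have h4 := Con.finrank_UV (m := m) (n := n) (κ + 2 + 1)
  have e1 : κ + 4 - 2 = κ + 2 := by omega
  have e2 : κ + 4 - 1 = κ + 2 + 1 := by omega
  have e3 : κ + 4 = κ + 2 + 1 + 1 := by omega
  rw [e1] at a1 a2
  rw [e2, e3] at b1 b2
  generalize Module.finrank ℂ ↥(Con.GG m n (κ + 2) ⊓ LinearMap.ker (Con.TT m n)) = x at *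
  generalize Module.finrank ℂ ↥(Con.YY m n (κ + 2 + 1)) = y at *
  generalize Module.finrank ℂ ↥(Con.UV m n (κ + 2 + 1)) = u at *
  generalize Module.finrank ℂ ↥(Con.AA m n (κ + 2 + 1) ⊓ LinearMap.ker (Con.dV m n)) = k at *
  generalize Nat.multichoose m (κ + 2) = q at *
  generalize Nat.multichoose n (κ + 2) = q' at *
  generalize Nat.multichoose m (κ + 2 + 1) = s at *
  generalize Nat.multichoose n (κ + 2 + 1) = s' at *
  generalize Nat.multichoose m (κ + 2 + 1 + 1) = S at *
  generalize Nat.multichoose n (κ + 2 + 1 + 1) = S' at *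
  generalize Nat.choose m 2 = c at *
  generalize Nat.choose n 2 = c' at *
  generalize A m = A1 at *
  generalize A n = A2 at *
  generalize B m = B1 at *
  generalize B n = B2 at *
  have hy : y = B1 * B2 := by
    zify at *
    have f1 : (B1 : ℤ) = m * s - S := by linarith
    have f2 : (B2 : ℤ) = n * s' - S' := by linarith
    rw [f1, f2]
    linear_combination h2 + h3 - h4
  zify at *
  have f1 : (A1 : ℤ) = c * q - B1 := by linarith
  have f2 : (A2 : ℤ) = c' * q' - B2 := by linarith
  rw [f1, f2]
  linear_combination h1 - hy
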